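/- arXiv:2508.10077 — 13 statements merged into one kernel-verified Lean document; each statement's English description precedes it below -/
import Mathlib

section
/- Let G be a finite connected simple graph of odd order n ≥ 3. Then π(G) ≤ (n+1)/4, and equality holds if and only if G is a path or a cycle. -/
open SimpleGraph Finset

theorem cycleGraph_odd_adj {m : ℕ} (hm : 1 ≤ m) (x y : Fin (2 * m + 1)) :
    (cycleGraph (2 * m + 1)).Adj x y ↔ x.val + 1 = y.val ∨ y.val + 1 = x.val ∨
      (x.val = 0 ∧ y.val = 2 * m) ∨ (y.val = 0 ∧ x.val = 2 * m) := by
  rw [cycleGraph_adj']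
  rcases lt_trichotomy x y with h | h | h
  · rw [Fin.coe_sub_iff_lt.2 h, Fin.coe_sub_iff_le.2 h.le]
    rw [Fin.lt_def] at h
    omega
  · subst h
    rw [show (x - x).val = 0 by simp]
    omega
  · rw [Fin.coe_sub_iff_lt.2 h, Fin.coe_sub_iff_le.2 h.le]
    rw [Fin.lt_def] at h
    omega

theorem sum_range_min_odd (m : ℕ) :
    ∑ k ∈ range (2 * m + 1), min k (2 * m + 1 - k) = m * (m + 1) := by
  have h1 : ∑ k ∈ range (m + 1), min k (2 * m + 1 - k) = ∑ k ∈ range (m + 1), k :=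
    sum_congr rfl fun k hk => by rw [mem_range] at hk; omega
  have h2 : ∑ k ∈ range m, min (m + 1 + k) (2 * m + 1 - (m + 1 + k)) =
      ∑ k ∈ range (m + 1), k := by
    rw [← sum_range_reflect (fun k => k), sum_range_succ]
    simp only [add_tsub_cancel_right, tsub_self, add_zero]
    exact sum_congr rfl fun k hk => by rw [mem_range] at hk; omega
  rw [show 2 * m + 1 = (m + 1) + m by ring, sum_range_add]
  rw [show m + 1 + m = 2 * m + 1 by ring, h1, h2, ← mul_two, sum_range_id_mul_two]
  simp [mul_comm]

/-- Circular distance from zero is `1`-Lipschitz. -/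
theorem min_val_sub_le_of_cycleGraph_adj {m : ℕ} (hm : 1 ≤ m) {x y : Fin (2 * m + 1)}
    (a : Fin (2 * m + 1)) (h : (cycleGraph (2 * m + 1)).Adj x y) :
    min (y - a).val (2 * m + 1 - (y - a).val) ≤
      min (x - a).val (2 * m + 1 - (x - a).val) + 1 := by
  have h' : (cycleGraph (2 * m + 1)).Adj (x - a) (y - a) := by
    rw [cycleGraph_adj'] at h ⊢
    simpa using h
  rw [cycleGraph_odd_adj hm] at h'
  omega

theorem mul_add_one_le_sum_dist {V : Type*} [Fintype V] {G : SimpleGraph V}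
    (hG : G.Connected) {m : ℕ} (hm : 1 ≤ m) (e : V ≃ Fin (2 * m + 1))
    (he : ∀ u w, G.Adj u w → (cycleGraph (2 * m + 1)).Adj (e u) (e w)) (v : V) :
    m * (m + 1) ≤ ∑ u, G.dist v u := by
  have key : ∀ {u w : V} (p : G.Walk u w),
      min (e w - e v).val (2 * m + 1 - (e w - e v).val) ≤
        min (e u - e v).val (2 * m + 1 - (e u - e v).val) + p.length := by
    intro u w p
    induction p with
    | nil => simp
    | cons h p ih =>
      have := min_val_sub_le_of_cycleGraph_adj hm (e v) (he _ _ h)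
      rw [Walk.length_cons]
      omega
  calc m * (m + 1) = ∑ k : Fin (2 * m + 1), min k.val (2 * m + 1 - k.val) := by
        rw [← sum_range_min_odd, Fin.sum_univ_eq_sum_range (fun k => min k (2 * m + 1 - k))]
    _ = ∑ u, min (e u - e v).val (2 * m + 1 - (e u - e v).val) :=
        ((e.trans (Equiv.subRight (e v))).sum_comp
          (fun k => min k.val (2 * m + 1 - k.val))).symm
    _ ≤ ∑ u, G.dist v u := by
        refine sum_le_sum fun u _ => ?_
        obtain ⟨p, hp⟩ := hG.exists_walk_length_eq_dist v u
        have := key p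
        rw [← hp]
        simpa using this

theorem mul_add_one_le_sum_dist_of_iso {V : Type*} [Fintype V] {G : SimpleGraph V}
    (hG : G.Connected) {m : ℕ} (hm : 1 ≤ m)
    (h : Nonempty (G ≃g pathGraph (2 * m + 1)) ∨ Nonempty (G ≃g cycleGraph (2 * m + 1)))
    (v : V) : m * (m + 1) ≤ ∑ u, G.dist v u := by
  rcases h with ⟨⟨e⟩⟩ | ⟨⟨e⟩⟩
  · refine mul_add_one_le_sum_dist hG hm e.toEquiv (fun u w h => ?_) v
    rw [← e.map_adj_iff, pathGraph_adj] at h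
    rw [cycleGraph_odd_adj hm]
    exact h.imp id Or.inl
  · exact mul_add_one_le_sum_dist hG hm e.toEquiv (fun u w => e.map_adj_iff.2) v

section

variable {V : Type*} {G : SimpleGraph V}

/-- `p` sends every vertex other than `v` to a neighbour that is closer to `v`. -/
def IsParentMap (G : SimpleGraph V) (v : V) (p : V → V) : Prop :=
  ∀ u, u ≠ v → G.Adj (p u) u ∧ G.dist v (p u) + 1 = G.dist v u

/-- `x ≠ v` lies on the chain of iterated parents of `u`. -/
def IsAncestor (G : SimpleGraph V) (v : V) (p : V → V) (x u : V) : Prop :=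
  ∃ k < G.dist v u, p^[k] u = x

/-- The neighbour of `v` among the iterated parents of `u`. -/
noncomputable def branchRoot (G : SimpleGraph V) (v : V) (p : V → V) (u : V) : V :=
  p^[G.dist v u - 1] u

theorem exists_isParentMap (hG : G.Connected) (v : V) : ∃ p, IsParentMap G v p := by
  have h : ∀ u, ∃ x, u ≠ v → G.Adj x u ∧ G.dist v x + 1 = G.dist v u := by
    intro u
    by_cases hu : u = v
    · exact ⟨v, fun h => absurd hu h⟩
    obtain ⟨q, hq⟩ := hG.exists_walk_length_eq_dist u v
    cases q with
    | nil => exact absurd rfl hu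
    | @cons _ x _ hadj q =>
      refine ⟨x, fun _ => ⟨hadj.symm, ?_⟩⟩
      have h1 := dist_le q
      have h2 := hG.dist_triangle (u := u) (v := x) (w := v)
      rw [dist_eq_one_iff_adj.2 hadj] at h2
      rw [Walk.length_cons] at hq
      rw [dist_comm, dist_comm (u := v)]
      omega
  choose p hp using h
  exact ⟨p, hp⟩

namespace IsParentMap

variable {v : V} {p : V → V}

theorem dist_iterate (hp : IsParentMap G v p) {u : V} {k : ℕ} (hk : k ≤ G.dist v u) :
    G.dist v (p^[k] u) + k = G.dist v u := by
  induction k with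
  | zero => rfl
  | succ k ih =>
    have h1 := ih (by omega)
    have h2 : p^[k] u ≠ v := by
      rintro h
      rw [h, dist_self] at h1
      omega
    rw [Function.iterate_succ_apply']
    have := (hp _ h2).2
    omega

theorem dist_iterate_le (hG : G.Connected) (hp : IsParentMap G v p) {u : V} {k : ℕ}
    (hk : k ≤ G.dist v u) : G.dist (p^[k] u) u ≤ k := by
  induction k with
  | zero => simp
  | succ k ih =>
    have h1 := ih (by omega)
    have h2 : p^[k] u ≠ v := by
      rintro h
      have := hp.dist_iterate (u := u) (k := k) (by omega)
      rw [h, dist_self] at this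
      omega
    rw [Function.iterate_succ_apply']
    have h3 := dist_eq_one_iff_adj.2 (hp _ h2).1
    have := hG.dist_triangle (u := p (p^[k] u)) (v := p^[k] u) (w := u)
    omega

theorem adj_branchRoot (hG : G.Connected) (hp : IsParentMap G v p) {u : V} (hu : u ≠ v) :
    G.Adj v (branchRoot G v p u) := by
  have h1 := hG.pos_dist_of_ne hu.symm
  have h2 := hp.dist_iterate (u := u) (k := G.dist v u - 1) (by omega)
  rw [← dist_eq_one_iff_adj]
  unfold branchRoot
  omega

theorem dist_branchRoot_lt (hG : G.Connected) (hp : IsParentMap G v p) {u : V} (hu : u ≠ v) :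
    G.dist (branchRoot G v p u) u < G.dist v u := by
  have h1 := hG.pos_dist_of_ne hu.symm
  have h2 := hp.dist_iterate_le hG (u := u) (k := G.dist v u - 1) (by omega)
  unfold branchRoot
  omega

theorem branchRoot_eq_of_isAncestor (hp : IsParentMap G v p) {x u : V}
    (h : IsAncestor G v p x u) : branchRoot G v p x = branchRoot G v p u := by
  obtain ⟨k, hk, rfl⟩ := h
  have := hp.dist_iterate hk.le
  unfold branchRoot
  rw [← Function.iterate_add_apply]
  congr 2
  omega

theorem ne_of_isAncestor (hp : IsParentMap G v p) {x u : V}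
    (h : IsAncestor G v p x u) : x ≠ v := by
  obtain ⟨k, hk, rfl⟩ := h
  have := hp.dist_iterate hk.le
  intro h
  rw [h, dist_self] at this
  omega

theorem eq_of_isAncestor (hp : IsParentMap G v p) {x u : V}
    (h : IsAncestor G v p x u) (hd : G.dist v u ≤ G.dist v x) : x = u := by
  obtain ⟨k, hk, rfl⟩ := h
  have := hp.dist_iterate hk.le
  obtain rfl : k = 0 := by omega
  rfl

theorem adj_of_isAncestor (hp : IsParentMap G v p) {x u : V}
    (h : IsAncestor G v p x u) (hd : G.dist v u = G.dist v x + 1) : G.Adj x u := by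
  obtain ⟨k, hk, rfl⟩ := h
  have := hp.dist_iterate hk.le
  obtain rfl : k = 1 := by omega
  refine (hp u ?_).1
  rintro rfl
  simp at hk

open Classical in
theorem card_isAncestor [Fintype V] (hp : IsParentMap G v p) (u : V) :
    #{x | IsAncestor G v p x u} = G.dist v u := by
  have h : ({x | IsAncestor G v p x u} : Finset V) =
      (range (G.dist v u)).image (fun k => p^[k] u) := by
    ext x
    rw [mem_filter, mem_image]
    simp only [IsAncestor, mem_univ, true_and, mem_range]
  rw [h, card_image_of_injOn, card_range]
  intro i hi j hj hij
  simp only [coe_range, Set.mem_Iio] at hi hj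
  have h1 := hp.dist_iterate hi.le
  have h2 := hp.dist_iterate hj.le
  simp only at hij
  rw [hij] at h1
  omega

open Classical in
/-- Counting comparable pairs in the rooted tree given by `p` gives twice the distance sum. -/
theorem two_mul_sum_dist [Fintype V] (hG : G.Connected) (hp : IsParentMap G v p) :
    2 * ∑ u, G.dist v u =
      ∑ u ∈ univ.erase v, (#{x | IsAncestor G v p x u ∨ IsAncestor G v p u x} + 1) := by
  have h1 : ∑ u, G.dist v u = ∑ u, #{x | IsAncestor G v p x u} :=
    sum_congr rfl fun u _ => (hp.card_isAncestor u).symm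
  have h2 : ∑ u, #{x | IsAncestor G v p x u} = ∑ u, #{x | IsAncestor G v p u x} :=
    (sum_card_bipartiteAbove_eq_sum_card_bipartiteBelow (s := univ) (t := univ)
      (r := fun u x => IsAncestor G v p u x)).symm
  rw [two_mul]
  nth_rewrite 2 [h1]
  rw [h2, h1, ← sum_add_distrib, ← add_sum_erase univ _ (mem_univ v)]
  have h3 : #{x | IsAncestor G v p x v} = 0 := by rw [hp.card_isAncestor, dist_self]
  have h4 : #{x | IsAncestor G v p v x} = 0 := by
    rw [card_eq_zero, filter_eq_empty_iff]
    exact fun x _ h => hp.ne_of_isAncestor h rfl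
  rw [h3, h4, zero_add, zero_add]
  refine sum_congr rfl fun u hu => ?_
  rw [mem_erase] at hu
  rw [filter_or, ← card_union_add_card_inter, ← filter_and]
  congr 1
  rw [card_eq_one]
  refine ⟨u, ?_⟩
  ext x
  simp only [mem_filter, mem_univ, true_and, mem_singleton]
  constructor
  · rintro ⟨h, k, hk, rfl⟩
    refine hp.eq_of_isAncestor h ?_
    have := hp.dist_iterate hk.le
    omega
  · rintro rfl
    have hpos := hG.pos_dist_of_ne hu.1.symm
    exact ⟨⟨0, hpos, rfl⟩, 0, hpos, rfl⟩

end IsParentMap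

open Classical in
theorem card_closer_add_card_union_le [Fintype V] {v w : V} (hG : G.Connected) (hadj : G.Adj v w)
    (hmin : ∑ u, G.dist v u ≤ ∑ u, G.dist w u) (S : Finset V)
    (hS : ∀ u ∈ S, G.dist w u ≤ G.dist v u) :
    #{u | G.dist w u < G.dist v u} +
      #(({u | G.dist w u < G.dist v u} : Finset V) ∪ S) ≤ Fintype.card V := by
  have key : ∑ u, (G.dist w u + ((if G.dist w u < G.dist v u then 1 else 0) +
      (if u ∈ ({u | G.dist w u < G.dist v u} : Finset V) ∪ S then 1 else 0))) ≤
      ∑ u, (G.dist v u + 1) := by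
    refine sum_le_sum fun u _ => ?_
    have h1 := hG.dist_triangle (u := w) (v := v) (w := u)
    rw [dist_eq_one_iff_adj.2 hadj.symm] at h1
    have h2 := hS u
    simp only [mem_union, mem_filter, mem_univ, true_and]
    split_ifs with h3 h4 h5 <;> first | omega | (have := hS u; grind)
  rw [sum_add_distrib, sum_add_distrib, sum_add_distrib, ← card_filter, ← card_filter] at key
  simp only [sum_const, card_univ, smul_eq_mul, mul_one, filter_mem_eq_inter, univ_inter] at key
  omega

section Minimal

variable [Fintype V] {v : V} {p : V → V} {m : ℕ}

open Classical in
theorem card_closer_le (hG : G.Connected) (hcard : Fintype.card V = 2 * m + 1)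
    (hmin : ∀ w, ∑ u, G.dist v u ≤ ∑ u, G.dist w u) {w : V} (hadj : G.Adj v w) :
    #{u | G.dist w u < G.dist v u} ≤ m := by
  have := card_closer_add_card_union_le hG hadj (hmin w) ∅ (by simp)
  rw [union_empty] at this
  omega

open Classical in
theorem comparable_subset_branch (hp : IsParentMap G v p) {u : V} (hu : u ≠ v) :
    ({x | IsAncestor G v p x u ∨ IsAncestor G v p u x} : Finset V) ⊆
      ({x | x ≠ v ∧ branchRoot G v p x = branchRoot G v p u} : Finset V) := by
  intro x
  simp only [mem_filter, mem_univ, true_and]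
  rintro (h | h)
  · exact ⟨hp.ne_of_isAncestor h, hp.branchRoot_eq_of_isAncestor h⟩
  · refine ⟨?_, (hp.branchRoot_eq_of_isAncestor h).symm⟩
    rintro rfl
    obtain ⟨k, hk, -⟩ := h
    simp at hk

open Classical in
theorem branch_subset_closer (hG : G.Connected) (hp : IsParentMap G v p) (w : V) :
    ({x | x ≠ v ∧ branchRoot G v p x = w} : Finset V) ⊆
      ({x | G.dist w x < G.dist v x} : Finset V) := by
  intro x
  simp only [mem_filter, mem_univ, true_and]
  rintro ⟨h, rfl⟩
  exact hp.dist_branchRoot_lt hG h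

open Classical in
theorem card_comparable_le (hG : G.Connected) (hcard : Fintype.card V = 2 * m + 1)
    (hmin : ∀ w, ∑ u, G.dist v u ≤ ∑ u, G.dist w u) (hp : IsParentMap G v p)
    {u : V} (hu : u ≠ v) : #{x | IsAncestor G v p x u ∨ IsAncestor G v p u x} ≤ m :=
  (card_le_card ((comparable_subset_branch hp hu).trans (branch_subset_closer hG hp _))).trans
    (card_closer_le hG hcard hmin (hp.adj_branchRoot hG hu))

theorem sum_dist_le (hG : G.Connected) (hcard : Fintype.card V = 2 * m + 1)
    (hmin : ∀ w, ∑ u, G.dist v u ≤ ∑ u, G.dist w u) :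
    ∑ u, G.dist v u ≤ m * (m + 1) := by
  classical
  obtain ⟨p, hp⟩ := exists_isParentMap hG v
  have h1 := hp.two_mul_sum_dist hG
  have h2 : ∑ u ∈ univ.erase v, (#{x | IsAncestor G v p x u ∨ IsAncestor G v p u x} + 1) ≤
      ∑ u ∈ univ.erase v, (m + 1) :=
    sum_le_sum fun u hu =>
      Nat.add_le_add_right (card_comparable_le hG hcard hmin hp (ne_of_mem_erase hu)) 1
  rw [sum_const, card_erase_of_mem (mem_univ v), card_univ, hcard, ← h1, smul_eq_mul,
    Nat.add_sub_cancel] at h2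
  nlinarith

open Classical in
theorem card_comparable_eq (hG : G.Connected) (hcard : Fintype.card V = 2 * m + 1)
    (hmin : ∀ w, ∑ u, G.dist v u ≤ ∑ u, G.dist w u)
    (heq : ∑ u, G.dist v u = m * (m + 1)) (hp : IsParentMap G v p)
    {u : V} (hu : u ≠ v) : #{x | IsAncestor G v p x u ∨ IsAncestor G v p u x} = m := by
  have h1 := hp.two_mul_sum_dist hG
  have h2 := (sum_eq_sum_iff_of_le (s := univ.erase v)
    (f := fun u => #{x | IsAncestor G v p x u ∨ IsAncestor G v p u x} + 1)
    (g := fun _ => m + 1) fun u hu =>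
      Nat.add_le_add_right (card_comparable_le hG hcard hmin hp (ne_of_mem_erase hu)) 1).1 (by
    rw [sum_const, card_erase_of_mem (mem_univ v), card_univ, hcard, ← h1, smul_eq_mul,
      Nat.add_sub_cancel, heq]
    ring) u (mem_erase.2 ⟨hu, mem_univ u⟩)
  exact Nat.succ_injective h2

/-- The structure of a connected graph of order `2 * m + 1` seen from a median vertex whose
distance sum is the extremal value `m * (m + 1)`. -/
theorem exists_branch_of_sum_dist_eq (hG : G.Connected) (hm : 1 ≤ m)
    (hcard : Fintype.card V = 2 * m + 1)
    (hmin : ∀ w, ∑ u, G.dist v u ≤ ∑ u, G.dist w u)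
    (heq : ∑ u, G.dist v u = m * (m + 1)) :
    ∃ s : V → Prop,
      (∀ u, G.dist v u ≤ m) ∧
      (∀ x y, x ≠ v → y ≠ v → (s x ↔ s y) → G.dist v x = G.dist v y → x = y) ∧
      (∀ x y, (x = v ∨ (s x ↔ s y)) → G.dist v y = G.dist v x + 1 → G.Adj x y) ∧
      (∀ x y, G.Adj x y → x ≠ v → y ≠ v → s x → ¬ s y →
        G.dist v x = m ∧ G.dist v y = m) := by
  classical
  obtain ⟨p, hp⟩ := exists_isParentMap hG v
  have hcomp : ∀ u, u ≠ v → #{x | IsAncestor G v p x u ∨ IsAncestor G v p u x} = m :=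
    fun u hu => card_comparable_eq hG hcard hmin heq hp hu
  have hclo : ∀ u, u ≠ v →
      #{x | G.dist (branchRoot G v p u) x < G.dist v x} ≤ m :=
    fun u hu => card_closer_le hG hcard hmin (hp.adj_branchRoot hG hu)
  have hcb : ∀ u, u ≠ v →
      ({x | IsAncestor G v p x u ∨ IsAncestor G v p u x} : Finset V) =
        ({x | x ≠ v ∧ branchRoot G v p x = branchRoot G v p u} : Finset V) := fun u hu =>
    eq_of_subset_of_card_le (comparable_subset_branch hp hu) <|
      ((card_le_card (branch_subset_closer hG hp _)).trans (hclo u hu)).trans (hcomp u hu).ge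
  have hbc : ∀ u, u ≠ v →
      ({x | x ≠ v ∧ branchRoot G v p x = branchRoot G v p u} : Finset V) =
        ({x | G.dist (branchRoot G v p u) x < G.dist v x} : Finset V) := fun u hu =>
    eq_of_subset_of_card_le (branch_subset_closer hG hp _) <|
      (hclo u hu).trans (by rw [← hcb u hu, hcomp u hu])
  have hbcard : ∀ u, u ≠ v →
      #{x | x ≠ v ∧ branchRoot G v p x = branchRoot G v p u} = m := fun u hu => by
    rw [← hcb u hu, hcomp u hu]
  have hchain : ∀ x y, x ≠ v → y ≠ v → branchRoot G v p x = branchRoot G v p y →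
      IsAncestor G v p x y ∨ IsAncestor G v p y x := fun x y hx hy h => by
    have : x ∈ ({x | x ≠ v ∧ branchRoot G v p x = branchRoot G v p y} : Finset V) := by
      simp [hx, h]
    rw [← hcb y hy] at this
    simpa using this
  have hle : ∀ u, G.dist v u ≤ m := fun u => by
    rcases eq_or_ne u v with rfl | hu
    · simp
    rw [← hp.card_isAncestor u, ← hcomp u hu]
    exact card_le_card fun x => by simpa using Or.inl
  have hinj : ∀ x y, x ≠ v → y ≠ v → branchRoot G v p x = branchRoot G v p y →
      G.dist v x = G.dist v y → x = y := fun x y hx hy h hd => by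
    rcases hchain x y hx hy h with h | h
    · exact hp.eq_of_isAncestor h hd.ge
    · exact (hp.eq_of_isAncestor h hd.le).symm
  have hadj : ∀ x y, x ≠ v → branchRoot G v p x = branchRoot G v p y →
      G.dist v y = G.dist v x + 1 → G.Adj x y := fun x y hx h hd => by
    have hy : y ≠ v := by
      rintro rfl
      simp at hd
    rcases hchain x y hx hy h with h | h
    · exact hp.adj_of_isAncestor h hd
    · have := hp.eq_of_isAncestor h (by omega)
      subst this
      omega
  have hsucc : ∀ y, y ≠ v → G.dist v y < m →
      ∃ z, z ≠ v ∧ branchRoot G v p z = branchRoot G v p y ∧ G.dist v z = G.dist v y + 1 := by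
    intro y hy hlt
    have himg : ({x | x ≠ v ∧ branchRoot G v p x = branchRoot G v p y} : Finset V).image
        (G.dist v) = Icc 1 m := by
      refine eq_of_subset_of_card_le ?_ ?_
      · intro k
        simp only [mem_image, mem_filter, mem_univ, true_and, mem_Icc]
        rintro ⟨x, ⟨hx, -⟩, rfl⟩
        exact ⟨hG.pos_dist_of_ne hx.symm, hle x⟩
      · rw [card_image_of_injOn, hbcard y hy, Nat.card_Icc, Nat.add_sub_cancel]
        intro a ha b hb hab
        simp only [coe_filter, mem_univ, true_and, Set.mem_ofPred_eq] at ha hb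
        exact hinj a b ha.1 hb.1 (ha.2.trans hb.2.symm) hab
    have : G.dist v y + 1 ∈ Icc 1 m := by
      rw [mem_Icc]
      omega
    rw [← himg] at this
    simpa [and_assoc] using this
  have hfar : ∀ x y, x ≠ v → y ≠ v → branchRoot G v p x ≠ branchRoot G v p y →
      G.dist v y ≤ G.dist (branchRoot G v p x) y := fun x y hx hy h => by
    by_contra! hlt
    have : y ∈ ({z | G.dist (branchRoot G v p x) z < G.dist v z} : Finset V) := by simpa
    rw [← hbc x hx] at this
    simp [hy, h.symm] at this
  have hnear : ∀ x y, x ≠ v → G.Adj x y →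
      G.dist (branchRoot G v p x) y ≤ G.dist v x := fun x y hx h => by
    have h1 := hp.dist_branchRoot_lt hG hx
    have h2 := hG.dist_triangle (u := branchRoot G v p x) (v := x) (w := y)
    rw [dist_eq_one_iff_adj.2 h] at h2
    omega
  have hcross : ∀ x y, G.Adj x y → x ≠ v → y ≠ v →
      branchRoot G v p x ≠ branchRoot G v p y → G.dist v x = m ∧ G.dist v y = m := by
    intro x y h hx hy hne
    have h1 := (hfar x y hx hy hne).trans (hnear x y hx h)
    have h2 := (hfar y x hy hx hne.symm).trans (hnear y x hy h.symm)
    by_contra hcon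
    have hlt : G.dist v y < m := by
      have := hle y
      omega
    obtain ⟨z, hz, hzb, hzd⟩ := hsucc y hy hlt
    have hyz := dist_eq_one_iff_adj.2 (hadj y z hy hzb.symm hzd)
    have h3 := hnear x y hx h
    have h4 := hG.dist_triangle (u := branchRoot G v p x) (v := y) (w := z)
    have h5 := card_closer_add_card_union_le hG (hp.adj_branchRoot hG hx) (hmin _) {y, z} (by
      intro u hu
      rw [mem_insert, mem_singleton] at hu
      rcases hu with rfl | rfl <;> omega)
    rw [← hbc x hx, card_union_of_disjoint, hbcard x hx, card_pair, hcard] at h5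
    · omega
    · rintro rfl
      omega
    · rw [Finset.disjoint_left]
      intro u hu hu'
      rw [mem_insert, mem_singleton] at hu'
      rw [mem_filter] at hu
      rcases hu' with rfl | rfl
      · exact hne hu.2.2.symm
      · exact hne (hu.2.2.symm.trans hzb)
  have hcard' : #(univ.erase v) = 2 * m := by
    rw [card_erase_of_mem (mem_univ v), card_univ, hcard, Nat.add_sub_cancel]
  obtain ⟨a, ha⟩ : (univ.erase v).Nonempty := by
    rw [← card_pos]
    omega
  have ha := ne_of_mem_erase ha
  have htwo : ∀ x y, x ≠ v → y ≠ v → branchRoot G v p x ≠ branchRoot G v p a →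
      branchRoot G v p y ≠ branchRoot G v p a → branchRoot G v p x = branchRoot G v p y := by
    intro x y hx hy hxa hya
    by_contra hxy
    have hsub : ({z | z ≠ v ∧ branchRoot G v p z = branchRoot G v p a} : Finset V) ∪
        ({z | z ≠ v ∧ branchRoot G v p z = branchRoot G v p x} : Finset V) ⊆
        (univ.erase v).erase y := by
      intro z
      simp only [mem_union, mem_filter, mem_univ, true_and, mem_erase, and_true]
      rintro (⟨h1, h2⟩ | ⟨h1, h2⟩)
      · exact ⟨by rintro rfl; exact hya h2, h1⟩
      · exact ⟨by rintro rfl; exact hxy h2.symm, h1⟩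
    have := card_le_card hsub
    rw [card_union_of_disjoint, hbcard a ha, hbcard x hx,
      card_erase_of_mem (mem_erase.2 ⟨hy, mem_univ y⟩), hcard'] at this
    · omega
    · rw [Finset.disjoint_left]
      intro z h1 h2
      rw [mem_filter] at h1 h2
      exact hxa (h2.2.2.symm.trans h1.2.2)
  have hsame : ∀ x y, x ≠ v → y ≠ v →
      (branchRoot G v p x = branchRoot G v p a ↔ branchRoot G v p y = branchRoot G v p a) →
      branchRoot G v p x = branchRoot G v p y := fun x y hx hy h => by
    by_cases hxa : branchRoot G v p x = branchRoot G v p a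
    · exact hxa.trans (h.1 hxa).symm
    · exact htwo x y hx hy hxa fun hya => hxa (h.2 hya)
  refine ⟨fun x => branchRoot G v p x = branchRoot G v p a, hle,
    fun x y hx hy h => hinj x y hx hy (hsame x y hx hy h), ?_,
    fun x y h hx hy hs ht => hcross x y h hx hy fun h' => ht (h'.symm.trans hs)⟩
  intro x y h hd
  rcases eq_or_ne x v with rfl | hx
  · rw [dist_self] at hd
    exact dist_eq_one_iff_adj.1 hd
  · have hy : y ≠ v := by
      rintro rfl
      simp at hd
    exact hadj x y hx (hsame x y hx hy (h.resolve_left hx)) hd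

theorem iso_of_sum_dist_eq (hG : G.Connected) (hm : 1 ≤ m)
    (hcard : Fintype.card V = 2 * m + 1)
    (hmin : ∀ w, ∑ u, G.dist v u ≤ ∑ u, G.dist w u)
    (heq : ∑ u, G.dist v u = m * (m + 1)) :
    Nonempty (G ≃g pathGraph (2 * m + 1)) ∨ Nonempty (G ≃g cycleGraph (2 * m + 1)) := by
  classical
  obtain ⟨s, hle, hinj, hadj, hcross⟩ := exists_branch_of_sum_dist_eq hG hm hcard hmin heq
  have hpos : ∀ u, u ≠ v → 1 ≤ G.dist v u := fun u hu => hG.pos_dist_of_ne hu.symm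
  have hv : G.dist v v = 0 := dist_self
  let f : V → Fin (2 * m + 1) := fun u =>
    if s u then ⟨m - G.dist v u, by omega⟩ else ⟨m + G.dist v u, by have := hle u; omega⟩
  have hf1 : ∀ u, s u → (f u).val + G.dist v u = m := fun u hu => by
    have := hle u
    simp only [f, if_pos hu]
    omega
  have hf2 : ∀ u, ¬ s u → (f u).val = m + G.dist v u := fun u hu => by
    simp only [f, if_neg hu]
  have hfinj : Function.Injective f := by
    intro x y h
    have h := congrArg Fin.val h
    by_cases hx : x = v <;> by_cases hy : y = v
    · rw [hx, hy]
    all_goals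
      have := hinj x y
      have := hf1 x
      have := hf1 y
      have := hf2 x
      have := hf2 y
      have := hpos x
      have := hpos y
      by_cases hsx : s x <;> by_cases hsy : s y <;> grind
  let e : V ≃ Fin (2 * m + 1) := Equiv.ofBijective f
    ((Fintype.bijective_iff_injective_and_card f).2 ⟨hfinj, by simpa using hcard⟩)
  have hlip : ∀ x y, G.Adj x y → G.dist v y ≤ G.dist v x + 1 := fun x y h => by
    have := hG.dist_triangle (u := v) (v := x) (w := y)
    rwa [dist_eq_one_iff_adj.2 h] at this
  have hsucc : ∀ x y, (f x).val + 1 = (f y).val → G.Adj x y := by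
    intro x y h
    have h1 := hadj x y
    have h2 := hadj y x
    have h3 := G.adj_comm x y
    have := hf1 x
    have := hf1 y
    have := hf2 x
    have := hf2 y
    have := hpos x
    have := hpos y
    by_cases hsx : s x <;> by_cases hsy : s y <;> grind
  have hcyc : ∀ x y, G.Adj x y → (f x).val + 1 = (f y).val ∨ (f y).val + 1 = (f x).val ∨
      ((f x).val = 0 ∧ (f y).val = 2 * m) ∨ ((f y).val = 0 ∧ (f x).val = 2 * m) := by
    intro x y h
    have h1 := hcross x y h
    have h2 := hcross y x h.symm
    have h3 := hlip x y h
    have h4 := hlip y x h.symm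
    have h5 := hinj x y
    have h6 := h.ne
    have := hf1 x
    have := hf1 y
    have := hf2 x
    have := hf2 y
    have := hpos x
    have := hpos y
    by_cases hx : x = v <;> by_cases hy : y = v <;> by_cases hsx : s x <;>
      by_cases hsy : s y <;> grind
  by_cases hend : ∃ x y, G.Adj x y ∧ (f x).val = 0 ∧ (f y).val = 2 * m
  · obtain ⟨a, b, hab, ha, hb⟩ := hend
    have hclose : ∀ x y, (f x).val = 0 → (f y).val = 2 * m → G.Adj x y := by
      intro x y hx hy
      rwa [hfinj (Fin.ext (hx.trans ha.symm)), hfinj (Fin.ext (hy.trans hb.symm))]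
    refine Or.inr ⟨⟨e, ?_⟩⟩
    intro x y
    rw [cycleGraph_odd_adj hm]
    refine ⟨?_, hcyc x y⟩
    rintro (h | h | h | h)
    · exact hsucc x y h
    · exact (hsucc y x h).symm
    · exact hclose x y h.1 h.2
    · exact (hclose y x h.1 h.2).symm
  · push Not at hend
    refine Or.inl ⟨⟨e, ?_⟩⟩
    intro x y
    rw [pathGraph_adj]
    refine ⟨?_, fun h => ?_⟩
    · rintro (h | h)
      · exact hsucc x y h
      · exact (hsucc y x h).symm
    · rcases hcyc x y h with h' | h' | h' | h'
      · exact Or.inl h'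
      · exact Or.inr h'
      · exact absurd h'.2 (hend x y h h'.1)
      · exact absurd h'.2 (hend y x h.symm h'.1)

end Minimal

end

/-- Let `G` be a finite connected simple graph of odd order `n ≥ 3`.
Then the proximity `π(G)` satisfies `π(G) ≤ (n+1)/4`, with equality iff `G` is a path
or a cycle. -/
theorem proximity_le_of_odd_order
    {V : Type*} [Fintype V] (G : SimpleGraph V) (hG : G.Connected)
    (n : ℕ) (hn : Fintype.card V = n) (hn3 : 3 ≤ n) (hodd : Odd n) :
    (⨅ v : V, (∑ u : V, (G.dist v u : ℝ)) / (n - 1)) ≤ (n + 1) / 4 ∧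
    ((⨅ v : V, (∑ u : V, (G.dist v u : ℝ)) / (n - 1)) = (n + 1) / 4 ↔
      (Nonempty (G ≃g pathGraph n) ∨ Nonempty (G ≃g cycleGraph n))) := by
  obtain ⟨m, rfl⟩ := hodd
  have hm : 1 ≤ m := by omega
  have hm' : (0 : ℝ) < m := by exact_mod_cast hm
  have := hG.nonempty
  obtain ⟨v, hv⟩ := Finite.exists_min fun v => ∑ u, G.dist v u
  have hle := sum_dist_le hG hn hv
  have hden : ((2 * m + 1 : ℕ) : ℝ) - 1 = 2 * m := by
    push_cast
    ring
  have hinf : (⨅ v : V, (∑ u : V, (G.dist v u : ℝ)) / (((2 * m + 1 : ℕ) : ℝ) - 1)) =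
      ((∑ u, G.dist v u : ℕ) : ℝ) / (2 * m) := by
    rw [hden]
    refine le_antisymm ?_ (le_ciInf fun w => ?_)
    · rw [Nat.cast_sum]
      exact ciInf_le (Set.finite_range _).bddBelow v
    · rw [← Nat.cast_sum]
      have := hv w
      gcongr
  have hval : (((2 * m + 1 : ℕ) : ℝ) + 1) / 4 = ((m * (m + 1) : ℕ) : ℝ) / (2 * m) := by
    push_cast
    field_simp
    ring
  rw [hinf, hval]
  refine ⟨by gcongr, ?_⟩
  rw [div_left_inj' (by positivity), Nat.cast_inj]
  exact ⟨iso_of_sum_dist_eq hG hm hn hv, fun h =>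
    hle.antisymm (mul_add_one_le_sum_dist_of_iso hG hm h v)⟩
end

section
/- Let G be a finite connected simple graph of even order n ≥ 2. Then π(G) ≤ (n+1)/4 + 1/(4(n−1)), and equality holds if and only if G is a path or a cycle. -/
open SimpleGraph Finset

section

variable {V : Type*} {G : SimpleGraph V}

/-- A geodesic from `a` to `b` has a vertex at each intermediate distance. -/
lemma exists_dist_eq_of_le_dist (hG : G.Connected) {a b : V} {i : ℕ} (hi : i ≤ G.dist a b) :
    ∃ y, G.dist a y = i ∧ i + G.dist y b = G.dist a b := by
  obtain ⟨p, hp⟩ := hG.exists_walk_length_eq_dist a b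
  refine ⟨p.getVert i, ?_⟩
  have h1 := SimpleGraph.dist_le (p.take i)
  have h2 := SimpleGraph.dist_le (p.drop i)
  have h3 := hG.dist_triangle (u := a) (v := p.getVert i) (w := b)
  rw [SimpleGraph.Walk.take_length] at h1
  rw [SimpleGraph.Walk.drop_length] at h2
  omega

/-- If `z` is strictly closer to the neighbour `u` of `v` than to `v`, then a geodesic from `v` to
`z` through `u` has a vertex at each positive distance from `v`, again closer to `u`. -/
lemma exists_closer_dist_eq (hG : G.Connected) {u v z : V} (huv : G.Adj v u)
    (hz : G.dist u z + 1 = G.dist v z) {i : ℕ} (hi : 1 ≤ i) (hiz : i ≤ G.dist v z) :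
    ∃ y, G.dist u y + 1 = G.dist v y ∧ G.dist v y = i ∧ i + G.dist y z = G.dist v z := by
  obtain ⟨y, h1, h2⟩ := exists_dist_eq_of_le_dist hG (a := u) (b := z) (i := i - 1) (by omega)
  have h3 := hG.dist_triangle (u := v) (v := u) (w := y)
  have h4 := hG.dist_triangle (u := v) (v := y) (w := z)
  rw [SimpleGraph.dist_eq_one_iff_adj.2 huv] at h3
  exact ⟨y, by omega, by omega, by omega⟩

/-- A vertex `z ≠ v` is closer to some neighbour of `v` than to `v`. -/
lemma exists_adj_closer (hG : G.Connected) {v z : V} (hz : 1 ≤ G.dist v z) :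
    ∃ u, G.Adj v u ∧ G.dist u z + 1 = G.dist v z := by
  obtain ⟨u, h1, h2⟩ := exists_dist_eq_of_le_dist hG hz
  exact ⟨u, SimpleGraph.dist_eq_one_iff_adj.1 h1, by omega⟩

lemma dist_le_dist_add_one (hG : G.Connected) {u v : V} (huv : G.Adj v u) (x : V) :
    G.dist v x ≤ G.dist u x + 1 := by
  have h := hG.dist_triangle (u := v) (v := u) (w := x)
  rw [SimpleGraph.dist_eq_one_iff_adj.2 huv] at h
  omega

variable [Fintype V]

/-- Moving from `v` to a neighbour `u` changes the total distance by the difference between the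
numbers of vertices that get farther and closer. -/
lemma sum_dist_add_card_closer (hG : G.Connected) {u v : V} (huv : G.Adj v u) :
    ∑ x, G.dist u x + #{x | G.dist u x + 1 = G.dist v x} =
      ∑ x, G.dist v x + #{x | G.dist v x + 1 = G.dist u x} := by
  rw [card_filter, card_filter, ← sum_add_distrib, ← sum_add_distrib]
  refine sum_congr rfl fun x _ => ?_
  have h1 := dist_le_dist_add_one hG huv x
  have h2 := dist_le_dist_add_one hG huv.symm x
  split_ifs <;> omega

lemma card_closer_add_card_farther_le (u v : V) :
    #{x | G.dist u x + 1 = G.dist v x} + #{x | G.dist v x + 1 = G.dist u x} ≤ Fintype.card V := by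
  classical
  rw [← card_union_of_disjoint]
  · exact card_le_univ _
  · rw [disjoint_filter]
    intro x _ h
    omega

/-- A vertex minimising the total distance. -/
def IsMedian (G : SimpleGraph V) (v : V) : Prop :=
  ∀ u, ∑ x, G.dist v x ≤ ∑ x, G.dist u x

lemma IsMedian.card_closer_le {v : V} (hv : IsMedian G v) (hG : G.Connected) {m : ℕ}
    (hm : Fintype.card V = 2 * m) {u : V} (huv : G.Adj v u) :
    #{x | G.dist u x + 1 = G.dist v x} ≤ m := by
  have h1 := sum_dist_add_card_closer hG huv
  have h2 := card_closer_add_card_farther_le (G := G) u v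
  have h3 := hv u
  omega

lemma card_le_dist_eq_add (v : V) (k : ℕ) :
    #{x | k ≤ G.dist v x} = #{x | G.dist v x = k} + #{x | k + 1 ≤ G.dist v x} := by
  classical
  rw [← card_union_of_disjoint]
  · congr 1
    ext x
    simp only [mem_union, mem_filter_univ]
    omega
  · rw [disjoint_filter]
    intro x _ h
    omega

lemma card_one_le_dist_add_one (hG : G.Connected) (v : V) :
    #{x | 1 ≤ G.dist v x} + 1 = Fintype.card V := by
  have h := card_le_dist_eq_add (G := G) v 0
  have h0 : #{x | G.dist v x = 0} = 1 := by
    rw [card_eq_one]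
    refine ⟨v, ?_⟩
    ext x
    simp [hG.dist_eq_zero_iff, eq_comm]
  simp only [zero_le, filter_true, card_univ, zero_add] at h
  omega

/-- From a median of a connected graph of order `2m`, the number of vertices at distance at least
`k` is at most `2m + 1 - 2k`. -/
lemma IsMedian.card_le_dist_add_le {v : V} (hv : IsMedian G v) (hG : G.Connected) {m : ℕ}
    (hm : Fintype.card V = 2 * m) {k : ℕ} (hk : 1 ≤ k) {z : V} (hz : k ≤ G.dist v z) :
    #{x | k ≤ G.dist v x} + 2 * k ≤ 2 * m + 1 := by
  classical
  by_cases hlev : ∀ j, 1 ≤ j → j < k → 2 ≤ #{x | G.dist v x = j}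
  · suffices ∀ j, 1 ≤ j → j ≤ k → #{x | j ≤ G.dist v x} + 2 * j ≤ 2 * m + 1 from this k hk le_rfl
    intro j hj
    induction j, hj using Nat.le_induction with
    | base =>
      intro _
      have := card_one_le_dist_add_one hG v
      omega
    | succ j hj ih =>
      intro hjk
      have h1 := ih (by omega)
      have h2 := hlev j hj hjk
      have h3 := card_le_dist_eq_add (G := G) v j
      omega
  · push Not at hlev
    obtain ⟨j, hj, hjk, hcard⟩ := hlev
    obtain ⟨w, hw, -⟩ := exists_dist_eq_of_le_dist hG (a := v) (b := z) (i := j) (by omega)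
    have hwu : ∀ y, G.dist v y = j → y = w := fun y hy =>
      card_le_one.1 (Nat.lt_succ_iff.1 hcard) y (by simpa using hy) w (by simpa using hw)
    obtain ⟨u, huv, huw⟩ := exists_adj_closer hG (v := v) (z := w) (by omega)
    have hfar : ∀ x, j ≤ G.dist v x → G.dist u x + 1 = G.dist v x := by
      intro x hx
      obtain ⟨y, hy1, hy2⟩ := exists_dist_eq_of_le_dist hG hx
      obtain rfl := hwu y hy1
      have h1 := hG.dist_triangle (u := u) (v := y) (w := x)
      have h2 := dist_le_dist_add_one hG huv x
      omega
    have hA := hv.card_closer_le hG hm huv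
    have hnear : k - 1 ≤ #{x | G.dist u x + 1 = G.dist v x ∧ G.dist v x < k} := by
      calc k - 1 = #(Icc 1 (k - 1)) := by simp
        _ ≤ #(image (G.dist v) {x | G.dist u x + 1 = G.dist v x ∧ G.dist v x < k}) := by
          refine card_le_card fun i hi => ?_
          rw [mem_Icc] at hi
          obtain ⟨y, hy1, hy2, -⟩ :=
            exists_closer_dist_eq hG huv (hfar z (by omega)) hi.1 (by omega)
          exact mem_image.2 ⟨y, by rw [mem_filter_univ]; omega, hy2⟩
        _ ≤ _ := card_image_le
    have hsum : #{x | G.dist u x + 1 = G.dist v x ∧ G.dist v x < k} + #{x | k ≤ G.dist v x} ≤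
        #{x | G.dist u x + 1 = G.dist v x} := by
      rw [← card_union_of_disjoint]
      · refine card_le_card fun x hx => ?_
        simp only [mem_union, mem_filter_univ] at hx ⊢
        rcases hx with hx | hx
        · exact hx.1
        · exact hfar x (by omega)
      · rw [disjoint_filter]
        intro x _ h
        omega
    have hpos : 0 < #{x | k ≤ G.dist v x} := card_pos.2 ⟨z, by simpa using hz⟩
    omega

lemma IsMedian.dist_le {v : V} (hv : IsMedian G v) (hG : G.Connected) {m : ℕ}
    (hm : Fintype.card V = 2 * m) (z : V) : G.dist v z ≤ m := by
  by_contra! h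
  have := hv.card_le_dist_add_le hG hm (k := m + 1) (by omega) h
  omega

lemma IsMedian.card_le_dist_le {v : V} (hv : IsMedian G v) (hG : G.Connected) {m : ℕ}
    (hm : Fintype.card V = 2 * m) {k : ℕ} (hk : k ∈ Icc 1 m) :
    #{x | k ≤ G.dist v x} ≤ 2 * m + 1 - 2 * k := by
  rcases Finset.eq_empty_or_nonempty {x | k ≤ G.dist v x} with h | ⟨z, hz⟩
  · simp [h]
  · have := hv.card_le_dist_add_le hG hm (mem_Icc.1 hk).1 (by simpa using hz)
    omega

lemma sum_eq_sum_card_le {f : V → ℕ} {m : ℕ} (hf : ∀ x, f x ≤ m) :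
    ∑ x, f x = ∑ k ∈ Icc 1 m, #{x | k ≤ f x} := by
  simp only [card_filter]
  rw [sum_comm]
  refine sum_congr rfl fun x _ => ?_
  rw [← card_filter]
  have : {k ∈ Icc 1 m | k ≤ f x} = Icc 1 (f x) := by
    ext k
    have := hf x
    simp only [mem_filter, mem_Icc]
    omega
  simp [this]

lemma sum_Icc_odd (m : ℕ) : ∑ k ∈ Icc 1 m, (2 * m + 1 - 2 * k) = m ^ 2 := by
  induction m with
  | zero => rfl
  | succ m ih =>
    rw [sum_Icc_succ_top (by omega)]
    have h : ∀ k ∈ Icc 1 m, 2 * (m + 1) + 1 - 2 * k = (2 * m + 1 - 2 * k) + 2 := by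
      intro k hk
      rw [mem_Icc] at hk
      omega
    rw [sum_congr rfl h, sum_add_distrib, ih]
    simp only [sum_const, Nat.card_Icc, smul_eq_mul]
    have : 2 * (m + 1) + 1 - 2 * (m + 1) = 1 := by omega
    rw [this]
    simp
    ring

lemma IsMedian.sum_dist_le {v : V} (hv : IsMedian G v) (hG : G.Connected) {m : ℕ}
    (hm : Fintype.card V = 2 * m) : ∑ x, G.dist v x ≤ m ^ 2 := by
  rw [sum_eq_sum_card_le (hv.dist_le hG hm), ← sum_Icc_odd]
  exact sum_le_sum fun k hk => hv.card_le_dist_le hG hm hk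

lemma IsMedian.card_le_dist_eq {v : V} (hv : IsMedian G v) (hG : G.Connected) {m : ℕ}
    (hm : Fintype.card V = 2 * m) (hsum : ∑ x, G.dist v x = m ^ 2) {k : ℕ} (hk : k ∈ Icc 1 m) :
    #{x | k ≤ G.dist v x} = 2 * m + 1 - 2 * k := by
  rw [sum_eq_sum_card_le (hv.dist_le hG hm), ← sum_Icc_odd] at hsum
  exact (sum_eq_sum_iff_of_le fun k hk => hv.card_le_dist_le hG hm hk).1 hsum k hk

lemma nonempty_iso_pathGraph_or_cycleGraph {n : ℕ} (hn : Fintype.card V = n) (f : V → ℕ)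
    (hlt : ∀ x, f x < n) (hinj : Function.Injective f)
    (hadj : ∀ x y, f x + 1 = f y → G.Adj x y)
    (hadj' : ∀ x y, G.Adj x y → f x ≤ f y → f x + 1 = f y ∨ f x = 0 ∧ f y + 1 = n) :
    Nonempty (G ≃g pathGraph n) ∨ Nonempty (G ≃g cycleGraph n) := by
  let e : V → Fin n := fun x => ⟨f x, hlt x⟩
  have he : Function.Bijective e := by
    rw [Fintype.bijective_iff_injective_and_card]
    exact ⟨fun x y h => hinj (congrArg Fin.val h), by simp [hn]⟩
  by_cases hends : ∃ x y, G.Adj x y ∧ f x = 0 ∧ f y + 1 = n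
  · right
    obtain ⟨x₀, y₀, h, hx₀, hy₀⟩ := hends
    refine ⟨⟨Equiv.ofBijective e he, ?_⟩⟩
    intro x y
    have key : ∀ a b, ((e a - e b : Fin n) : ℕ) = 1 ↔ f b + 1 = f a ∨ f a = 0 ∧ f b + 1 = n := by
      intro a b
      have ha := hlt a
      have hb := hlt b
      have hne : f y₀ ≠ f x₀ := fun h' => h.ne (hinj h'.symm)
      have : ((e a - e b : Fin n) : ℕ) = (n - f b + f a) % n := rfl
      rw [this]
      by_cases hab : f b ≤ f a
      · have h2 : n - f b + f a = (f a - f b) + n := by omega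
        rw [h2, Nat.add_mod_right, Nat.mod_eq_of_lt (by omega)]
        omega
      · rw [Nat.mod_eq_of_lt (by omega)]
        omega
    have hxy : ∀ a b, f a = 0 ∧ f b + 1 = n → G.Adj a b := by
      rintro a b ⟨ha, hb⟩
      rwa [hinj (ha.trans hx₀.symm), hinj (show f b = f y₀ by omega)]
    rw [Equiv.ofBijective_apply, Equiv.ofBijective_apply, cycleGraph_adj', key, key]
    constructor
    · rintro ((h | h) | (h | h))
      · exact (hadj _ _ h).symm
      · exact hxy _ _ h
      · exact hadj _ _ h
      · exact (hxy _ _ h).symm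
    · intro h
      rcases le_total (f x) (f y) with hle | hle
      · have := hadj' x y h hle
        tauto
      · have := hadj' y x h.symm hle
        tauto
  · left
    refine ⟨⟨Equiv.ofBijective e he, ?_⟩⟩
    intro x y
    rw [Equiv.ofBijective_apply, Equiv.ofBijective_apply, pathGraph_adj]
    constructor
    · rintro (h | h)
      · exact hadj _ _ h
      · exact (hadj _ _ h).symm
    · intro h
      rcases le_total (f x) (f y) with hle | hle
      · exact (hadj' x y h hle).imp_right fun h' => (hends ⟨x, y, h, h'⟩).elim
      · exact ((hadj' y x h.symm hle).imp_right fun h' => (hends ⟨y, x, h.symm, h'⟩).elim).symm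

/-- If the total distance of a median attains the upper bound, the graph is a path or a cycle. -/
lemma IsMedian.nonempty_iso_of_sum_dist_eq {v : V} (hv : IsMedian G v) (hG : G.Connected) {m : ℕ}
    (hm : Fintype.card V = 2 * m) (hm1 : 1 ≤ m) (hsum : ∑ x, G.dist v x = m ^ 2) :
    Nonempty (G ≃g pathGraph (2 * m)) ∨ Nonempty (G ≃g cycleGraph (2 * m)) := by
  classical
  have hN : ∀ k, 1 ≤ k → k ≤ m → #{x | k ≤ G.dist v x} = 2 * m + 1 - 2 * k :=
    fun k h1 h2 => hv.card_le_dist_eq hG hm hsum (mem_Icc.2 ⟨h1, h2⟩)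
  have hle := hv.dist_le hG hm
  obtain ⟨w, hw⟩ : ∃ w, G.dist v w = m := by
    have hpos : 0 < #{x | m ≤ G.dist v x} := by
      rw [hN m hm1 le_rfl]
      omega
    obtain ⟨w, hw⟩ := card_pos.1 hpos
    exact ⟨w, le_antisymm (hle w) (by simpa using hw)⟩
  obtain ⟨u, huv, huw⟩ := exists_adj_closer hG (v := v) (z := w) (by omega)
  set A : Finset V := {x | G.dist u x + 1 = G.dist v x} with hA
  set B : Finset V := {x | G.dist v x + 1 = G.dist u x} with hB
  have memA : ∀ x, x ∈ A ↔ G.dist u x + 1 = G.dist v x := fun x => by simp [hA]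
  have memB : ∀ x, x ∈ B ↔ G.dist v x + 1 = G.dist u x := fun x => by simp [hB]
  have hAle : #A ≤ m := hv.card_closer_le hG hm huv
  have hAsub : Icc 1 m ⊆ A.image (G.dist v) := by
    intro i hi
    rw [mem_Icc] at hi
    obtain ⟨y, hy1, hy2, -⟩ := exists_closer_dist_eq hG huv huw hi.1 (by omega)
    exact mem_image.2 ⟨y, (memA y).2 hy1, hy2⟩
  have hAcard : #A = m := by
    refine le_antisymm hAle ?_
    simpa using (card_le_card hAsub).trans card_image_le
  have hAinj : ∀ x ∈ A, ∀ y ∈ A, G.dist v x = G.dist v y → x = y := by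
    have : Set.InjOn (G.dist v) A := by
      rw [← card_image_iff]
      refine le_antisymm card_image_le ?_
      simpa [hAcard] using card_le_card hAsub
    exact fun x hx y hy h => this hx hy h
  have hAB : #A + #B ≤ 2 * m := hm ▸ card_closer_add_card_farther_le (G := G) u v
  have hBcard : #B = m := by
    have h1 := sum_dist_add_card_closer hG huv
    rw [← hA, ← hB] at h1
    have h2 := hv u
    omega
  have hdisj : Disjoint A B := by
    rw [disjoint_filter]
    intro x _ h
    omega
  have hcover : ∀ x, x ∈ A ∨ x ∈ B := by
    intro x
    have : A ∪ B = univ := by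
      rw [← card_eq_iff_eq_univ, card_union_of_disjoint hdisj]
      omega
    rw [← mem_union, this]
    exact mem_univ x
  have hvB : v ∈ B := by
    rw [memB, SimpleGraph.dist_self, SimpleGraph.dist_eq_one_iff_adj.2 huv.symm]
  have hBsub : range m ⊆ B.image (G.dist v) := by
    intro i hi
    rw [mem_range] at hi
    rcases Nat.eq_zero_or_pos i with rfl | hi0
    · exact mem_image.2 ⟨v, hvB, by simp⟩
    · by_contra hcon
      have hL : #{x | G.dist v x = i} = 2 := by
        have h1 := card_le_dist_eq_add (G := G) v i
        rw [hN i hi0 hi.le, hN (i + 1) (by omega) hi] at h1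
        omega
      have hL1 : #{x | G.dist v x = i} ≤ 1 := by
        refine card_le_one.2 fun x hx y hy => ?_
        simp only [mem_filter_univ] at hx hy
        have hx' := (hcover x).resolve_right fun h => hcon (mem_image.2 ⟨x, h, hx⟩)
        have hy' := (hcover y).resolve_right fun h => hcon (mem_image.2 ⟨y, h, hy⟩)
        exact hAinj x hx' y hy' (hx.trans hy.symm)
      omega
  have hBinj : ∀ x ∈ B, ∀ y ∈ B, G.dist v x = G.dist v y → x = y := by
    have : Set.InjOn (G.dist v) B := by
      rw [← card_image_iff]
      refine le_antisymm card_image_le ?_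
      simpa [hBcard] using card_le_card hBsub
    exact fun x hx y hy h => this hx hy h
  have hBlt : ∀ x ∈ B, G.dist v x < m := by
    intro x hx
    have himg : range m = B.image (G.dist v) :=
      eq_of_subset_of_card_le hBsub (by simpa [hBcard] using card_image_le (s := B))
    exact mem_range.1 (himg ▸ mem_image_of_mem _ hx)
  have huA : u ∈ A := by
    rw [memA, SimpleGraph.dist_self, SimpleGraph.dist_eq_one_iff_adj.2 huv]
  have hvu : G.dist v u = 1 := SimpleGraph.dist_eq_one_iff_adj.2 huv
  -- an edge between `A` and `B` is either `uv` or joins the two farthest vertices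
  have hcross : ∀ p ∈ A, ∀ q ∈ B, G.Adj p q →
      G.dist v p = G.dist v q + 1 ∧ (G.dist v q = 0 ∨ G.dist v p = m) := by
    intro p hp q hq hpq
    have h1 := (memA p).1 hp
    have h2 := (memB q).1 hq
    have t1 : G.dist v p ≤ G.dist v q + 1 := by
      simpa only [SimpleGraph.dist_comm] using dist_le_dist_add_one hG hpq v
    have t2 : G.dist u q ≤ G.dist u p + 1 := by
      simpa only [SimpleGraph.dist_comm] using dist_le_dist_add_one hG hpq.symm u
    refine ⟨by omega, ?_⟩
    by_contra! hcon
    obtain ⟨u', huv', hq'⟩ := exists_adj_closer hG (v := v) (z := q) (by omega)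
    have hvu' : G.dist v u' = 1 := SimpleGraph.dist_eq_one_iff_adj.2 huv'
    have hnotA : ∀ x ∈ B, x ∉ A := fun x hx hx' => Finset.disjoint_left.1 hdisj hx' hx
    have hu'B : u' ∈ B := by
      refine (hcover u').resolve_left fun h => hnotA q hq ?_
      rwa [memA, hAinj u huA u' h (by omega)]
    have hpcl : G.dist u' p + 1 = G.dist v p := by
      have t3 : G.dist u' p ≤ G.dist u' q + 1 := by
        simpa only [SimpleGraph.dist_comm] using dist_le_dist_add_one hG hpq u'
      have t4 := dist_le_dist_add_one hG huv' p
      omega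
    have hwcl : G.dist u' w + 1 = G.dist v w := by
      obtain ⟨y, hy1, hy2, hy3⟩ :=
        exists_closer_dist_eq hG huv huw (i := G.dist v p) (by omega) (by have := hle p; omega)
      obtain rfl := hAinj y ((memA y).2 hy1) p hp hy2
      have t3 := hG.dist_triangle (u := u') (v := y) (w := w)
      have t4 := dist_le_dist_add_one hG huv' w
      omega
    have hsub : (B.erase v) ∪ {p, w} ⊆ ({x | G.dist u' x + 1 = G.dist v x} : Finset V) := by
      intro x hx
      rw [mem_filter_univ]
      simp only [mem_union, mem_erase, mem_insert, mem_singleton] at hx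
      rcases hx with ⟨hxv, hxB⟩ | rfl | rfl
      · obtain ⟨y, hy1, hy2⟩ := exists_adj_closer hG (v := v) (z := x)
          (hG.pos_dist_of_ne (Ne.symm hxv))
        have hvy : G.dist v y = 1 := SimpleGraph.dist_eq_one_iff_adj.2 hy1
        have hyB : y ∈ B := by
          refine (hcover y).resolve_left fun h => hnotA x hxB ?_
          rwa [memA, hAinj u huA y h (by omega)]
        rwa [hBinj u' hu'B y hyB (by omega)]
      · exact hpcl
      · exact hwcl
    have hcard := card_le_card hsub
    have hpw : p ≠ w := fun h => hcon.2 (h ▸ hw)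
    rw [card_union_of_disjoint, card_erase_of_mem hvB, card_pair hpw, hBcard] at hcard
    · have := hv.card_closer_le hG hm huv'
      omega
    · rw [Finset.disjoint_left]
      intro x hx hx'
      simp only [mem_insert, mem_singleton] at hx'
      refine hnotA x (mem_of_mem_erase hx) ?_
      rcases hx' with rfl | rfl
      · exact hp
      · exact (memA _).2 huw
  have hAadj : ∀ p ∈ A, ∀ q ∈ A, G.dist v p + 1 = G.dist v q → G.Adj p q := by
    intro p hp q hq h
    have h1 := (memA p).1 hp
    obtain ⟨y, hy1, hy2, hy3⟩ := exists_closer_dist_eq hG huv ((memA q).1 hq)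
      (i := G.dist v p) (by omega) (by omega)
    obtain rfl := hAinj y ((memA y).2 hy1) p hp hy2
    exact SimpleGraph.dist_eq_one_iff_adj.1 (by omega)
  have hBadj : ∀ p ∈ B, ∀ q ∈ B, G.dist v p + 1 = G.dist v q → G.Adj p q := by
    intro p hp q hq h
    have h1 := (memB q).1 hq
    obtain ⟨y, hy1, hy2⟩ := exists_dist_eq_of_le_dist hG (a := v) (b := q) (i := G.dist v p)
      (by omega)
    have hyB : y ∈ B := by
      refine (hcover y).resolve_left fun hy => ?_
      have h2 := (memA y).1 hy
      have h3 := hG.dist_triangle (u := u) (v := y) (w := q)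
      omega
    obtain rfl := hBinj y hyB p hp hy1
    exact SimpleGraph.dist_eq_one_iff_adj.1 (by omega)
  have hsame : ∀ p q, G.Adj p q → G.dist v p ≤ G.dist v q + 1 := fun p q hpq => by
    simpa only [SimpleGraph.dist_comm] using dist_le_dist_add_one hG hpq v
  have hApos : ∀ x ∈ A, 1 ≤ G.dist v x := fun x hx => by
    have := (memA x).1 hx
    omega
  let f : V → ℕ := fun x => if x ∈ A then m - 1 + G.dist v x else m - 1 - G.dist v x
  have hfA : ∀ x ∈ A, f x = m - 1 + G.dist v x := fun x hx => if_pos hx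
  have hfB : ∀ x ∈ B, f x = m - 1 - G.dist v x := fun x hx =>
    if_neg fun h => Finset.disjoint_left.1 hdisj h hx
  refine nonempty_iso_pathGraph_or_cycleGraph hm f ?_ ?_ ?_ ?_
  · intro x
    have := hle x
    rcases hcover x with h | h
    · rw [hfA x h]
      omega
    · rw [hfB x h]
      omega
  · intro x y hxy
    rcases hcover x with hx | hx <;> rcases hcover y with hy | hy
    · rw [hfA x hx, hfA y hy] at hxy
      exact hAinj x hx y hy (by omega)
    · rw [hfA x hx, hfB y hy] at hxy
      have := hApos x hx
      omega
    · rw [hfB x hx, hfA y hy] at hxy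
      have := hApos y hy
      omega
    · rw [hfB x hx, hfB y hy] at hxy
      have := hBlt x hx
      have := hBlt y hy
      exact hBinj x hx y hy (by omega)
  · intro x y hxy
    rcases hcover x with hx | hx <;> rcases hcover y with hy | hy
    · rw [hfA x hx, hfA y hy] at hxy
      exact hAadj x hx y hy (by omega)
    · rw [hfA x hx, hfB y hy] at hxy
      have := hApos x hx
      omega
    · rw [hfB x hx, hfA y hy] at hxy
      have := hApos y hy
      have := hBlt x hx
      rw [hBinj x hx v hvB (by rw [SimpleGraph.dist_self]; omega), hAinj y hy u huA (by omega)]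
      exact huv
    · rw [hfB x hx, hfB y hy] at hxy
      have := hBlt x hx
      have := hBlt y hy
      exact (hBadj y hy x hx (by omega)).symm
  · intro x y hadj hxy
    have h1 := hsame x y hadj
    have h2 := hsame y x hadj.symm
    rcases hcover x with hx | hx <;> rcases hcover y with hy | hy
    · have : G.dist v x ≠ G.dist v y := fun h => hadj.ne (hAinj x hx y hy h)
      rw [hfA x hx, hfA y hy] at hxy ⊢
      omega
    · rw [hfA x hx, hfB y hy] at hxy
      have := hApos x hx
      omega
    · have := hcross y hy x hx hadj.symm
      have := hBlt x hx
      rw [hfB x hx, hfA y hy] at hxy ⊢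
      omega
    · have : G.dist v x ≠ G.dist v y := fun h => hadj.ne (hBinj x hx y hy h)
      have := hBlt x hx
      have := hBlt y hy
      rw [hfB x hx, hfB y hy] at hxy ⊢
      omega

lemma sum_range_min_sub (m : ℕ) : ∑ j ∈ range (2 * m), min j (2 * m - j) = m ^ 2 := by
  rw [two_mul, sum_range_add, ← sum_add_distrib]
  have h : ∀ j ∈ range m, min j (m + m - j) + min (m + j) (m + m - (m + j)) = m := by
    intro j hj
    rw [mem_range] at hj
    omega
  rw [sum_congr rfl h]
  simp [sq]

lemma le_dist_of_forall_adj {W : Type*} {H : SimpleGraph W} (hH : H.Connected) (g : W → ℕ) {v : W}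
    (hv : g v = 0) (hg : ∀ x y, H.Adj x y → g y ≤ g x + 1) (x : W) : g x ≤ H.dist v x := by
  obtain ⟨p, hp⟩ := hH.exists_walk_length_eq_dist v x
  have hw : ∀ {a b : W} (p : H.Walk a b), g b ≤ g a + p.length := by
    intro a b p
    induction p with
    | nil => simp
    | cons h p ih =>
      have := hg _ _ h
      rw [SimpleGraph.Walk.length_cons]
      omega
  have := hw p
  omega

/-- A connected graph of order `2m` that embeds bijectively into a cycle has all total distances at
least `m ^ 2`. -/
lemma sq_le_sum_dist_of_adj_cycleGraph (hG : G.Connected) {m : ℕ} (hm1 : 1 ≤ m)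
    (e : V ≃ Fin (2 * m)) (he : ∀ x y, G.Adj x y → (cycleGraph (2 * m)).Adj (e x) (e y)) (v : V) :
    m ^ 2 ≤ ∑ x, G.dist v x := by
  have : NeZero (2 * m) := ⟨by omega⟩
  let h : Fin (2 * m) → ℕ := fun j => min (j : ℕ) (2 * m - j)
  have hstep : ∀ a b : Fin (2 * m), ((b : ℕ) = 1 ∨ ((-b : Fin (2 * m)) : ℕ) = 1) →
      h (a + b) ≤ h a + 1 := by
    intro a b hb
    simp only [h, Fin.val_add]
    have ha := a.2
    have hb' := b.2
    have hb2 : (b : ℕ) = 1 ∨ (b : ℕ) + 1 = 2 * m := by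
      rcases hb with hb | hb
      · exact Or.inl hb
      · rw [Fin.val_neg'] at hb
        by_cases h0 : (b : ℕ) = 0
        · simp [h0] at hb
        · rw [Nat.mod_eq_of_lt (by omega)] at hb
          omega
    by_cases hlt : (a : ℕ) + b < 2 * m
    · rw [Nat.mod_eq_of_lt hlt]
      omega
    · rw [Nat.mod_eq_sub_mod (by omega), Nat.mod_eq_of_lt (by omega)]
      omega
  have hle : ∀ x, h (e x - e v) ≤ G.dist v x := by
    refine le_dist_of_forall_adj hG (fun x => h (e x - e v)) (by simp [h]) fun x y hxy => ?_
    have hc := he x y hxy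
    rw [cycleGraph_adj'] at hc
    have := hstep (e x - e v) (e y - e x) (by rw [neg_sub]; exact hc.symm)
    rwa [show e x - e v + (e y - e x) = e y - e v by abel] at this
  calc m ^ 2 = ∑ j : Fin (2 * m), h j := by
        rw [Fin.sum_univ_eq_sum_range (fun j => min j (2 * m - j)), sum_range_min_sub]
    _ = ∑ x, h (e x - e v) :=
        (Equiv.sum_comp (e.trans (Equiv.subRight (e v))) h).symm
    _ ≤ _ := sum_le_sum fun x _ => hle x

end

/-- Let `G` be a finite connected simple graph of even order `n ≥ 2`.
Then the proximity `π(G)` satisfies `π(G) ≤ (n+1)/4 + 1/(4(n-1))`, with equality iff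
`G` is a path or a cycle. -/
theorem proximity_le_of_even_order
    {V : Type*} [Fintype V] (G : SimpleGraph V) (hG : G.Connected)
    (n : ℕ) (hn : Fintype.card V = n) (hn2 : 2 ≤ n) (heven : Even n) :
    (⨅ v : V, (∑ u : V, (G.dist v u : ℝ)) / (n - 1)) ≤ (n + 1) / 4 + 1 / (4 * (n - 1)) ∧
    ((⨅ v : V, (∑ u : V, (G.dist v u : ℝ)) / (n - 1)) = (n + 1) / 4 + 1 / (4 * (n - 1)) ↔
      (Nonempty (G ≃g pathGraph n) ∨ Nonempty (G ≃g cycleGraph n))) := by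
  obtain ⟨m, rfl⟩ := even_iff_exists_two_mul.1 heven
  have hm1 : 1 ≤ m := by omega
  have := hG.nonempty
  obtain ⟨v, hv⟩ := Finite.exists_min fun v : V => ∑ x, G.dist v x
  have hmed : IsMedian G v := hv
  have hpos : (0 : ℝ) < ((2 * m : ℕ) : ℝ) - 1 := by
    have : (2 : ℝ) ≤ ((2 * m : ℕ) : ℝ) := by exact_mod_cast hn2
    linarith
  have hinf : (⨅ v : V, (∑ u : V, (G.dist v u : ℝ)) / (((2 * m : ℕ) : ℝ) - 1)) =
      ((∑ x, G.dist v x : ℕ) : ℝ) / (((2 * m : ℕ) : ℝ) - 1) := by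
    refine le_antisymm ((ciInf_le (Set.finite_range _).bddBelow v).trans_eq (by push_cast; rfl)) ?_
    refine le_ciInf fun u => ?_
    rw [div_le_div_iff_of_pos_right hpos]
    exact_mod_cast hv u
  have hrhs : (((2 * m : ℕ) : ℝ) + 1) / 4 + 1 / (4 * (((2 * m : ℕ) : ℝ) - 1)) =
      ((m ^ 2 : ℕ) : ℝ) / (((2 * m : ℕ) : ℝ) - 1) := by
    field_simp
    push_cast
    ring
  rw [hinf, hrhs, div_le_div_iff_of_pos_right hpos, div_left_inj' hpos.ne', Nat.cast_le,
    Nat.cast_inj]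
  refine ⟨hmed.sum_dist_le hG hn, hmed.nonempty_iso_of_sum_dist_eq hG hn hm1, fun h =>
    le_antisymm (hmed.sum_dist_le hG hn) ?_⟩
  rcases h with ⟨⟨e⟩⟩ | ⟨⟨e⟩⟩
  · exact sq_le_sum_dist_of_adj_cycleGraph hG hm1 e.toEquiv
      (fun x y h => pathGraph_le_cycleGraph (e.map_adj_iff.2 h)) v
  · exact sq_le_sum_dist_of_adj_cycleGraph hG hm1 e.toEquiv (fun x y h => e.map_adj_iff.2 h) v
end

section
/- Let G be a finite connected simple graph of order n ≥ 2. Then 1 ≤ ρ(G) ≤ n/2. The lower bound holds with equality if and only if G is a complete graph, and the upper bound holds with equality if and only if G is a path. -/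
open SimpleGraph Finset

/-- A nonzero distance from `v` is witnessed by a neighbour one step closer to `v`. -/
theorem exists_adj_dist_eq_of_dist_eq_succ {V : Type*} {G : SimpleGraph V} {v u : V} {m : ℕ}
    (h : G.dist v u = m + 1) : ∃ w, G.Adj w u ∧ G.dist v w = m := by
  obtain ⟨p, hp⟩ := exists_walk_of_dist_ne_zero (by omega : G.dist v u ≠ 0)
  have hnil : ¬ p.Nil := by
    rw [← Walk.length_eq_zero_iff]
    omega
  have hadj := p.adj_penultimate hnil
  refine ⟨p.penultimate, hadj, ?_⟩
  have hle : G.dist v p.penultimate ≤ p.dropLast.length := dist_le _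
  have hlen := p.length_dropLast_add_one hnil
  have htri := hadj.reachable.dist_triangle_right v
  rw [dist_eq_one_iff_adj.mpr hadj] at htri
  omega

theorem exists_dist_eq_of_le {V : Type*} {G : SimpleGraph V} {v u : V} {m : ℕ}
    (h : m ≤ G.dist v u) : ∃ w, G.dist v w = m := by
  obtain ⟨k, hk⟩ := Nat.exists_eq_add_of_le h
  induction k generalizing u with
  | zero => exact ⟨u, hk⟩
  | succ k ih =>
    obtain ⟨w, -, hw⟩ := exists_adj_dist_eq_of_dist_eq_succ (m := m + k) hk
    exact ih (by omega) hw

/-- The vertices can be listed so that the `i`-th one is at distance at most `i` from `v`. -/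
theorem exists_equiv_dist_le {V : Type*} [Fintype V] (G : SimpleGraph V) (v : V)
    {n : ℕ} (hn : Fintype.card V = n) :
    ∃ e : Fin n ≃ V, ∀ i, G.dist v (e i) ≤ i := by
  let e₀ : Fin n ≃ V := (Fintype.equivFinOfCardEq hn).symm
  let f : Fin n → ℕ := fun i => G.dist v (e₀ i)
  let e : Fin n ≃ V := (Tuple.sort f).trans e₀
  have hmono : Monotone fun i => G.dist v (e i) := Tuple.monotone_sort f
  refine ⟨e, ?_⟩
  rintro ⟨i, hi⟩
  induction i with
  | zero =>
    have h := hmono (show (⟨0, hi⟩ : Fin n) ≤ e.symm v from Nat.zero_le _)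
    simpa using h
  | succ i ih =>
    have hprev := ih (by omega)
    by_contra! hlt
    simp only at hprev hlt
    obtain ⟨w, hw⟩ := exists_dist_eq_of_le hlt.le
    rcases le_total (e.symm w) ⟨i, by omega⟩ with h | h
    · have := hmono h
      simp only [Equiv.apply_symm_apply] at this
      omega
    · rcases h.lt_or_eq with h | h
      · have := hmono (show (⟨i + 1, hi⟩ : Fin n) ≤ e.symm w from h)
        simp only [Equiv.apply_symm_apply] at this
        omega
      · rw [h, Equiv.apply_symm_apply] at hprev
        omega

theorem sum_fin_val_mul_two (n : ℕ) : (∑ i : Fin n, (i : ℕ)) * 2 = n * (n - 1) := by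
  rw [Fin.sum_univ_eq_sum_range (fun i => i), Finset.sum_range_id_mul_two]

theorem sum_dist_mul_two_le {V : Type*} [Fintype V] (G : SimpleGraph V) (v : V)
    {n : ℕ} (hn : Fintype.card V = n) : (∑ u, G.dist v u) * 2 ≤ n * (n - 1) := by
  obtain ⟨e, he⟩ := exists_equiv_dist_le G v hn
  rw [← e.sum_comp, ← sum_fin_val_mul_two]
  exact Nat.mul_le_mul_right _ (Finset.sum_le_sum fun i _ => he i)

theorem nonempty_iso_pathGraph_of_sum_dist {V : Type*} [Fintype V] {G : SimpleGraph V}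
    (hG : G.Connected) {v : V} {n : ℕ} (hn : Fintype.card V = n)
    (h : (∑ u, G.dist v u) * 2 = n * (n - 1)) : Nonempty (G ≃g pathGraph n) := by
  obtain ⟨e, he⟩ := exists_equiv_dist_le G v hn
  have hdist : ∀ i, G.dist v (e i) = i := by
    rw [← e.sum_comp, ← sum_fin_val_mul_two] at h
    have := (Finset.sum_eq_sum_iff_of_le fun i _ => he i).mp (Nat.eq_of_mul_eq_mul_right two_pos h)
    exact fun i => this i (Finset.mem_univ i)
  have hsucc : ∀ i j : Fin n, (i : ℕ) + 1 = j → G.Adj (e i) (e j) := by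
    intro i j hij
    obtain ⟨w, hadj, hw⟩ := exists_adj_dist_eq_of_dist_eq_succ ((hdist j).trans hij.symm)
    have hi := hdist (e.symm w)
    rw [Equiv.apply_symm_apply, hw] at hi
    rwa [Fin.ext hi, Equiv.apply_symm_apply]
  refine ⟨RelIso.symm ⟨e, ?_⟩⟩
  intro i j
  rw [pathGraph_adj]
  constructor
  · intro hadj
    have hne : (i : ℕ) ≠ j := fun hij => hadj.ne (congrArg e (Fin.ext hij))
    have h₁ := hG.dist_triangle (u := v) (v := e i) (w := e j)
    have h₂ := hG.dist_triangle (u := v) (v := e j) (w := e i)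
    rw [dist_eq_one_iff_adj.mpr hadj, hdist, hdist] at h₁
    rw [dist_eq_one_iff_adj.mpr hadj.symm, hdist, hdist] at h₂
    omega
  · rintro (hij | hij)
    · exact hsucc i j hij
    · exact (hsucc j i hij).symm

theorem pathGraph_val_le_add_length {n : ℕ} {i j : Fin n} (p : (pathGraph n).Walk i j) :
    (j : ℕ) ≤ i + p.length := by
  induction p with
  | nil => simp
  | cons h p ih =>
    rw [pathGraph_adj] at h
    rw [Walk.length_cons]
    omega

theorem exists_le_sum_dist_mul_two_of_iso_pathGraph {V : Type*} [Fintype V] {G : SimpleGraph V}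
    (hG : G.Connected) {n : ℕ} (hn : 0 < n) (φ : G ≃g pathGraph n) :
    ∃ v, n * (n - 1) ≤ (∑ u, G.dist v u) * 2 := by
  refine ⟨φ.symm ⟨0, hn⟩, ?_⟩
  rw [← φ.symm.toEquiv.sum_comp, ← sum_fin_val_mul_two]
  refine Nat.mul_le_mul_right _ (Finset.sum_le_sum fun i _ => ?_)
  obtain ⟨p, hp⟩ := hG.exists_walk_length_eq_dist (φ.symm ⟨0, hn⟩) (φ.symm i)
  have h := pathGraph_val_le_add_length (p.map φ.toHom)
  rw [Walk.length_map, hp] at h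
  simpa using h

theorem card_sub_one_eq_sum {V : Type*} [Fintype V] [DecidableEq V] (v : V) :
    Fintype.card V - 1 = ∑ u, if v = u then 0 else 1 := by
  simp [Finset.filter_ne, Finset.sum_ite]

theorem card_sub_one_le_sum_dist {V : Type*} [Fintype V] {G : SimpleGraph V}
    (hG : G.Connected) (v : V) : Fintype.card V - 1 ≤ ∑ u, G.dist v u := by
  classical
  rw [card_sub_one_eq_sum v]
  refine Finset.sum_le_sum fun u _ => ?_
  split_ifs with h
  · exact Nat.zero_le _
  · exact hG.pos_dist_of_ne h

theorem sum_dist_eq_card_sub_one_iff {V : Type*} [Fintype V] {G : SimpleGraph V}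
    (hG : G.Connected) (v : V) :
    ∑ u, G.dist v u = Fintype.card V - 1 ↔ ∀ u, v ≠ u → G.Adj v u := by
  classical
  rw [card_sub_one_eq_sum v, eq_comm, Finset.sum_eq_sum_iff_of_le]
  · refine ⟨fun h u hu => ?_, fun h u _ => ?_⟩
    · have := h u (Finset.mem_univ u)
      rw [if_neg hu] at this
      exact dist_eq_one_iff_adj.mp this.symm
    · split_ifs with hu
      · simp [hu]
      · exact (dist_eq_one_iff_adj.mpr (h u hu)).symm
  · intro u _
    split_ifs with h
    · exact Nat.zero_le _
    · exact hG.pos_dist_of_ne h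

/-- Let `G` be a finite connected simple graph of order `n ≥ 2`.
Then the remoteness `ρ(G) = max_v (∑_u d(v,u)) / (n-1)` satisfies `1 ≤ ρ(G) ≤ n/2`;
the lower bound is attained iff `G` is complete, and the upper bound iff `G` is a path. -/
theorem remoteness_bounds
    {V : Type*} [Fintype V] (G : SimpleGraph V) (hG : G.Connected)
    (n : ℕ) (hn : Fintype.card V = n) (hn2 : 2 ≤ n) :
    (1 : ℝ) ≤ (⨆ v : V, (∑ u : V, (G.dist v u : ℝ)) / (n - 1)) ∧
    (⨆ v : V, (∑ u : V, (G.dist v u : ℝ)) / (n - 1)) ≤ n / 2 ∧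
    ((⨆ v : V, (∑ u : V, (G.dist v u : ℝ)) / (n - 1)) = 1 ↔ G = ⊤) ∧
    ((⨆ v : V, (∑ u : V, (G.dist v u : ℝ)) / (n - 1)) = n / 2 ↔
      Nonempty (G ≃g pathGraph n)) := by
  have hne : Nonempty V := hG.nonempty
  have hcast : ((n - 1 : ℕ) : ℝ) = n - 1 := by
    rw [Nat.cast_sub (by omega), Nat.cast_one]
  have hpos : (0 : ℝ) < n - 1 := by
    rw [← hcast, Nat.cast_pos]
    omega
  have one_le (v : V) : 1 ≤ (∑ u : V, (G.dist v u : ℝ)) / (n - 1) := by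
    rw [one_le_div hpos, ← hcast, ← hn]
    exact_mod_cast card_sub_one_le_sum_dist hG v
  have eq_one (v : V) : (∑ u : V, (G.dist v u : ℝ)) / (n - 1) = 1 ↔
      ∀ u, v ≠ u → G.Adj v u := by
    rw [div_eq_one_iff_eq hpos.ne', ← hcast, ← sum_dist_eq_card_sub_one_iff hG, ← hn]
    exact_mod_cast Iff.rfl
  have le_half (v : V) : (∑ u : V, (G.dist v u : ℝ)) / (n - 1) ≤ n / 2 := by
    rw [div_le_div_iff₀ hpos two_pos, ← hcast]
    exact_mod_cast sum_dist_mul_two_le G v hn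
  have eq_half (v : V) : (∑ u : V, (G.dist v u : ℝ)) / (n - 1) = n / 2 ↔
      (∑ u, G.dist v u) * 2 = n * (n - 1) := by
    rw [div_eq_div_iff hpos.ne' two_ne_zero, ← hcast]
    exact_mod_cast Iff.rfl
  have le_sup (v : V) := le_ciSup (Set.finite_range fun v : V =>
    (∑ u : V, (G.dist v u : ℝ)) / (n - 1)).bddAbove v
  obtain ⟨v₀, hv₀⟩ := exists_eq_ciSup_of_finite (f := fun v : V =>
    (∑ u : V, (G.dist v u : ℝ)) / (n - 1))
  refine ⟨(one_le v₀).trans (le_sup v₀), ciSup_le le_half, ⟨fun h => ?_, fun h => ?_⟩,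
    fun h => ?_, fun ⟨φ⟩ => ?_⟩
  · ext v u
    rw [top_adj]
    exact ⟨Adj.ne, (eq_one v).mp (le_antisymm ((le_sup v).trans h.le) (one_le v)) u⟩
  · rw [← hv₀]
    exact (eq_one v₀).mpr fun u hu => by rwa [h, top_adj]
  · exact nonempty_iso_pathGraph_of_sum_dist hG hn ((eq_half v₀).mp (hv₀.trans h))
  · obtain ⟨v, hv⟩ := exists_le_sum_dist_mul_two_of_iso_pathGraph hG (by omega) φ
    have hv' := (eq_half v).mpr (le_antisymm (sum_dist_mul_two_le G v hn) hv)
    exact le_antisymm (ciSup_le le_half) (hv'.ge.trans (le_sup v))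
end

section
/- Let T be a finite tree and let c : V(T) → ℝ be a nonnegative weight function with total weight N = ∑_{x∈V(T)} c(x). A vertex v of T is a c-median vertex of T if and only if bw_c(v,T) ≤ N/2. -/
open SimpleGraph Finset

/-- If every walk from `x` to `w` passes through `v`, then `v` lies on a geodesic. -/
lemma SimpleGraph.Connected.dist_eq_add_of_not_reachable_induce {V : Type*} {G : SimpleGraph V}
    (hG : G.Connected) {v x w : V} (hx : x ≠ v)
    (h : ∀ hw : w ≠ v, ¬ (G.induce {y : V | y ≠ v}).Reachable ⟨x, hx⟩ ⟨w, hw⟩) :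
    G.dist x w = G.dist x v + G.dist v w := by
  classical
  refine le_antisymm hG.dist_triangle ?_
  obtain ⟨p, hp⟩ := hG.exists_walk_length_eq_dist x w
  have hv : v ∈ p.support := by
    by_contra hv
    have hs : ∀ y ∈ p.support, y ∈ {y : V | y ≠ v} := fun y hy hyv => hv (hyv ▸ hy)
    exact h (hs w p.end_mem_support) ⟨p.induce _ hs⟩
  have hlen := congrArg Walk.length (p.take_spec hv)
  rw [Walk.length_append] at hlen
  have h1 := dist_le (p.takeUntil v hv)
  have h2 := dist_le (p.dropUntil v hv)
  omega

/-- Every component of `G - v` from which `v` can be reached contains a neighbour of `v`. -/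
lemma SimpleGraph.Walk.exists_adj_reachable_induce {V : Type*} {G : SimpleGraph V} {x v : V}
    (p : G.Walk x v) (hx : x ≠ v) :
    ∃ u, ∃ hu : u ≠ v, G.Adj u v ∧ (G.induce {y : V | y ≠ v}).Reachable ⟨x, hx⟩ ⟨u, hu⟩ := by
  induction p with
  | nil => exact absurd rfl hx
  | @cons a b e hab p ih =>
    by_cases hb : b = e
    · subst hb
      exact ⟨a, hx, hab, .rfl⟩
    · obtain ⟨u, hu, huv, hr⟩ := ih hb
      refine ⟨u, hu, huv, Reachable.trans (Adj.reachable ?_) hr⟩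
      exact hab

/-- In a tree, a neighbour `u` of `v` is closer than `v` to every vertex of its branch at `v`. -/
lemma SimpleGraph.IsTree.dist_add_one_le_of_reachable_induce {V : Type*} {T : SimpleGraph V}
    (hT : T.IsTree) {v u w : V} (huv : T.Adj u v) (hu : u ≠ v) (hw : w ≠ v)
    (h : (T.induce {y : V | y ≠ v}).Reachable ⟨w, hw⟩ ⟨u, hu⟩) :
    T.dist u w + 1 ≤ T.dist v w := by
  obtain ⟨q, hq⟩ := h.exists_isPath
  let p : T.Walk w u := q.map (Embedding.induce {y : V | y ≠ v}).toHom
  have hp : p.IsPath := hq.map Subtype.val_injective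
  have hv : v ∉ p.support := by
    intro hv
    obtain ⟨y, -, hy⟩ := List.mem_map.mp (Walk.support_map _ q ▸ hv)
    exact y.2 hy
  obtain ⟨g, hg, hlen⟩ := hT.connected.exists_path_of_dist w v
  have heq := (hT.existsUnique_path w v).unique hg (hp.concat hv huv)
  rw [heq, Walk.length_concat] at hlen
  have := dist_le p
  rw [dist_comm (u := u), dist_comm (u := v)]
  omega

open scoped Classical in
/-- Let `T` be a finite tree with a nonnegative weight function `c` of
total weight `N`. A vertex `v` is a `c`-median vertex of `T` (i.e. it minimises
`σ_c(v,T) = ∑_w c(w) d(v,w)`) if and only if the `c`-branch weight of `v` — the maximum,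
over connected components `K` of `T - v`, of the total weight of `K` (taken to be `0` if
`T - v` has no vertices) — is at most `N/2`. -/
theorem median_iff_branch_weight_le_half
    {V : Type*} [Fintype V] [DecidableEq V] (T : SimpleGraph V) (hT : T.IsTree)
    (c : V → ℝ) (hc : ∀ v, 0 ≤ c v) (N : ℝ) (hN : N = ∑ v : V, c v) (v : V) :
    (∀ u : V, (∑ w : V, c w * T.dist v w) ≤ ∑ w : V, c w * T.dist u w) ↔
      sSup ({0} ∪ Set.range (fun x : {w : V | w ≠ v} =>
        ∑ u : {w : V | w ≠ v},
          if (T.induce {w : V | w ≠ v}).Reachable x u then c u else 0)) ≤ N / 2 := by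
  set S : Set V := {w : V | w ≠ v}
  set W : S → ℝ := fun x => ∑ u : S, if (T.induce S).Reachable x u then c u else 0
  let e : S → V → ℝ := fun x w => if ∃ hw : w ∈ S, (T.induce S).Reachable x ⟨w, hw⟩ then 1 else 0
  have hWe (x : S) : W x = ∑ w : V, c w * e x w := by
    have hv : c v * e x v = 0 := by simp [e, S]
    have hsum : ∑ w : S, c w * e x w = ∑ w ∈ univ.filter (· ∈ S), c w * e x w :=
      (Finset.sum_subtype (univ.filter (· ∈ S)) (fun w => by simp) fun w => c w * e x w).symm
    rw [← Finset.sum_filter_of_ne (p := (· ∈ S)) (fun w _ hw hwv => hw (hwv ▸ hv)), ← hsum]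
    refine Finset.sum_congr rfl fun w _ => ?_
    simp [e]
  have hbound : sSup ({0} ∪ Set.range W) ≤ N / 2 ↔ ∀ x, W x ≤ N / 2 := by
    have hN0 : 0 ≤ N / 2 := by
      have := Finset.sum_nonneg fun w (_ : w ∈ univ) => hc w
      linarith
    rw [csSup_le_iff ((Set.finite_singleton _).union (Set.finite_range W)).bddAbove ⟨0, by simp⟩]
    simp only [Set.mem_union, Set.mem_singleton_iff, or_imp, forall_and, forall_eq, hN0, true_and,
      Set.forall_mem_range]
  have hcomb (x : S) (k : ℝ) : ∑ w : V, c w * (T.dist v w + k * (1 - 2 * e x w)) =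
      ∑ w : V, c w * T.dist v w + k * (N - 2 * W x) := by
    rw [hWe, hN, Finset.mul_sum, ← Finset.sum_sub_distrib, Finset.mul_sum,
      ← Finset.sum_add_distrib]
    exact Finset.sum_congr rfl fun w _ => by ring
  rw [hbound]
  constructor
  · rintro hmed ⟨x, hx⟩
    obtain ⟨p⟩ := hT.connected.preconnected x v
    obtain ⟨u, hu, huv, hr⟩ := p.exists_adj_reachable_induce hx
    have hle : ∑ w : V, c w * T.dist u w ≤
        ∑ w : V, c w * (T.dist v w + 1 * (1 - 2 * e ⟨x, hx⟩ w)) := by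
      refine Finset.sum_le_sum fun w _ => mul_le_mul_of_nonneg_left ?_ (hc w)
      by_cases hw : ∃ hw : w ∈ S, (T.induce S).Reachable ⟨x, hx⟩ ⟨w, hw⟩
      · obtain ⟨hwS, hxw⟩ := hw
        have hd := hT.dist_add_one_le_of_reachable_induce huv hu hwS (hxw.symm.trans hr)
        have hd' : (T.dist u w : ℝ) + 1 ≤ T.dist v w := mod_cast hd
        have he : e ⟨x, hx⟩ w = 1 := if_pos ⟨hwS, hxw⟩
        rw [he]
        linarith
      · have hd : T.dist u w ≤ T.dist u v + T.dist v w := hT.connected.dist_triangle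
        rw [dist_eq_one_iff_adj.mpr huv] at hd
        have hd' : (T.dist u w : ℝ) ≤ 1 + T.dist v w := mod_cast hd
        have he : e ⟨x, hx⟩ w = 0 := if_neg hw
        rw [he]
        linarith
    rw [hcomb] at hle
    linarith [hmed u]
  · intro hbw u
    by_cases hu : u = v
    · rw [hu]
    have hle : ∑ w : V, c w * (T.dist v w + T.dist u v * (1 - 2 * e ⟨u, hu⟩ w)) ≤
        ∑ w : V, c w * T.dist u w := by
      refine Finset.sum_le_sum fun w _ => mul_le_mul_of_nonneg_left ?_ (hc w)
      by_cases hw : ∃ hw : w ∈ S, (T.induce S).Reachable ⟨u, hu⟩ ⟨w, hw⟩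
      · have hd : T.dist v w ≤ T.dist v u + T.dist u w := hT.connected.dist_triangle
        rw [dist_comm (u := v) (v := u)] at hd
        have hd' : (T.dist v w : ℝ) ≤ T.dist u v + T.dist u w := mod_cast hd
        have he : e ⟨u, hu⟩ w = 1 := if_pos hw
        rw [he]
        linarith
      · have hd := hT.connected.dist_eq_add_of_not_reachable_induce hu (not_exists.mp hw)
        have he : e ⟨u, hu⟩ w = 0 := if_neg hw
        rw [he, hd]
        push_cast
        linarith
    rw [hcomb] at hle
    have hk : (0 : ℝ) ≤ T.dist u v * (N - 2 * W ⟨u, hu⟩) :=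
      mul_nonneg (Nat.cast_nonneg _) (by linarith [hbw ⟨u, hu⟩])
    linarith
end

section
/- Let G be a cycle of even order n ≥ 4 with a nonnegative vertex weight function c of total weight N = ∑_{x∈V(G)} c(x). Then σ_c(G) ≤ nN²/8, and equality holds if and only if every pair of opposite (antipodal) vertices of the cycle have equal weights. -/
open SimpleGraph Finset

/-- Distance between positions `a` and `b` around a cycle of order `n`. -/
def cycleDist (n a b : ℕ) : ℕ := min (max a b - min a b) (n - (max a b - min a b))

theorem cycleGraph_adj_iff_val {n : ℕ} (hn : 2 ≤ n) (u v : Fin n) :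
    (cycleGraph n).Adj u v ↔ u.val = v.val + 1 ∨ v.val = u.val + 1 ∨
      (u.val = 0 ∧ v.val + 1 = n) ∨ (v.val = 0 ∧ u.val + 1 = n) := by
  have hsub : ∀ a b : Fin n, (a - b).val = 1 ↔ a.val = b.val + 1 ∨ (a.val = 0 ∧ b.val + 1 = n) := by
    intro a b
    have ha := a.isLt
    have hb := b.isLt
    rw [Fin.val_sub]
    rcases lt_or_ge (n - b.val + a.val) n with h | h
    · rw [Nat.mod_eq_of_lt h]
      omega
    · rw [Nat.mod_eq_sub_mod h, Nat.mod_eq_of_lt (by omega)]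
      omega
  rw [cycleGraph_adj', hsub, hsub]
  tauto

theorem cycleDist_le_length {n : ℕ} (hn : 2 ≤ n) {u v : Fin n} (p : (cycleGraph n).Walk u v) :
    cycleDist n u v ≤ p.length := by
  induction p with
  | nil => simp [cycleDist]
  | @cons a b w h p ih =>
    have := a.isLt
    have := b.isLt
    have := w.isLt
    rw [cycleGraph_adj_iff_val hn] at h
    rw [Walk.length_cons]
    unfold cycleDist at *
    omega

theorem exists_walk_length_eq_cycleDist {n : ℕ} (hn : 2 ≤ n) (k : ℕ) :
    ∀ u v : Fin n, cycleDist n u v = k → ∃ p : (cycleGraph n).Walk u v, p.length = k := by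
  induction k with
  | zero =>
    intro u v h
    have hu := u.isLt
    have hv := v.isLt
    have huv : u = v := by
      ext
      unfold cycleDist at h
      omega
    subst huv
    exact ⟨Walk.nil, rfl⟩
  | succ k ih =>
    intro u v h
    have hu := u.isLt
    have hv := v.isLt
    obtain ⟨w, hw, hwv⟩ : ∃ w : Fin n, (cycleGraph n).Adj u w ∧ cycleDist n w v = k := by
      simp only [cycleGraph_adj_iff_val hn]
      unfold cycleDist at *
      by_cases hup : (u.val ≤ v.val ∧ v.val - u.val ≤ n - (v.val - u.val)) ∨
          (v.val < u.val ∧ n - (u.val - v.val) < u.val - v.val)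
      · by_cases hlast : u.val + 1 = n
        · exact ⟨⟨0, by omega⟩, by simp; omega, by simp; omega⟩
        · exact ⟨⟨u.val + 1, by omega⟩, by simp, by simp; omega⟩
      · by_cases hfirst : u.val = 0
        · exact ⟨⟨n - 1, by omega⟩, by simp; omega, by simp; omega⟩
        · exact ⟨⟨u.val - 1, by omega⟩, by simp; omega, by simp; omega⟩
    obtain ⟨p, hp⟩ := ih w v hwv
    exact ⟨Walk.cons hw p, by simp [hp]⟩

theorem cycleGraph_dist {n : ℕ} (hn : 2 ≤ n) (u v : Fin n) :
    (cycleGraph n).dist u v = cycleDist n u v := by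
  obtain ⟨p, hp⟩ := exists_walk_length_eq_cycleDist hn _ u v rfl
  apply le_antisymm
  · exact hp ▸ dist_le p
  · obtain ⟨q, hq⟩ := p.reachable.exists_walk_length_eq_dist
    exact hq ▸ cycleDist_le_length hn q

theorem SimpleGraph.Reachable.dist_map_le {V W : Type*} {G : SimpleGraph V} {H : SimpleGraph W}
    (f : G →g H) {u v : V} (h : G.Reachable u v) : H.dist (f u) (f v) ≤ G.dist u v := by
  obtain ⟨p, hp⟩ := h.exists_walk_length_eq_dist
  rw [← hp, ← Walk.length_map f p]
  exact dist_le _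

theorem SimpleGraph.Iso.dist_eq {V W : Type*} {G : SimpleGraph V} {H : SimpleGraph W}
    (φ : G ≃g H) (u v : V) : H.dist (φ u) (φ v) = G.dist u v := by
  by_cases h : G.Reachable u v
  · apply le_antisymm (h.dist_map_le φ.toHom)
    simpa using (φ.reachable_iff.2 h).dist_map_le φ.symm.toHom
  · rw [dist_eq_zero_of_not_reachable h,
      dist_eq_zero_of_not_reachable fun h' => h (φ.reachable_iff.1 h')]

/-- Sign telling on which side of the cut `{j, …, j + m - 1}` the position `x` lies. -/
def cutSign (m j x : ℕ) : ℝ := if j ≤ x ∧ x < j + m then 1 else -1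

theorem sum_cutSign_mul_cutSign {m x y : ℕ} (hx : x < 2 * m) (hy : y < 2 * m) :
    ∑ j ∈ range m, cutSign m j x * cutSign m j y = m - 2 * (cycleDist (2 * m) x y : ℝ) := by
  wlog hxy : x ≤ y generalizing x y
  · have h := this hy hx (by omega)
    have hcomm : cycleDist (2 * m) x y = cycleDist (2 * m) y x := by
      unfold cycleDist
      omega
    rw [hcomm, ← h]
    exact sum_congr rfl fun j _ => mul_comm _ _
  have hprod : ∀ j, cutSign m j x * cutSign m j y =
      1 - 2 * (if (j ≤ x ∧ x < j + m ↔ j ≤ y ∧ y < j + m) then 0 else 1) := by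
    intro j
    unfold cutSign
    by_cases h₁ : j ≤ x ∧ x < j + m <;> by_cases h₂ : j ≤ y ∧ y < j + m <;> simp [h₁, h₂] <;>
      norm_num
  have hcard : ((range m).filter
      fun j => ¬(j ≤ x ∧ x < j + m ↔ j ≤ y ∧ y < j + m)).card = cycleDist (2 * m) x y := by
    unfold cycleDist
    by_cases hym : y < m
    · have : (range m).filter (fun j => ¬(j ≤ x ∧ x < j + m ↔ j ≤ y ∧ y < j + m)) =
          Ioc x y := by
        ext j
        simp only [mem_filter, mem_range, mem_Ioc]
        omega
      rw [this, Nat.card_Ioc]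
      omega
    by_cases hxm : m ≤ x
    · have : (range m).filter (fun j => ¬(j ≤ x ∧ x < j + m ↔ j ≤ y ∧ y < j + m)) =
          Ioc (x - m) (y - m) := by
        ext j
        simp only [mem_filter, mem_range, mem_Ioc]
        omega
      rw [this, Nat.card_Ioc]
      omega
    · have : (range m).filter (fun j => ¬(j ≤ x ∧ x < j + m ↔ j ≤ y ∧ y < j + m)) =
          range m \ Ioc (min x (y - m)) (max x (y - m)) := by
        ext j
        simp only [mem_filter, mem_range, mem_Ioc, mem_sdiff]
        omega
      rw [this, card_sdiff_of_subset, Nat.card_Ioc, card_range]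
      · omega
      · intro j
        simp only [mem_range, mem_Ioc]
        omega
  rw [sum_congr rfl fun j _ => hprod j, sum_sub_distrib, ← mul_sum, ← hcard, card_filter]
  simp only [ite_not]
  push_cast
  simp

theorem sum_mul_cycleDist (m : ℕ) (g : ℕ → ℝ) :
    (1 / 2) * ∑ x ∈ range (2 * m), ∑ y ∈ range (2 * m), g x * g y * cycleDist (2 * m) x y =
      m * (∑ x ∈ range (2 * m), g x) ^ 2 / 4 -
        (∑ j ∈ range m, (∑ x ∈ range (2 * m), g x * cutSign m j x) ^ 2) / 4 := by
  have hsq : ∑ j ∈ range m, (∑ x ∈ range (2 * m), g x * cutSign m j x) ^ 2 =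
      ∑ x ∈ range (2 * m), ∑ y ∈ range (2 * m),
        (m * (g x * g y) - 2 * (g x * g y * cycleDist (2 * m) x y)) := by
    simp only [sq, sum_mul_sum]
    rw [sum_comm]
    refine sum_congr rfl fun x hx => ?_
    rw [sum_comm]
    refine sum_congr rfl fun y hy => ?_
    have h := sum_cutSign_mul_cutSign (mem_range.1 hx) (mem_range.1 hy)
    calc ∑ j ∈ range m, g x * cutSign m j x * (g y * cutSign m j y)
        = g x * g y * ∑ j ∈ range m, cutSign m j x * cutSign m j y := by
          rw [mul_sum]
          exact sum_congr rfl fun j _ => by ring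
      _ = _ := by
          rw [h]
          ring
  rw [hsq, sq, sum_mul_sum]
  simp only [sum_sub_distrib, ← mul_sum]
  ring

theorem sum_mul_cutSign {m j : ℕ} (hj : j ≤ m) (g : ℕ → ℝ) :
    ∑ x ∈ range (2 * m), g x * cutSign m j x =
      ∑ x ∈ range m, (g x - g (m + x)) * (if j ≤ x then 1 else -1) := by
  rw [two_mul, sum_range_add, ← sum_add_distrib]
  refine sum_congr rfl fun x hx => ?_
  have hx := mem_range.1 hx
  unfold cutSign
  by_cases h : j ≤ x
  · rw [if_pos (by omega), if_neg (by omega), if_pos h]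
    ring
  · rw [if_neg (by omega), if_pos (by omega), if_neg h]
    ring

theorem forall_sum_mul_cutSign_eq_zero_iff (m : ℕ) (g : ℕ → ℝ) :
    (∀ j ∈ range m, ∑ x ∈ range (2 * m), g x * cutSign m j x = 0) ↔
      ∀ x < m, g x = g (m + x) := by
  constructor
  · intro h x hx
    have hall : ∀ j ≤ m,
        ∑ x ∈ range m, (g x - g (m + x)) * (if j ≤ x then (1 : ℝ) else -1) = 0 := by
      intro j hj
      rcases hj.lt_or_eq with hj' | rfl
      · rw [← sum_mul_cutSign hj]
        exact h j (mem_range.2 hj')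
      · have h₀ := h 0 (mem_range.2 (by omega))
        rw [sum_mul_cutSign (Nat.zero_le _)] at h₀
        rw [← neg_eq_zero, ← sum_neg_distrib, ← h₀]
        refine sum_congr rfl fun y hy => ?_
        have hy := mem_range.1 hy
        rw [if_neg (by omega), if_pos (Nat.zero_le _)]
        ring
    have hdiff : ∑ y ∈ range m, (if y = x then 2 * (g x - g (m + x)) else 0) = 0 := by
      refine Eq.trans ?_ (sub_eq_zero_of_eq ((hall x hx.le).trans (hall (x + 1) hx).symm))
      rw [← sum_sub_distrib]
      refine sum_congr rfl fun y _ => ?_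
      rcases lt_trichotomy y x with hy | rfl | hy
      · rw [if_neg (by omega), if_neg (by omega), if_neg (by omega)]
        ring
      · rw [if_pos rfl, if_pos le_rfl, if_neg (by omega)]
        ring
      · rw [if_neg (by omega), if_pos (by omega), if_pos (by omega)]
        ring
    rw [sum_ite_eq' (range m) x, if_pos (mem_range.2 hx)] at hdiff
    linarith
  · intro h j hj
    rw [sum_mul_cutSign (mem_range.1 hj).le]
    refine sum_eq_zero fun x hx => ?_
    rw [h x (mem_range.1 hx)]
    ring

/-- Let `G` be a cycle of even order `n ≥ 4` with a nonnegative vertex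
weight function `c` of total weight `N`. Then the weighted total distance
`σ_c(G) = ∑_{unordered pairs {x,y}} c(x)c(y)d(x,y)` (here written as half the double sum)
is at most `nN²/8`, with equality iff every pair of opposite vertices (vertices at
distance `n/2`) have equal weights. -/
theorem weighted_total_distance_even_cycle
    {V : Type*} [Fintype V] (n : ℕ) (hn : 4 ≤ n) (heven : Even n)
    (G : SimpleGraph V) (hiso : Nonempty (G ≃g cycleGraph n))
    (c : V → ℝ) (hc : ∀ v, 0 ≤ c v) (N : ℝ) (hN : N = ∑ v : V, c v) :
    (1 / 2) * (∑ x : V, ∑ y : V, c x * c y * G.dist x y) ≤ n * N ^ 2 / 8 ∧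
    ((1 / 2) * (∑ x : V, ∑ y : V, c x * c y * G.dist x y) = n * N ^ 2 / 8 ↔
      ∀ x y : V, G.dist x y = n / 2 → c x = c y) := by
  obtain ⟨φ⟩ := hiso
  obtain ⟨m, rfl⟩ := heven
  rw [← two_mul] at *
  set g : ℕ → ℝ := fun k => if h : k < 2 * m then c (φ.symm ⟨k, h⟩) else 0 with hg
  have hgφ : ∀ v, g (φ v) = c v := fun v => by simp [hg]
  have hdist : ∀ x y, G.dist x y = cycleDist (2 * m) (φ x) (φ y) := fun x y => by
    rw [← cycleGraph_dist (by omega), Iso.dist_eq]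
  have hsum : ∀ f : ℕ → ℝ, ∑ v : V, f (φ v) = ∑ k ∈ range (2 * m), f k := fun f => by
    rw [← Fin.sum_univ_eq_sum_range]
    exact φ.toEquiv.sum_comp fun k : Fin (2 * m) => f k
  have hN' : N = ∑ k ∈ range (2 * m), g k := by
    rw [hN, ← hsum]
    simp only [hgφ]
  have hσ : ∑ x : V, ∑ y : V, c x * c y * G.dist x y =
      ∑ x ∈ range (2 * m), ∑ y ∈ range (2 * m), g x * g y * cycleDist (2 * m) x y := by
    rw [← hsum]
    refine sum_congr rfl fun x _ => ?_
    rw [← hsum]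
    refine sum_congr rfl fun y _ => ?_
    rw [hgφ, hgφ, hdist]
  have hanti : (∀ x y : V, G.dist x y = 2 * m / 2 → c x = c y) ↔ ∀ k < m, g k = g (m + k) := by
    constructor
    · intro h k hk
      have := h (φ.symm ⟨k, by omega⟩) (φ.symm ⟨m + k, by omega⟩) (by
        rw [hdist]
        simp only [RelIso.apply_symm_apply, cycleDist]
        omega)
      simpa [hg, show k < 2 * m by omega, show m + k < 2 * m by omega] using this
    · intro h x y hxy
      rw [hdist] at hxy
      have hx := (φ x).isLt
      have hy := (φ y).isLt
      rw [← hgφ x, ← hgφ y]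
      unfold cycleDist at hxy
      rcases le_total (φ x).val (φ y).val with hle | hle
      · rw [h _ (by omega)]
        congr 1
        omega
      · rw [h (φ y) (by omega)]
        congr 1
        omega
  have hnonneg : 0 ≤ ∑ j ∈ range m, (∑ x ∈ range (2 * m), g x * cutSign m j x) ^ 2 :=
    sum_nonneg fun j _ => sq_nonneg _
  rw [hσ, sum_mul_cycleDist, hanti, ← forall_sum_mul_cutSign_eq_zero_iff, ← hN']
  push_cast
  refine ⟨by linarith, ?_⟩
  have hzero := sum_eq_zero_iff_of_nonneg
    (s := range m) (f := fun j => (∑ x ∈ range (2 * m), g x * cutSign m j x) ^ 2)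
    fun j _ => sq_nonneg _
  simp only [sq_eq_zero_iff] at hzero
  rw [← hzero]
  constructor <;> intro h <;> linarith
end

section
/- Let G be a cycle of odd order n ≥ 3 with a nonnegative vertex weight function c of total weight N = ∑_{x∈V(G)} c(x). Then σ_c(G) ≤ (n²−1)N²/(8n), and equality holds if and only if all vertices have the same weight. -/
open SimpleGraph Finset

lemma Fin.val_sub_eq_ite' {n : ℕ} (x y : Fin n) :
    (x - y).val = if y.val ≤ x.val then x.val - y.val else n + x.val - y.val := by
  split_ifs with h
  · exact Fin.sub_val_of_le h
  · exact Fin.coe_sub_iff_lt.2 (not_le.1 h)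

/-- An isomorphism of simple graphs preserves distances. -/
lemma SimpleGraph.Iso.dist_apply {V W : Type*} {G : SimpleGraph V} {H : SimpleGraph W}
    (e : G ≃g H) (hG : G.Connected) (x y : V) : H.dist (e x) (e y) = G.dist x y := by
  have hH : H.Connected := e.connected_iff.1 hG
  apply le_antisymm
  · obtain ⟨p, hp⟩ := hG.exists_walk_length_eq_dist x y
    rw [← hp, ← p.length_map e.toHom]
    exact dist_le _
  · obtain ⟨p, hp⟩ := hH.exists_walk_length_eq_dist (e x) (e y)
    rw [← hp, ← p.length_map e.symm.toHom]
    simpa using dist_le (p.map e.symm.toHom)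

lemma cycleGraph_dist_le_sub {n : ℕ} (d : ℕ) (x y : Fin n) (h : (y - x).val = d) :
    (cycleGraph n).dist x y ≤ d := by
  induction d generalizing y with
  | zero =>
    have : x = y := by
      rw [Fin.val_sub_eq_ite'] at h
      apply Fin.ext
      split_ifs at h <;> omega
    simp [this]
  | succ d ih =>
    have hlt := (y - x).isLt
    let o : Fin n := ⟨1, by omega⟩
    have hadj : (cycleGraph n).Adj (y - o) y := by
      rw [cycleGraph_adj']
      right
      simp only [Fin.val_sub_eq_ite', o] at h ⊢
      split_ifs at h ⊢ <;> omega
    have hd : (y - o - x).val = d := by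
      simp only [Fin.val_sub_eq_ite', o] at h ⊢
      split_ifs at h ⊢ <;> omega
    have hc : (cycleGraph n).Connected := by
      obtain _ | n := n
      · exact x.elim0
      · exact cycleGraph_connected
    have := hc.dist_triangle (u := x) (v := y - o) (w := y)
    rw [dist_eq_one_iff_adj.2 hadj] at this
    have := ih _ hd
    omega

lemma cycleGraph_min_le_length {n : ℕ} {x y : Fin n} (p : (cycleGraph n).Walk x y) :
    min (y - x).val (n - (y - x).val) ≤ p.length := by
  induction p with
  | nil => simp [Fin.val_sub_eq_ite']
  | @cons u v w h p ih =>
    rw [Walk.length_cons]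
    rw [cycleGraph_adj'] at h
    simp only [Fin.val_sub_eq_ite'] at h ih ⊢
    split_ifs at h ih ⊢ <;> omega

/-- The distance in a cycle graph is the length of the shorter of the two arcs. -/
lemma cycleGraph_dist_s7 {n : ℕ} (x y : Fin n) :
    (cycleGraph n).dist x y = min (y - x).val (n - (y - x).val) := by
  have hc : (cycleGraph n).Connected := by
    obtain _ | n := n
    · exact x.elim0
    · exact cycleGraph_connected
  apply le_antisymm
  · refine le_min (cycleGraph_dist_le_sub _ x y rfl) ?_
    rw [SimpleGraph.dist_comm]
    refine (cycleGraph_dist_le_sub _ y x rfl).trans ?_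
    simp only [Fin.val_sub_eq_ite']
    split_ifs <;> omega
  · obtain ⟨p, hp⟩ := hc.exists_walk_length_eq_dist x y
    exact hp ▸ cycleGraph_min_le_length p

/-- The indicator of the arc of `k` consecutive vertices starting at `i`. -/
def arcInd (k : ℕ) (i x : Fin (2 * k + 1)) : ℝ := if (x - i).val < k then 1 else 0

lemma sum_arcInd (k : ℕ) (x : Fin (2 * k + 1)) : ∑ i, arcInd k i x = k := by
  rw [← (Equiv.subLeft x).sum_comp]
  simp only [arcInd, Equiv.subLeft_apply, sub_sub_cancel, sum_boole]
  rw [Fin.card_filter_val_lt]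
  congr 1
  omega

/-- The distance in an odd cycle counts the arcs of length `k` separating two vertices. -/
lemma sum_arcInd_mul_one_sub (k : ℕ) (x y : Fin (2 * k + 1)) :
    ∑ i, arcInd k i x * (1 - arcInd k i y) = (cycleGraph (2 * k + 1)).dist x y := by
  rw [cycleGraph_dist_s7, ← (Equiv.subLeft x).sum_comp]
  obtain ⟨t, rfl⟩ : ∃ t, y = x + t := ⟨y - x, by abel⟩
  have key (m : Fin (2 * k + 1)) :
      arcInd k (x - m) x * (1 - arcInd k (x - m) (x + t)) =
        if (if t.val ≤ k then k - t.val ≤ m.val ∧ m.val < k else m.val < 2 * k + 1 - t.val)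
        then 1 else 0 := by
    have h1 : x + t - (x - m) = m + t := by abel
    rw [arcInd, arcInd, sub_sub_cancel, h1, Fin.val_add_eq_ite]
    split_ifs <;> first | omega | simp
  have ht := t.isLt
  simp only [Equiv.subLeft_apply, key, add_sub_cancel_left]
  rw [Fin.sum_univ_eq_sum_range (fun m : ℕ => if (if t.val ≤ k then k - t.val ≤ m ∧ m < k
    else m < 2 * k + 1 - t.val) then (1 : ℝ) else 0), sum_boole]
  have hI : (range (2 * k + 1)).filter (fun m => if t.val ≤ k then k - t.val ≤ m ∧ m < k
      else m < 2 * k + 1 - t.val) =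
      if t.val ≤ k then Ico (k - t.val) k else range (2 * k + 1 - t.val) := by
    ext m
    split_ifs <;> simp only [mem_filter, mem_range, mem_Ico] <;> omega
  rw [hI]
  congr 1
  split_ifs <;> simp only [Nat.card_Ico, card_range] <;> omega

lemma arcInd_sub_arcInd_succ {k : ℕ} (hk : 0 < k) (i x : Fin (2 * k + 1)) :
    arcInd k i x - arcInd k (i + 1) x =
      (if x = i then 1 else 0) - (if x = i + ⟨k, by omega⟩ then 1 else 0) := by
  have h1 : (1 : Fin (2 * k + 1)).val = 1 := by
    rw [Fin.val_one', Nat.mod_eq_of_lt (by omega)]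
  simp only [arcInd, Fin.ext_iff, Fin.val_sub_eq_ite', Fin.val_add_eq_ite, h1]
  split_ifs <;> first | omega | simp

/-- The total weight of the arc of `k` consecutive vertices starting at `i`. -/
noncomputable def arcWeight (k : ℕ) (c : Fin (2 * k + 1) → ℝ) (i : Fin (2 * k + 1)) : ℝ :=
  ∑ x, arcInd k i x * c x

lemma sum_arcWeight (k : ℕ) (c : Fin (2 * k + 1) → ℝ) :
    ∑ i, arcWeight k c i = k * ∑ x, c x := by
  simp only [arcWeight]
  rw [sum_comm, mul_sum]
  simp only [← sum_mul, sum_arcInd]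

lemma sum_arcWeight_mul (k : ℕ) (c : Fin (2 * k + 1) → ℝ) :
    ∑ i, arcWeight k c i * (∑ x, c x - arcWeight k c i) =
      ∑ x, ∑ y, c x * c y * (cycleGraph (2 * k + 1)).dist x y := by
  have h (i) : arcWeight k c i * (∑ x, c x - arcWeight k c i) =
      ∑ x, ∑ y, c x * c y * (arcInd k i x * (1 - arcInd k i y)) := by
    rw [arcWeight, ← sum_sub_distrib, sum_mul_sum]
    exact sum_congr rfl fun x _ => sum_congr rfl fun y _ => by ring
  simp only [h, ← sum_arcInd_mul_one_sub, mul_sum]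
  rw [sum_comm]
  refine sum_congr rfl fun x _ => ?_
  rw [sum_comm]

/-- The defect in the distance bound is a sum of squared deviations of arc weights. -/
lemma sum_sq_arcWeight_sub (k : ℕ) (c : Fin (2 * k + 1) → ℝ) :
    ∑ i, (arcWeight k c i - k * (∑ x, c x) / (2 * k + 1)) ^ 2 =
      k * (k + 1) * (∑ x, c x) ^ 2 / (2 * k + 1) -
        ∑ x, ∑ y, c x * c y * (cycleGraph (2 * k + 1)).dist x y := by
  rw [← sum_arcWeight_mul]
  set N := ∑ x, c x with hN
  have h (i) : (arcWeight k c i - k * N / (2 * k + 1)) ^ 2 =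
      (N - 2 * (k * N / (2 * k + 1))) * arcWeight k c i + (k * N / (2 * k + 1)) ^ 2
        - arcWeight k c i * (N - arcWeight k c i) := by ring
  simp only [h, sum_sub_distrib, sum_add_distrib, ← mul_sum, sum_arcWeight, ← hN, sum_const,
    card_univ, Fintype.card_fin, nsmul_eq_mul]
  push_cast
  field_simp
  ring

lemma eq_of_arcWeight_eq {k : ℕ} (hk : 0 < k) {c : Fin (2 * k + 1) → ℝ} {m : ℝ}
    (h : ∀ i, arcWeight k c i = m) (x y : Fin (2 * k + 1)) : c x = c y := by
  have hstep (i : Fin (2 * k + 1)) : c i = c (i + ⟨k, by omega⟩) := by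
    have := sub_eq_zero.2 ((h i).trans (h (i + 1)).symm)
    simp only [arcWeight, ← sum_sub_distrib, ← sub_mul, arcInd_sub_arcInd_succ hk] at this
    simpa [sub_mul, sub_eq_zero] using this
  have hsucc (i : Fin (2 * k + 1)) : c (i + 1) = c i := by
    rw [hstep (i + 1), hstep]
    congr 1
    have h1 : (1 : Fin (2 * k + 1)).val = 1 := by
      rw [Fin.val_one', Nat.mod_eq_of_lt (by omega)]
    simp only [Fin.ext_iff, Fin.val_add_eq_ite, h1]
    split_ifs <;> omega
  have h0 (i : Fin (2 * k + 1)) : c i = c 0 := by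
    induction i using Fin.induction with
    | zero => rfl
    | succ i ih => rw [← ih, ← hsucc i.castSucc, Fin.coeSucc_eq_succ]
  rw [h0 x, h0 y]

lemma arcWeight_const (k : ℕ) (a : ℝ) (i : Fin (2 * k + 1)) :
    arcWeight k (fun _ => a) i = k * a := by
  rw [arcWeight, ← sum_mul, ← Equiv.sum_comp (Equiv.addRight i)]
  simp only [arcInd, Equiv.coe_addRight, add_sub_cancel_right, sum_boole]
  rw [Fin.card_filter_val_lt, min_eq_right (by omega)]

/-- Let `G` be a cycle of odd order `n ≥ 3` with a nonnegative vertex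
weight function `c` of total weight `N`. Then the weighted total distance
`σ_c(G) = ∑_{unordered pairs {x,y}} c(x)c(y)d(x,y)` (here written as half the double sum)
is at most `(n²-1)N²/(8n)`, with equality iff all vertices have the same weight. -/
theorem weighted_total_distance_odd_cycle
    {V : Type*} [Fintype V] (n : ℕ) (hn : 3 ≤ n) (hodd : Odd n)
    (G : SimpleGraph V) (hiso : Nonempty (G ≃g cycleGraph n))
    (c : V → ℝ) (hc : ∀ v, 0 ≤ c v) (N : ℝ) (hN : N = ∑ v : V, c v) :
    (1 / 2) * (∑ x : V, ∑ y : V, c x * c y * G.dist x y) ≤ ((n : ℝ) ^ 2 - 1) * N ^ 2 / (8 * n) ∧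
    ((1 / 2) * (∑ x : V, ∑ y : V, c x * c y * G.dist x y) = ((n : ℝ) ^ 2 - 1) * N ^ 2 / (8 * n) ↔
      ∀ x y : V, c x = c y) := by
  obtain ⟨e⟩ := hiso
  obtain ⟨k, rfl⟩ := hodd
  have hk : 0 < k := by omega
  have hG : G.Connected := e.connected_iff.2 cycleGraph_connected
  obtain ⟨b, rfl⟩ : ∃ b : Fin (2 * k + 1) → ℝ, c = b ∘ e :=
    ⟨c ∘ e.symm, by ext x; simp⟩
  have hNb : N = ∑ x, b x := hN.trans (e.toEquiv.sum_comp b)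
  have hS : ∑ x : V, ∑ y : V, (b ∘ e) x * (b ∘ e) y * G.dist x y =
      ∑ x, ∑ y, b x * b y * (cycleGraph (2 * k + 1)).dist x y := by
    rw [← e.toEquiv.sum_comp]
    refine sum_congr rfl fun x _ => ?_
    rw [← e.toEquiv.sum_comp]
    refine sum_congr rfl fun y _ => ?_
    rw [← e.dist_apply hG]
    rfl
  have hR : (((2 * k + 1 : ℕ) : ℝ) ^ 2 - 1) * N ^ 2 / (8 * (2 * k + 1 : ℕ)) =
      1 / 2 * (k * (k + 1) * (∑ x, b x) ^ 2 / (2 * k + 1)) := by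
    rw [← hNb]
    push_cast
    field_simp
    ring
  have hD := sum_sq_arcWeight_sub k b
  have hnn : 0 ≤ ∑ i, (arcWeight k b i - k * (∑ x, b x) / (2 * k + 1)) ^ 2 :=
    sum_nonneg fun i _ => sq_nonneg _
  rw [hS, hR]
  refine ⟨by linarith, fun h => ?_, fun h => ?_⟩
  · have hz : ∑ i, (arcWeight k b i - k * (∑ x, b x) / (2 * k + 1)) ^ 2 = 0 := by linarith
    rw [sum_eq_zero_iff_of_nonneg fun i _ => sq_nonneg _] at hz
    intro x y
    exact eq_of_arcWeight_eq hk
      (fun i => sub_eq_zero.1 (pow_eq_zero_iff two_ne_zero |>.1 (hz i (mem_univ i)))) _ _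
  · obtain ⟨a, rfl⟩ : ∃ a, b = fun _ => a := by
      refine ⟨b 0, funext fun i => ?_⟩
      simpa using h (e.symm i) (e.symm 0)
    have hz : ∑ i, (arcWeight k (fun _ => a) i -
        k * (∑ x : Fin (2 * k + 1), a) / (2 * k + 1)) ^ 2 = 0 := by
      refine sum_eq_zero fun i _ => ?_
      rw [arcWeight_const]
      simp
      field_simp
      simp
    linarith
end

section
/- Let G be a cycle of order n ≥ 3 with a nonnegative vertex weight function c of total weight N = ∑_{x∈V(G)} c(x). Then there exists a vertex v of G such that σ_c(v,G) ≤ nN/4 if n is even, and σ_c(v,G) ≤ (n²−1)N/(4n) if n is odd. -/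
open SimpleGraph Finset

theorem four_mul_sum_range_min_add_mod_two (n : ℕ) :
    4 * ∑ k ∈ range n, min k (n - k) + n % 2 = n ^ 2 := by
  induction n using Nat.twoStepInduction with
  | zero => simp
  | one => simp
  | more n ih _ =>
    have shift : ∑ k ∈ range (n + 1), min (k + 1) (n + 2 - (k + 1)) =
        ∑ k ∈ range (n + 1), (min k (n - k) + 1) :=
      sum_congr rfl fun k hk => by
        have := mem_range.mp hk
        omega
    rw [sum_range_succ', shift, sum_add_distrib, sum_range_succ]
    simp only [Nat.sub_self, Nat.min_zero, Nat.zero_min, sum_const, card_range, smul_eq_mul,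
      mul_one, add_zero, Nat.add_mod_right]
    linarith

open scoped Fin.CommRing in
theorem SimpleGraph.Iso.dist_symm_le_val_sub {V : Type*} {m : ℕ} {G : SimpleGraph V}
    (e : G ≃g cycleGraph (m + 2)) (a b : Fin (m + 2)) :
    G.dist (e.symm a) (e.symm b) ≤ (b - a).val := by
  have hconn : G.Connected := e.connected_iff.mpr cycleGraph_connected
  have key : ∀ k : ℕ, G.dist (e.symm a) (e.symm (a + (k : Fin (m + 2)))) ≤ k := by
    intro k
    induction k with
    | zero => simp
    | succ k ih =>
      have hadj : G.Adj (e.symm (a + (k : Fin (m + 2))))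
          (e.symm (a + ((k + 1 : ℕ) : Fin (m + 2)))) := by
        rw [e.symm.map_adj_iff, cycleGraph_adj]
        right
        push_cast
        abel
      exact hconn.dist_triangle.trans (Nat.add_le_add ih (dist_eq_one_iff_adj.mpr hadj).le)
  simpa using key (b - a).val

theorem SimpleGraph.Iso.four_mul_sum_dist_le {V : Type*} [Fintype V] {m : ℕ} {G : SimpleGraph V}
    (e : G ≃g cycleGraph (m + 2)) (w : V) :
    4 * ∑ v, G.dist v w + (m + 2) % 2 ≤ (m + 2) ^ 2 := by
  rw [← four_mul_sum_range_min_add_mod_two]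
  gcongr
  rw [← Fin.sum_univ_eq_sum_range (fun k => min k (m + 2 - k)), ← e.symm.toEquiv.sum_comp,
    ← Equiv.sum_comp (Equiv.addRight (e w))]
  refine sum_le_sum fun k _ => ?_
  have h₁ := e.dist_symm_le_val_sub (e w) (k + e w)
  have h₂ := e.dist_symm_le_val_sub (k + e w) (e w)
  rw [dist_comm] at h₁
  simp only [add_sub_cancel_right, sub_add_cancel_right, e.symm_apply_apply] at h₁ h₂
  refine le_min h₁ (h₂.trans ?_)
  rw [Fin.val_neg']
  exact Nat.mod_le _ _

/-- Let `G` be a cycle of order `n ≥ 3` with a nonnegative vertex weight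
function `c` of total weight `N`. Then there is a vertex `v` whose weighted distance
`σ_c(v,G) = ∑_w c(w) d(v,w)` is at most `nN/4` if `n` is even, and at most
`(n²-1)N/(4n)` if `n` is odd. -/
theorem exists_vertex_small_weighted_distance_cycle
    {V : Type*} [Fintype V] (n : ℕ) (hn : 3 ≤ n)
    (G : SimpleGraph V) (hiso : Nonempty (G ≃g cycleGraph n))
    (c : V → ℝ) (hc : ∀ v, 0 ≤ c v) (N : ℝ) (hN : N = ∑ v : V, c v) :
    ∃ v : V, (∑ w : V, c w * G.dist v w) ≤
      if Even n then (n : ℝ) * N / 4 else ((n : ℝ) ^ 2 - 1) * N / (4 * n) := by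
  obtain ⟨e⟩ := hiso
  obtain ⟨m, rfl⟩ : ∃ m, n = m + 2 := ⟨n - 2, by omega⟩
  set n := m + 2 with n_def
  have hn0 : (n : ℝ) ≠ 0 := by positivity
  have hcard : Fintype.card V = n := by simpa using Fintype.card_congr e.toEquiv
  have : Nonempty V := ⟨e.symm 0⟩
  have hrhs : (if Even n then (n : ℝ) * N / 4 else ((n : ℝ) ^ 2 - 1) * N / (4 * n)) =
      ((n : ℝ) ^ 2 - (n % 2 : ℕ)) / 4 * N / n := by
    split_ifs with h
    · rw [Nat.even_iff.mp h]
      field_simp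
      push_cast
      ring
    · rw [Nat.not_even_iff.mp h]
      field_simp
      push_cast
      ring
  have hdist (w : V) : ∑ v, (G.dist v w : ℝ) ≤ ((n : ℝ) ^ 2 - (n % 2 : ℕ)) / 4 := by
    have h : (4 * ∑ v, (G.dist v w : ℝ)) + (n % 2 : ℕ) ≤ (n : ℝ) ^ 2 :=
      mod_cast e.four_mul_sum_dist_le w
    linarith
  have hsum : ∑ v, ∑ w, c w * (G.dist v w : ℝ) ≤
      ∑ _v : V, ((n : ℝ) ^ 2 - (n % 2 : ℕ)) / 4 * N / n := by
    rw [sum_comm, sum_const, card_univ, hcard, nsmul_eq_mul, mul_div_cancel₀ _ hn0, hN, mul_sum]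
    refine sum_le_sum fun w _ => ?_
    rw [← mul_sum, mul_comm]
    exact mul_le_mul_of_nonneg_right (hdist w) (hc w)
  obtain ⟨v, -, hv⟩ := exists_le_of_sum_le univ_nonempty hsum
  exact ⟨v, hv.trans_eq hrhs.symm⟩
end

section
/- Let G be a finite connected chordal simple graph. Then 2·rad(G) − 2 ≤ diam(G) ≤ 2·rad(G). -/
open SimpleGraph Finset

namespace SimpleGraph

variable {V : Type*} {G : SimpleGraph V}

/-- There is no induced cycle of length at least four. -/
def Chordal (G : SimpleGraph V) : Prop :=
  ¬ ∃ (k : ℕ) (f : Fin k ↪ V), 4 ≤ k ∧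
    ∀ i j : Fin k, G.Adj (f i) (f j) ↔ (cycleGraph k).Adj i j

/-- The edges of `G` with both ends in `s`, as a graph on the whole vertex type. -/
def within (G : SimpleGraph V) (s : Set V) : SimpleGraph V where
  Adj a b := G.Adj a b ∧ a ∈ s ∧ b ∈ s
  symm := ⟨fun _ _ h => ⟨h.1.symm, h.2.2, h.2.1⟩⟩
  loopless := ⟨fun _ h => G.loopless.irrefl _ h.1⟩

/-- The vertices outside `s` with a neighbour in `s`. -/
def outerBoundary (G : SimpleGraph V) (s : Set V) : Set V :=
  {y | y ∉ s ∧ ∃ a ∈ s, G.Adj a y}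

/-- A vertex adjacent to both ends of an induced path of length at least two in a chordal graph is
adjacent to an inner vertex of the path. -/
lemma Chordal.exists_adj_inner (hc : G.Chordal) {n : ℕ} (hn : 2 ≤ n) {p : ℕ → V} {x : V}
    (hinj : ∀ i ≤ n, ∀ j ≤ n, p i = p j → i = j)
    (hp : ∀ i ≤ n, ∀ j ≤ n, G.Adj (p i) (p j) ↔ i + 1 = j ∨ j + 1 = i)
    (hx : ∀ i ≤ n, p i ≠ x) (h0 : G.Adj x (p 0)) (hlast : G.Adj x (p n)) :
    ∃ i, 0 < i ∧ i < n ∧ G.Adj x (p i) := by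
  by_contra! hno
  have hxp : ∀ i ≤ n, G.Adj x (p i) ↔ i = 0 ∨ i = n := by
    intro i hi
    constructor
    · intro h
      by_contra! h'
      exact hno i (by omega) (by omega) h
    · rintro (rfl | rfl) <;> assumption
  have hcycle_inj : Function.Injective
      fun i : Fin (n + 2) => if i.val ≤ n then p i.val else x := by
    intro i j hij
    have := i.2
    have := j.2
    simp only at hij
    ext
    split_ifs at hij with h1 h2 h2
    · exact hinj _ h1 _ h2 hij
    · exact absurd hij (hx _ h1)
    · exact absurd hij.symm (hx _ h2)
    · omega
  refine hc ⟨n + 2, ⟨_, hcycle_inj⟩, by omega, ?_⟩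
  intro i j
  have hi := i.2
  have hj := j.2
  have hcyc : (cycleGraph (n + 2)).Adj i j ↔ i.val + 1 = j.val ∨ j.val + 1 = i.val ∨
      (i.val = 0 ∧ j.val = n + 1) ∨ (j.val = 0 ∧ i.val = n + 1) := by
    have sub_val : ∀ a b : Fin (n + 2), (a - b).val = 1 ↔
        b.val + 1 = a.val ∨ (a.val = 0 ∧ b.val = n + 1) := by
      intro a b
      have ha := a.2
      have hb := b.2
      rcases le_or_gt b a with h | h
      · rw [Fin.sub_val_of_le h]
        have : b.val ≤ a.val := h
        omega
      · rw [Fin.coe_sub_iff_lt.2 h]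
        have : a.val < b.val := h
        omega
    rw [cycleGraph_adj', sub_val, sub_val]
    tauto
  rw [hcyc]
  simp only [Function.Embedding.coeFn_mk]
  split_ifs with h1 h2 h2
  · rw [hp _ h1 _ h2]
    omega
  · rw [G.adj_comm, hxp _ h1]
    omega
  · rw [hxp _ h2]
    omega
  · simp only [SimpleGraph.irrefl, false_iff]
    omega

/-- A vertex adjacent to both ends of an induced path of length at least two in a chordal graph is
adjacent to the last but one vertex of the path. -/
lemma Chordal.adj_penultimate (hc : G.Chordal) {n : ℕ} (hn : 2 ≤ n) {p : ℕ → V} {x : V}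
    (hinj : ∀ i ≤ n, ∀ j ≤ n, p i = p j → i = j)
    (hp : ∀ i ≤ n, ∀ j ≤ n, G.Adj (p i) (p j) ↔ i + 1 = j ∨ j + 1 = i)
    (hx : ∀ i ≤ n, p i ≠ x) (h0 : G.Adj x (p 0)) (hlast : G.Adj x (p n)) :
    G.Adj x (p (n - 1)) := by
  induction n using Nat.strong_induction_on generalizing p with
  | _ n ih =>
    obtain ⟨i, hi0, hin, hi⟩ := hc.exists_adj_inner hn hinj hp hx h0 hlast
    rcases Nat.lt_or_ge (i + 1) n with h | h
    · have key := ih (n - i) (by omega) (by omega) (p := fun k => p (i + k))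
        (fun a ha b hb hab => by have := hinj _ (by omega) _ (by omega) hab; omega)
        (fun a ha b hb => by rw [hp _ (by omega) _ (by omega)]; omega)
        (fun a ha => hx _ (by omega)) hi
        (by simpa [Nat.add_sub_cancel' hin.le] using hlast)
      simpa [show i + (n - i - 1) = n - 1 by omega] using key
    · rwa [show n - 1 = i by omega]

/-- Two vertices joined in `G.within s` are the ends of a path in `s` that is induced in `G`. -/
lemma exists_induced_path {s : Set V} {u v : V} (hu : u ∈ s) (h : (G.within s).Reachable u v) :
    ∃ (n : ℕ) (p : ℕ → V), p 0 = u ∧ p n = v ∧ (∀ i, p i ∈ s) ∧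
      (∀ i ≤ n, ∀ j ≤ n, p i = p j → i = j) ∧
      ∀ i ≤ n, ∀ j ≤ n, G.Adj (p i) (p j) ↔ i + 1 = j ∨ j + 1 = i := by
  obtain ⟨w, hw⟩ := h.exists_walk_length_eq_dist
  have hs : ∀ i, w.getVert i ∈ s := by
    intro i
    rcases Nat.eq_zero_or_pos i with rfl | hi
    · simpa using hu
    rcases Nat.lt_or_ge (i - 1) w.length with hlt | hge
    · have := (w.adj_getVert_succ hlt).2.2
      rwa [Nat.sub_add_cancel hi] at this
    · rcases Nat.eq_zero_or_pos w.length with h0 | h0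
      · rw [w.getVert_of_length_le (by omega), ← w.eq_of_length_eq_zero h0]
        exact hu
      · have := (w.adj_getVert_succ (i := w.length - 1) (by omega)).2.2
        rwa [Nat.sub_add_cancel h0, w.getVert_length,
          ← w.getVert_of_length_le (show w.length ≤ i by omega)] at this
  have short : ∀ i j, i ≤ j → j ≤ w.length → ∀ q : (G.within s).Walk (w.getVert i) (w.getVert j),
      j ≤ i + q.length := by
    intro i j hij hj q
    have := dist_le ((w.take i).append (q.append (w.drop j)))
    simp only [Walk.length_append, Walk.take_length, Walk.drop_length] at this
    omega
  refine ⟨w.length, w.getVert, by simp, by simp, hs, ?_, ?_⟩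
  · have aux : ∀ i j, i ≤ j → j ≤ w.length → w.getVert i = w.getVert j → i = j := by
      intro i j hij hj h
      have := short i j hij hj (Walk.nil.copy rfl h)
      rw [Walk.length_copy, Walk.length_nil] at this
      omega
    intro i hi j hj h
    rcases le_total i j with hij | hij
    · exact aux i j hij hj h
    · exact (aux j i hij hi h.symm).symm
  · have aux : ∀ i j, i ≤ j → j ≤ w.length → G.Adj (w.getVert i) (w.getVert j) → i + 1 = j := by
      intro i j hij hj h
      have hadj : (G.within s).Adj (w.getVert i) (w.getVert j) := ⟨h, hs _, hs _⟩
      have := short i j hij hj (Walk.cons hadj Walk.nil)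
      rw [Walk.length_cons, Walk.length_nil] at this
      rcases Nat.lt_or_ge i j with hlt | hge
      · omega
      · obtain rfl : i = j := by omega
        exact absurd h (G.loopless.irrefl _)
    intro i hi j hj
    constructor
    · intro h
      rcases le_total i j with hij | hij
      · exact .inl (aux i j hij hj h)
      · exact .inr (aux j i hij hi h.symm)
    · rintro (rfl | rfl)
      · exact (w.adj_getVert_succ (by omega)).1
      · exact (w.adj_getVert_succ (by omega)).1.symm

lemma within_mono {s t : Set V} (h : s ⊆ t) : G.within s ≤ G.within t :=
  fun _ _ hab => ⟨hab.1, h hab.2.1, h hab.2.2⟩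

/-- In a chordal graph, a connected set whose outer boundary is a clique contains a vertex adjacent
to the whole boundary. -/
lemma Chordal.exists_complete_to_outerBoundary [Finite V] (hc : G.Chordal) {C : Set V}
    (hne : C.Nonempty) (hconn : ∀ a ∈ C, ∀ b ∈ C, (G.within C).Reachable a b)
    (hK : G.IsClique (G.outerBoundary C)) :
    ∃ c ∈ C, ∀ y ∈ G.outerBoundary C, G.Adj c y := by
  obtain ⟨c, hcC, hmax⟩ := Set.exists_max_image C
    (fun c => (G.outerBoundary C ∩ G.neighborSet c).ncard) (Set.toFinite C) hne
  refine ⟨c, hcC, fun y hy => ?_⟩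
  by_contra hcy
  obtain ⟨b, hb, hby⟩ := hy.2
  have hreach : (G.within (insert y C)).Reachable c y :=
    ((hconn c hcC b hb).mono (within_mono (Set.subset_insert y C))).trans
      (Adj.reachable ⟨hby, .inr hb, .inl rfl⟩)
  obtain ⟨n, p, h0, hn, hs, hinj, hp⟩ := exists_induced_path (.inr hcC) hreach
  have hn2 : 2 ≤ n := by
    by_contra! hlt
    interval_cases n
    · exact hy.1 (by rwa [← hn, h0])
    · exact hcy (by rw [← h0, ← hn, hp _ (by omega) _ (by omega)]; simp)
  have hzy : G.Adj (p (n - 1)) y := by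
    rw [← hn, hp _ (by omega) _ le_rfl]
    omega
  have hzC : p (n - 1) ∈ C := (hs (n - 1)).resolve_left hzy.ne
  refine absurd (hmax _ hzC) (not_le.2 (Set.ncard_lt_ncard ?_ (Set.toFinite _)))
  refine (Set.ssubset_iff_of_subset ?_).2 ⟨y, ⟨hy, hzy⟩, fun h => hcy h.2⟩
  rintro x ⟨hx, hcx⟩
  have hxy : x ≠ y := by
    rintro rfl
    exact hcy hcx
  refine ⟨hx, (hc.adj_penultimate hn2 hinj hp ?_ ?_ ?_).symm⟩
  · rintro i - rfl
    exact (hs i).elim hxy hx.1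
  · rw [h0]
    exact hcx.symm
  · rw [hn]
    exact hK hx hy hxy

/-- In a connected chordal graph, every family of pairwise touching connected sets is hit by a
clique. -/
lemma Chordal.exists_clique_hitting [Finite V] {ι : Type*} (hc : G.Chordal) (hG : G.Connected)
    (B : ι → Set V) (hne : ∀ i, (B i).Nonempty)
    (hB : ∀ i, ∀ C : Set V, (B i ∩ C).Nonempty → Disjoint (B i) (G.outerBoundary C) → B i ⊆ C)
    (htouch : ∀ i j, ∃ a ∈ B i, ∃ b ∈ B j, a = b ∨ G.Adj a b) :
    ∃ K : Set V, G.IsClique K ∧ ∀ i, (B i ∩ K).Nonempty := by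
  suffices h : ∀ (m : ℕ) (C : Set V), C.ncard = m → C.Nonempty →
      (∀ a ∈ C, ∀ b ∈ C, (G.within C).Reachable a b) → G.IsClique (G.outerBoundary C) →
      (∀ i, Disjoint (B i) (G.outerBoundary C) → B i ⊆ C) →
      ∃ K : Set V, G.IsClique K ∧ ∀ i, (B i ∩ K).Nonempty by
    have hle : G ≤ G.within Set.univ := fun a b hab => ⟨hab, trivial, trivial⟩
    refine h _ Set.univ rfl ⟨hG.nonempty.some, trivial⟩
      (fun a _ b _ => (hG.preconnected a b).mono hle) ?_ (fun i _ => Set.subset_univ _)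
    exact fun a ha => absurd trivial ha.1
  intro m
  induction m using Nat.strong_induction_on with
  | _ m ih =>
    rintro C rfl hCne hconn hK hin
    obtain ⟨c, hcC, hcK⟩ := hc.exists_complete_to_outerBoundary hCne hconn hK
    by_cases hhit : ∀ i, (B i ∩ insert c (G.outerBoundary C)).Nonempty
    · exact ⟨_, hK.insert fun y hy _ => hcK y hy, hhit⟩
    push Not at hhit
    obtain ⟨i, hi⟩ := hhit
    rw [← Set.disjoint_iff_inter_eq_empty] at hi
    have hiC := hin i (hi.mono_right (Set.subset_insert _ _))
    obtain ⟨s, hs⟩ := hne i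
    have hsc : s ∈ C \ {c} := ⟨hiC hs, fun h => Set.disjoint_left.1 hi hs (.inl h)⟩
    let D : Set V := {u | (G.within (C \ {c})).Reachable s u}
    have hsD : s ∈ D := Reachable.refl s
    have hDsub : D ⊆ C \ {c} := by
      intro u hu
      obtain ⟨n, p, -, hn, hp, -⟩ := exists_induced_path hsc hu
      exact hn ▸ hp n
    have hDbd : G.outerBoundary D ⊆ insert c (G.outerBoundary C) := by
      rintro y ⟨hyD, a, ha, hay⟩
      by_cases hyc : y = c
      · exact .inl hyc
      · refine .inr ⟨fun hyC => hyD ?_, a, (hDsub ha).1, hay⟩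
        exact Reachable.trans ha (Adj.reachable ⟨hay, hDsub ha, hyC, hyc⟩)
    have hiD : B i ⊆ D := hB i D ⟨s, hs, hsD⟩ (hi.mono_right hDbd)
    have hDreach : ∀ u ∈ D, (G.within D).Reachable s u := by
      intro u hu
      have hu' := (reachable_iff_reflTransGen s u).1 hu
      clear hu
      induction hu' with
      | refl => exact Reachable.refl s
      | tail hab hbd hr =>
        have hb := (reachable_iff_reflTransGen s _).2 hab
        exact hr.trans (Adj.reachable ⟨hbd.1, hb, hb.trans hbd.reachable⟩)
    refine ih D.ncard (Set.ncard_lt_ncard ?_ (Set.toFinite C)) D rfl ⟨s, hsD⟩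
      (fun a ha b hb => (hDreach a ha).symm.trans (hDreach b hb))
      ((hK.insert fun y hy _ => hcK y hy).subset hDbd) ?_
    · exact (Set.ssubset_iff_of_subset fun u hu => (hDsub hu).1).2
        ⟨c, hcC, fun h => (hDsub h).2 rfl⟩
    · intro j hj
      refine hB j D ?_ hj
      obtain ⟨a, ha, b, hb, hab⟩ := htouch j i
      refine ⟨a, ha, ?_⟩
      rcases hab with rfl | hab
      · exact hiD hb
      · by_contra haD
        exact Set.disjoint_left.1 hj ha ⟨haD, b, hiD hb, hab.symm⟩

/-- Balls in a connected graph are connected. -/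
lemma Connected.ball_subset_of_disjoint_outerBoundary (hG : G.Connected) (v : V) (r : ℕ) (C : Set V)
    (hne : ({u | G.dist v u ≤ r} ∩ C).Nonempty)
    (hdis : Disjoint {u | G.dist v u ≤ r} (G.outerBoundary C)) : {u | G.dist v u ≤ r} ⊆ C := by
  have key : ∀ u, G.dist v u ≤ r → (u ∈ C ↔ v ∈ C) := by
    intro u hu
    obtain ⟨w, hw⟩ := hG.exists_walk_length_eq_dist v u
    have hmem : ∀ i ≤ w.length, G.dist v (w.getVert i) ≤ r := by
      intro i hi
      have := dist_le (w.take i)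
      simp only [Walk.take_length] at this
      omega
    have hstep : ∀ i ≤ w.length, (w.getVert i ∈ C ↔ v ∈ C) := by
      intro i
      induction i with
      | zero => simp
      | succ i ih =>
        intro hi
        rw [← ih (by omega)]
        have hadj := w.adj_getVert_succ (show i < w.length by omega)
        constructor
        · intro h
          by_contra h'
          exact Set.disjoint_left.1 hdis (hmem i (by omega)) ⟨h', _, h, hadj.symm⟩
        · intro h
          by_contra h'
          exact Set.disjoint_left.1 hdis (hmem _ hi) ⟨h', _, h, hadj⟩
    simpa using hstep w.length le_rfl
  obtain ⟨a, ha, haC⟩ := hne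
  exact fun u hu => (key u hu).2 ((key a ha).1 haC)

/-- Balls of radius `r` around vertices at distance at most `2 * r + 1` intersect or are joined by
an edge. -/
lemma Connected.balls_touch (hG : G.Connected) {u v : V} {r : ℕ} (h : G.dist u v ≤ 2 * r + 1) :
    ∃ a ∈ {x | G.dist u x ≤ r}, ∃ b ∈ {x | G.dist v x ≤ r}, a = b ∨ G.Adj a b := by
  obtain ⟨w, hw⟩ := hG.exists_walk_length_eq_dist u v
  have hl : ∀ i, G.dist u (w.getVert i) ≤ i := by
    intro i
    have := dist_le (w.take i)
    simp only [Walk.take_length] at this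
    omega
  have hr : ∀ i, G.dist v (w.getVert i) ≤ w.length - i := by
    intro i
    have := dist_le (w.drop i)
    rwa [Walk.drop_length, dist_comm] at this
  refine ⟨w.getVert r, hl r, w.getVert (r + 1), (hr (r + 1)).trans (by omega), ?_⟩
  rcases Nat.lt_or_ge r w.length with hlt | hge
  · exact .inr (w.adj_getVert_succ hlt)
  · left
    rw [w.getVert_of_length_le hge, w.getVert_of_length_le (by omega)]

/-- In a finite connected chordal graph with all distances at most `2 * r + 1`, some vertex is
within distance `r + 1` of every vertex. -/
lemma Chordal.exists_forall_dist_le [Finite V] (hc : G.Chordal) (hG : G.Connected) {r : ℕ}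
    (h : ∀ u v, G.dist u v ≤ 2 * r + 1) : ∃ c, ∀ u, G.dist c u ≤ r + 1 := by
  obtain ⟨K, hK, hhit⟩ := hc.exists_clique_hitting hG (fun v => {u | G.dist v u ≤ r})
    (fun v => ⟨v, by simp⟩) (fun v => hG.ball_subset_of_disjoint_outerBoundary v r)
    (fun u v => hG.balls_touch (h u v))
  obtain ⟨c, -, hcK⟩ := hhit hG.nonempty.some
  refine ⟨c, fun u => ?_⟩
  obtain ⟨b, hb, hbK⟩ := hhit u
  have hcb : G.dist c b ≤ 1 := by
    by_cases hcb : c = b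
    · simp [hcb]
    · exact (dist_eq_one_iff_adj.2 (hK hcK hbK hcb)).le
  have htri := hG.dist_triangle (u := c) (v := b) (w := u)
  have hub : G.dist b u ≤ r := by
    rw [dist_comm]
    exact hb
  omega

end SimpleGraph

/-- Let `G` be a finite connected chordal simple graph (no induced cycle
of length at least 4, i.e. no induced subgraph isomorphic to `C_k` for `k ≥ 4`). Then
`2·rad(G) - 2 ≤ diam(G) ≤ 2·rad(G)`, where `rad` and `diam` are the minimum and maximum
vertex eccentricities. -/
theorem chordal_radius_diameter
    {V : Type*} [Fintype V] (G : SimpleGraph V) (hG : G.Connected)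
    (hchordal : ¬ ∃ (k : ℕ) (f : Fin k ↪ V), 4 ≤ k ∧
      ∀ i j : Fin k, G.Adj (f i) (f j) ↔ (cycleGraph k).Adj i j) :
    2 * ((sInf (Set.range fun v : V => Finset.univ.sup fun u : V => G.dist v u) : ℕ) : ℤ) - 2
        ≤ ((Finset.univ.sup fun v : V => Finset.univ.sup fun u : V => G.dist v u : ℕ) : ℤ) ∧
    ((Finset.univ.sup fun v : V => Finset.univ.sup fun u : V => G.dist v u : ℕ) : ℤ)
        ≤ 2 * ((sInf (Set.range fun v : V => Finset.univ.sup fun u : V => G.dist v u) : ℕ) : ℤ) := by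
  have hdist : ∀ u v, G.dist u v ≤
      Finset.univ.sup fun v : V => Finset.univ.sup fun u : V => G.dist v u := fun u v =>
    (Finset.le_sup (f := fun x => G.dist u x) (Finset.mem_univ v)).trans
      (Finset.le_sup (f := fun v : V => Finset.univ.sup fun u : V => G.dist v u)
        (Finset.mem_univ u))
  set D := Finset.univ.sup fun v : V => Finset.univ.sup fun u : V => G.dist v u with hD
  have := hG.nonempty
  constructor
  · have hc : G.Chordal := hchordal
    obtain ⟨c, hc⟩ := hc.exists_forall_dist_le hG (r := D / 2)
      fun u v => (hdist u v).trans (by omega)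
    have hrad : sInf (Set.range fun v : V => Finset.univ.sup fun u : V => G.dist v u) ≤
        D / 2 + 1 :=
      (Nat.sInf_le (Set.mem_range_self c)).trans (Finset.sup_le fun u _ => hc u)
    omega
  · obtain ⟨c, hc⟩ := Nat.sInf_mem
      (Set.range_nonempty fun v : V => Finset.univ.sup fun u : V => G.dist v u)
    rw [← hc]
    have hle : ∀ u, G.dist c u ≤ Finset.univ.sup fun u : V => G.dist c u :=
      fun u => Finset.le_sup (f := fun u => G.dist c u) (Finset.mem_univ u)
    have hDle : D ≤ 2 * Finset.univ.sup fun u : V => G.dist c u := by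
      refine Finset.sup_le fun v _ => Finset.sup_le fun u _ => ?_
      have htri := hG.dist_triangle (u := v) (v := c) (w := u)
      have hv := hle v
      have hu := hle u
      rw [dist_comm] at hv
      omega
    exact_mod_cast hDle
end

section
/- Let G be a finite connected simple graph of order n ≥ 3 that contains a Hamiltonian cycle. Then ρ(G) ≤ (n+1)/4 + 1/(4(n−1)) if n is even, and ρ(G) ≤ (n+1)/4 if n is odd. -/
open SimpleGraph Finset

theorem SimpleGraph.Walk.dist_getVert_le_min {V : Type*} {G : SimpleGraph V} {u v : V}
    (p : G.Walk u u) (hv : v ∈ p.support) :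
    ∃ i ≤ p.length, p.getVert i = v ∧ G.dist u v ≤ min i (p.length - i) := by
  obtain ⟨i, rfl, hi⟩ := Walk.mem_support_iff_exists_getVert.1 hv
  refine ⟨i, hi, rfl, le_min ?_ ?_⟩
  · exact (dist_le (p.take i)).trans (by simp)
  · rw [dist_comm]
    exact (dist_le (p.drop i)).trans (by simp)

/-- The sum of the distances from a vertex in the cycle of length `n` equals `⌊n² / 4⌋`. -/
theorem four_mul_sum_range_min_sub_add_mod (n : ℕ) :
    4 * ∑ i ∈ range n, min i (n - i) + n % 2 = n ^ 2 := by
  induction n using Nat.twoStepInduction with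
  | zero => simp
  | one => simp
  | more n ih _ =>
    have h : ∑ i ∈ range n, min (i + 1) (n + 2 - (i + 1)) = ∑ i ∈ range n, (min i (n - i) + 1) := by
      refine sum_congr rfl fun i hi => ?_
      have := mem_range.1 hi
      omega
    rw [sum_range_succ', sum_range_succ, h, sum_add_distrib]
    have h' : min (n + 1) (n + 2 - (n + 1)) = 1 := by omega
    simp only [h', sum_const, card_range, smul_eq_mul, mul_one, zero_le,
      Nat.min_eq_left, add_zero, Nat.add_mod_right]
    linarith

theorem SimpleGraph.Walk.IsHamiltonianCycle.sum_dist_le {V : Type*} [Fintype V] [DecidableEq V]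
    {G : SimpleGraph V} {v : V} {p : G.Walk v v} (hp : p.IsHamiltonianCycle) :
    ∑ u, G.dist v u ≤ ∑ i ∈ range (Fintype.card V), min i (Fintype.card V - i) := by
  have hlen := hp.length_eq
  have hpos : 0 < Fintype.card V := Fintype.card_pos_iff.2 ⟨v⟩
  have hexists (u : V) : ∃ i < Fintype.card V,
      p.getVert i = u ∧ G.dist v u ≤ min i (Fintype.card V - i) := by
    obtain ⟨i, hi, hiu, hd⟩ := p.dist_getVert_le_min (hp.mem_support u)
    rw [hlen] at hi hd
    obtain hi | rfl := hi.lt_or_eq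
    · exact ⟨i, hi, hiu, hd⟩
    · refine ⟨0, hpos, ?_, by simpa using hd⟩
      rw [← hiu, ← hlen, Walk.getVert_length, Walk.getVert_zero]
  choose f hf hfu hd using hexists
  have hinj : Function.Injective f := Function.LeftInverse.injective hfu
  calc ∑ u, G.dist v u ≤ ∑ u, min (f u) (Fintype.card V - f u) := sum_le_sum fun u _ => hd u
    _ = ∑ i ∈ univ.image f, min i (Fintype.card V - i) := by
      rw [sum_image hinj.injOn]
    _ ≤ _ := sum_le_sum_of_subset fun i hi => by
      obtain ⟨u, -, rfl⟩ := mem_image.1 hi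
      exact mem_range.2 (hf u)

/-- Let `G` be a finite connected simple graph of order `n ≥ 3`
containing a Hamiltonian cycle. Then the remoteness `ρ(G)` is at most
`(n+1)/4 + 1/(4(n-1))` if `n` is even, and at most `(n+1)/4` if `n` is odd. -/
theorem remoteness_le_of_hamiltonian
    {V : Type*} [Fintype V] [DecidableEq V] (G : SimpleGraph V) (hG : G.Connected)
    (n : ℕ) (hn : Fintype.card V = n) (hn3 : 3 ≤ n)
    (hham : ∃ (v : V) (p : G.Walk v v), p.IsHamiltonianCycle) :
    (⨆ v : V, (∑ u : V, (G.dist v u : ℝ)) / (n - 1)) ≤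
      if Even n then (n + 1) / 4 + 1 / (4 * ((n : ℝ) - 1)) else ((n : ℝ) + 1) / 4 := by
  obtain ⟨w, p, hp⟩ := hham
  subst hn
  have := hG.nonempty
  refine ciSup_le fun v => ?_
  have hle := (hp.rotate (hp.mem_support v)).sum_dist_le
  have hsum := four_mul_sum_range_min_sub_add_mod (Fintype.card V)
  have hpos : (0 : ℝ) < Fintype.card V - 1 := by
    have : (3 : ℝ) ≤ Fintype.card V := by exact_mod_cast hn3
    linarith
  have hdist : (4 : ℝ) * ∑ u, (G.dist v u : ℝ) + (Fintype.card V % 2 : ℕ) ≤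
      (Fintype.card V : ℝ) ^ 2 := by
    have h : 4 * ∑ u, G.dist v u + Fintype.card V % 2 ≤ Fintype.card V ^ 2 := by omega
    exact_mod_cast h
  rw [div_le_iff₀ hpos]
  split_ifs with heven
  · rw [Nat.even_iff.1 heven] at hdist
    have : (((Fintype.card V : ℝ) + 1) / 4 + 1 / (4 * ((Fintype.card V : ℝ) - 1))) *
        (Fintype.card V - 1) = (Fintype.card V : ℝ) ^ 2 / 4 := by
      field_simp
      ring
    push_cast at hdist
    linarith
  · rw [Nat.not_even_iff.1 heven] at hdist
    push_cast at hdist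
    linarith
end

section
/- Let n ≥ 3 and let G_n be the graph with vertex set {a_0, a_1, …, a_{⌊(n−1)/2⌋}} ∪ {b_1, b_2, …, b_{⌈(n−1)/2⌉}} whose edges are the path edges a_i a_{i+1} for 0 ≤ i < ⌊(n−1)/2⌋, the path edges b_j b_{j+1} for 1 ≤ j < ⌈(n−1)/2⌉, and the edges a_i b_j whenever j ∈ {i, i+1} and both vertices exist. Then the average distance of the vertex a_0 satisfies σ̄(a_0, G_n) = (n+1)/4 + 1/(4(n−1)) if n is even, and σ̄(a_0, G_n) = (n+1)/4 if n is odd. -/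
open SimpleGraph Finset

/-- The graph `G_n` of Statement 12: vertices `a_0, …, a_{⌊(n-1)/2⌋}` (encoded as
`Sum.inl i` for `i : Fin ((n-1)/2 + 1)`) and `b_1, …, b_{⌈(n-1)/2⌉}` (with `b_{k+1}`
encoded as `Sum.inr k` for `k : Fin (n/2)`, noting `⌈(n-1)/2⌉ = n/2`).
Edges: `a_i a_{i+1}`, `b_j b_{j+1}`, and `a_i b_j` whenever `j ∈ {i, i+1}`. -/
def statement12Graph (n : ℕ) : SimpleGraph (Fin ((n - 1) / 2 + 1) ⊕ Fin (n / 2)) :=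
  SimpleGraph.fromRel (fun x y =>
    match x, y with
    | Sum.inl i, Sum.inl j => (i : ℕ) + 1 = (j : ℕ)
    | Sum.inr i, Sum.inr j => (i : ℕ) + 1 = (j : ℕ)
    | Sum.inl i, Sum.inr k => (k : ℕ) = (i : ℕ) ∨ (k : ℕ) + 1 = (i : ℕ)
    | Sum.inr _, Sum.inl _ => False)

/-- A function growing by at most one along each edge grows by at most the length of a walk. -/
theorem SimpleGraph.Walk.apply_le_apply_add_length {V : Type*} {G : SimpleGraph V} (f : V → ℕ)
    (hf : ∀ x y, G.Adj x y → f y ≤ f x + 1) {u v : V} (p : G.Walk u v) :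
    f v ≤ f u + p.length := by
  induction p with
  | nil => simp
  | cons h p ih =>
    have := hf _ _ h
    rw [SimpleGraph.Walk.length_cons]
    omega

namespace statement12Graph

variable {n : ℕ}

/-- The index of a vertex in its path: `i` for `a_i` and `j` for `b_j`. -/
def index : Fin ((n - 1) / 2 + 1) ⊕ Fin (n / 2) → ℕ :=
  Sum.elim (fun i => i) (fun k => k + 1)

theorem index_le_of_adj (x y : Fin ((n - 1) / 2 + 1) ⊕ Fin (n / 2))
    (h : (statement12Graph n).Adj x y) : index y ≤ index x + 1 := by
  rcases x with i | i <;> rcases y with j | j <;>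
    simp [statement12Graph, index] at h ⊢ <;> omega

theorem exists_walk_inl (i : ℕ) (hi : i < (n - 1) / 2 + 1) :
    ∃ p : (statement12Graph n).Walk (Sum.inl 0) (Sum.inl ⟨i, hi⟩), p.length = i := by
  induction i with
  | zero => exact ⟨.nil, rfl⟩
  | succ i ih =>
    obtain ⟨p, hp⟩ := ih (by omega)
    have hadj : (statement12Graph n).Adj (Sum.inl ⟨i, by omega⟩) (Sum.inl ⟨i + 1, hi⟩) := by
      simp [statement12Graph]
    exact ⟨p.concat hadj, by simp [hp]⟩

theorem exists_walk_inr (k : ℕ) (hk : k < n / 2) :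
    ∃ p : (statement12Graph n).Walk (Sum.inl 0) (Sum.inr ⟨k, hk⟩), p.length = k + 1 := by
  obtain ⟨p, hp⟩ := exists_walk_inl (n := n) k (by omega)
  have hadj : (statement12Graph n).Adj (Sum.inl ⟨k, by omega⟩) (Sum.inr ⟨k, hk⟩) := by
    simp [statement12Graph]
  exact ⟨p.concat hadj, by simp [hp]⟩

theorem dist_eq_index (u : Fin ((n - 1) / 2 + 1) ⊕ Fin (n / 2)) :
    (statement12Graph n).dist (Sum.inl 0) u = index u := by
  obtain ⟨p, hp⟩ : ∃ p : (statement12Graph n).Walk (Sum.inl 0) u, p.length = index u := by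
    rcases u with i | k
    · exact exists_walk_inl i i.isLt
    · exact exists_walk_inr k k.isLt
  refine le_antisymm (hp ▸ SimpleGraph.dist_le p) ?_
  obtain ⟨q, hq⟩ := p.reachable.exists_walk_length_eq_dist
  simpa [hq, index] using q.apply_le_apply_add_length index index_le_of_adj

theorem sum_range_cast (m : ℕ) : ∑ i ∈ range (m + 1), (i : ℝ) = m * (m + 1) / 2 := by
  induction m with
  | zero => simp
  | succ m ih =>
    rw [sum_range_succ, ih]
    push_cast
    ring

theorem sum_dist : ∑ u, ((statement12Graph n).dist (Sum.inl 0) u : ℝ) =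
    (((n - 1) / 2 : ℕ) * (((n - 1) / 2 : ℕ) + 1) + ((n / 2 : ℕ) * ((n / 2 : ℕ) + 1)) : ℝ) / 2 := by
  have hb := sum_range_cast (n / 2)
  rw [sum_range_succ'] at hb
  simp only [dist_eq_index, index, Fintype.sum_sum_type, Sum.elim_inl, Sum.elim_inr]
  rw [Fin.sum_univ_eq_sum_range (fun i => (i : ℝ)),
    Fin.sum_univ_eq_sum_range (fun i => ((i + 1 : ℕ) : ℝ)), sum_range_cast]
  push_cast at hb ⊢
  linarith

end statement12Graph

/-- For `n ≥ 3`, the average distance of the vertex `a_0` in `G_n`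
equals `(n+1)/4 + 1/(4(n-1))` if `n` is even, and `(n+1)/4` if `n` is odd. -/
theorem avg_distance_a0_statement12Graph (n : ℕ) (hn : 3 ≤ n) :
    (∑ u, ((statement12Graph n).dist (Sum.inl (0 : Fin ((n - 1) / 2 + 1))) u : ℝ)) / (n - 1) =
      if Even n then (n + 1) / 4 + 1 / (4 * ((n : ℝ) - 1)) else ((n : ℝ) + 1) / 4 := by
  rw [statement12Graph.sum_dist]
  split_ifs with h
  · obtain ⟨q, hq⟩ := h.exists_two_nsmul
    obtain ⟨m, rfl⟩ : ∃ m, n = 2 * m + 2 := ⟨q - 1, by simp at hq; omega⟩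
    rw [show (2 * m + 2 - 1) / 2 = m by omega, show (2 * m + 2) / 2 = m + 1 by omega]
    push_cast
    rw [show (2 * m + 2 - 1 : ℝ) = 2 * m + 1 by ring]
    field_simp
    ring
  · obtain ⟨m, rfl⟩ := Nat.not_even_iff_odd.mp h
    rw [show (2 * m + 1 - 1) / 2 = m by omega, show (2 * m + 1) / 2 = m by omega]
    have hm : (m : ℝ) ≠ 0 := by
      have : m ≠ 0 := by omega
      exact_mod_cast this
    push_cast
    rw [add_sub_cancel_right]
    field_simp
    ring
end

section
/- Let G be a finite connected chordal simple graph of order n that contains a Hamiltonian cycle. Then rad(G) ≤ ⌊n/4⌋ + 1. -/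
open SimpleGraph Finset

namespace SimpleGraph

variable {V : Type*} {G : SimpleGraph V}

/-- A graph without induced cycles of length at least four. -/
def HasNoLongInducedCycle (G : SimpleGraph V) : Prop :=
  ¬ ∃ (k : ℕ) (f : Fin k ↪ V), 4 ≤ k ∧ ∀ i j : Fin k, G.Adj (f i) (f j) ↔ (cycleGraph k).Adj i j

/-- In a chordal graph, if the ends of an edge `k k'` are adjacent to the ends of a walk inside `S`,
then they have a common neighbour in `S`. -/
theorem HasNoLongInducedCycle.exists_common_adj (hG : G.HasNoLongInducedCycle) {S : Set V}
    {k k' : V} (hkk : G.Adj k k') (hk : k ∉ S) (hk' : k' ∉ S) {a b : V} (p : G.Walk a b)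
    (hp : ∀ x ∈ p.support, x ∈ S) (ha : G.Adj k' a) (hb : G.Adj k b) :
    ∃ x ∈ S, G.Adj k x ∧ G.Adj k' x := by
  induction hn : p.length using Nat.strong_induction_on generalizing a b with
  | _ n ih =>
  subst hn
  have hmem (i : ℕ) : p.getVert i ∈ S := hp _ (p.getVert_mem_support i)
  by_contra hno
  have hend (i : ℕ) (hi : i ≤ p.length) (h : G.Adj k (p.getVert i)) : i = p.length := by
    by_contra hne
    refine hno (ih (p.take i).length (by simp; omega) (p.take i) (fun x hx => hp x ?_) ha h rfl)
    exact (p.isSubwalk_take i).support_subset hx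
  have hstart (i : ℕ) (hi : i ≤ p.length) (h : G.Adj k' (p.getVert i)) : i = 0 := by
    by_contra hne
    refine hno (ih (p.drop i).length (by simp; omega) (p.drop i) (fun x hx => hp x ?_) h hb rfl)
    exact (p.isSubwalk_drop i).support_subset hx
  have hinj (i j : ℕ) (hij : i < j) (hj : j ≤ p.length) : p.getVert i ≠ p.getVert j := by
    intro h
    refine hno (ih _ ?_ ((p.take i).append ((p.drop j).copy h.symm rfl)) (fun x hx => hp x ?_)
      ha hb rfl)
    · simp; omega
    · rw [Walk.mem_support_append_iff, Walk.support_copy] at hx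
      exact hx.elim (fun hx => (p.isSubwalk_take i).support_subset hx)
        (fun hx => (p.isSubwalk_drop j).support_subset hx)
  have hchord (i j : ℕ) (hij : i + 1 < j) (hj : j ≤ p.length) :
      ¬ G.Adj (p.getVert i) (p.getVert j) := by
    intro h
    refine hno (ih _ ?_ ((p.take i).append (Walk.cons h (p.drop j))) (fun x hx => hp x ?_)
      ha hb rfl)
    · simp; omega
    · rw [Walk.mem_support_append_iff, Walk.support_cons, List.mem_cons] at hx
      rcases hx with hx | rfl | hx
      · exact (p.isSubwalk_take i).support_subset hx
      · exact p.getVert_mem_support i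
      · exact (p.isSubwalk_drop j).support_subset hx
  have hlen : p.length ≠ 0 := fun h => hno ⟨b, hp b p.end_mem_support, hb, by
    rwa [← Walk.eq_of_length_eq_zero h]⟩
  have hb' : G.Adj k (p.getVert p.length) := by simpa using hb
  have ha' : G.Adj k' (p.getVert 0) := by simpa using ha
  have hsucc (i : ℕ) (hi : i < p.length) := p.adj_getVert_succ hi
  generalize p.length = m at *
  generalize p.getVert = c at *
  set f : ℕ → V := fun i => if i ≤ m then c i else if i = m + 1 then k else k' with hf
  have hf₁ (i : ℕ) (hi : i ≤ m) : f i = c i := if_pos hi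
  have hf₂ : f (m + 1) = k := by simp [hf]
  have hf₃ : f (m + 2) = k' := by simp [hf]
  clear_value f
  have hck (i : ℕ) : c i ≠ k := fun h => hk (h ▸ hmem i)
  have hck' (i : ℕ) : c i ≠ k' := fun h => hk' (h ▸ hmem i)
  have hcases (j : ℕ) (hj : j < m + 3) : j ≤ m ∨ j = m + 1 ∨ j = m + 2 := by omega
  have hlt_ne (i j : ℕ) (hij : i < j) (hj : j < m + 3) : f i ≠ f j := by
    rcases hcases j hj with hj | rfl | rfl
    · rw [hf₁ i (by omega), hf₁ j hj]; exact hinj i j hij hj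
    · rw [hf₁ i (by omega), hf₂]; exact hck i
    · rcases hcases i (by omega) with hi | rfl | rfl
      · rw [hf₁ i hi, hf₃]; exact hck' i
      · rw [hf₂, hf₃]; exact hkk.ne
      · omega
  have hlt_adj (i j : ℕ) (hij : i < j) (hj : j < m + 3) :
      G.Adj (f i) (f j) ↔ j = i + 1 ∨ (i = 0 ∧ j = m + 2) := by
    rcases hcases j hj with hj | rfl | rfl
    · rw [hf₁ i (by omega), hf₁ j hj]
      constructor
      · intro h
        by_contra hne
        exact hchord i j (by omega) hj h
      · rintro (rfl | h)
        · exact hsucc i (by omega)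
        · omega
    · rw [hf₁ i (by omega), hf₂, G.adj_comm]
      constructor
      · intro h
        have := hend i (by omega) h
        omega
      · intro h
        obtain rfl : i = m := by omega
        exact hb'
    · rcases hcases i (by omega) with hi | rfl | rfl
      · rw [hf₁ i hi, hf₃, G.adj_comm]
        constructor
        · intro h
          exact Or.inr ⟨hstart i hi h, rfl⟩
        · intro h
          obtain rfl : i = 0 := by omega
          exact ha'
      · simpa [hf₂, hf₃] using hkk
      · omega
  refine hG ⟨m + 3, ⟨fun i => f i, fun i j hij => ?_⟩, by omega, fun i j => ?_⟩
  · rcases lt_trichotomy i.val j.val with h | h | h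
    · exact absurd hij (hlt_ne _ _ h j.isLt)
    · exact Fin.ext h
    · exact absurd hij.symm (hlt_ne _ _ h i.isLt)
  · have hsub (i j : Fin (m + 3)) (h : i.val < j.val) :
        G.Adj (f i) (f j) ↔ (cycleGraph (m + 3)).Adj i j := by
      rw [hlt_adj _ _ h j.isLt, cycleGraph_adj', Fin.coe_sub_iff_lt.mpr h,
        Fin.coe_sub_iff_le.mpr (show i ≤ j from h.le)]
      have := j.isLt
      omega
    rcases lt_trichotomy i.val j.val with h | h | h
    · exact hsub i j h
    · obtain rfl := Fin.ext h
      simp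
    · rw [G.adj_comm, (cycleGraph _).adj_comm]
      exact hsub j i h

/-- In a chordal graph, a clique whose members all have neighbours in a connected set `C` disjoint
from it has a common neighbour in `C`. -/
theorem HasNoLongInducedCycle.exists_adj_clique [Finite V] (hG : G.HasNoLongInducedCycle)
    {K C : Set V} (hK : G.IsClique K) (hKC : Disjoint K C) (hne : C.Nonempty)
    (hC : ∀ a ∈ C, ∀ b ∈ C, ∃ p : G.Walk a b, ∀ x ∈ p.support, x ∈ C)
    (hadj : ∀ k ∈ K, ∃ c ∈ C, G.Adj k c) : ∃ c ∈ C, ∀ k ∈ K, G.Adj k c := by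
  classical
  obtain ⟨c, hc, hmax⟩ := Set.exists_max_image C (fun c => {k ∈ K | G.Adj k c}.ncard)
    C.toFinite hne
  refine ⟨c, hc, ?_⟩
  by_contra! ⟨k, hk, hkc⟩
  obtain ⟨d, hd, hkd⟩ := hadj k hk
  obtain ⟨p, hp⟩ := hC c hc d hd
  have hex : ∃ i, G.Adj k (p.getVert i) := ⟨p.length, by simpa using hkd⟩
  have hm : G.Adj k (p.getVert (Nat.find hex)) := Nat.find_spec hex
  have hmC : p.getVert (Nat.find hex) ∈ C := hp _ (p.getVert_mem_support _)
  refine (hmax _ hmC).not_gt (Set.ncard_lt_ncard ⟨?_, fun h => hkc (h ⟨hk, hm⟩).2⟩)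
  rintro k' ⟨hk', hk'c⟩
  have hkk : G.Adj k k' := hK hk hk' (by rintro rfl; exact hkc hk'c)
  have hsub (x) (hx : x ∈ (p.take (Nat.find hex)).support) : x ∈ C :=
    hp x ((p.isSubwalk_take _).support_subset hx)
  obtain ⟨x, hx, hkx, hxk⟩ := hG.exists_common_adj
    (S := {x | x ∈ (p.take (Nat.find hex)).support}) hkk
    (fun h => hKC.notMem_of_mem_left hk (hsub _ h))
    (fun h => hKC.notMem_of_mem_left hk' (hsub _ h)) _ (fun _ h => h) hk'c hm
  obtain ⟨j, rfl, hj⟩ := Walk.mem_support_iff_exists_getVert.mp hx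
  rw [Walk.take_getVert] at hkx hxk
  have hle := Nat.find_min' hex hkx
  rw [min_eq_left (le_trans hle (min_le_right _ _))] at hxk
  exact ⟨hk', hxk⟩

/-- The vertices that can be reached from `x` while avoiding `K`. -/
def avoidingComponent (G : SimpleGraph V) (K : Set V) (x : V) : Set V :=
  {y | ∃ p : G.Walk x y, ∀ z ∈ p.support, z ∉ K}

theorem mem_avoidingComponent_self {K : Set V} {x : V} (hx : x ∉ K) :
    x ∈ G.avoidingComponent K x := ⟨.nil, by simpa using hx⟩

theorem notMem_of_mem_avoidingComponent {K : Set V} {x y : V}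
    (hy : y ∈ G.avoidingComponent K x) : y ∉ K :=
  let ⟨p, hp⟩ := hy
  hp y p.end_mem_support

theorem mem_avoidingComponent_of_adj {K : Set V} {x y z : V}
    (hy : y ∈ G.avoidingComponent K x) (hyz : G.Adj y z) (hz : z ∉ K) :
    z ∈ G.avoidingComponent K x := by
  obtain ⟨p, hp⟩ := hy
  refine ⟨p.concat hyz, fun w hw => ?_⟩
  rw [Walk.support_concat, List.mem_append, List.mem_singleton] at hw
  rcases hw with hw | rfl
  exacts [hp w hw, hz]

theorem mem_avoidingComponent_of_mem_support {K : Set V} {x y z : V} {p : G.Walk x y}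
    (hp : ∀ z ∈ p.support, z ∉ K) (hz : z ∈ p.support) : z ∈ G.avoidingComponent K x := by
  classical
  exact ⟨p.takeUntil z hz, fun w hw => hp w (p.support_takeUntil_subset_support hz hw)⟩

theorem exists_walk_avoidingComponent {K : Set V} {x a b : V}
    (ha : a ∈ G.avoidingComponent K x) (hb : b ∈ G.avoidingComponent K x) :
    ∃ p : G.Walk a b, ∀ z ∈ p.support, z ∈ G.avoidingComponent K x := by
  obtain ⟨p, hp⟩ := ha
  obtain ⟨q, hq⟩ := hb
  refine ⟨p.reverse.append q, fun z hz => ?_⟩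
  rw [Walk.mem_support_append_iff, Walk.support_reverse, List.mem_reverse] at hz
  exact hz.elim (mem_avoidingComponent_of_mem_support hp)
    (mem_avoidingComponent_of_mem_support hq)

/-- A walk that starts in a set and avoids the outer boundary of that set stays in it. -/
theorem Walk.end_mem_of_forall_adj {C : Set V} {a b : V} (p : G.Walk a b) (ha : a ∈ C)
    (h : ∀ y ∈ C, ∀ z ∈ p.support, G.Adj y z → z ∈ C) : b ∈ C := by
  induction p with
  | nil => exact ha
  | cons hadj p ih =>
    exact ih (h _ ha _ (by simp) hadj) fun y hy z hz => h y hy z (by simp [hz])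

theorem Connected.exists_walk_of_dist_le (hG : G.Connected) {r : ℕ} {x y : V}
    (h : G.dist x y ≤ r) : ∃ p : G.Walk x y, ∀ z ∈ p.support, G.dist x z ≤ r := by
  classical
  obtain ⟨p, hp⟩ := hG.exists_walk_length_eq_dist x y
  exact ⟨p, fun z hz => (dist_le (p.takeUntil z hz)).trans
    ((p.length_takeUntil_le_length hz).trans (hp.trans_le h))⟩

/-- Two balls of radius `r` with centres at distance at most `2 * r + 1` meet or are joined by an
edge. -/
theorem Connected.exists_eq_or_adj_of_dist_le (hG : G.Connected) {r : ℕ} {x y : V}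
    (h : G.dist x y ≤ 2 * r + 1) :
    ∃ a b, G.dist x a ≤ r ∧ G.dist y b ≤ r ∧ (a = b ∨ G.Adj a b) := by
  obtain ⟨p, hp⟩ := hG.exists_walk_length_eq_dist x y
  rcases le_or_gt p.length r with hr | hr
  · exact ⟨y, y, hp ▸ hr, by simp, Or.inl rfl⟩
  · refine ⟨p.getVert r, p.getVert (r + 1), ?_, ?_, Or.inr (p.adj_getVert_succ hr)⟩
    · exact (dist_le (p.take r)).trans (by simp)
    · rw [dist_comm]
      exact (dist_le (p.drop (r + 1))).trans (by simp; omega)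

/-- In a chordal graph of diameter at most `2 * r + 1`, some clique meets all balls of
radius `r`. -/
theorem HasNoLongInducedCycle.exists_clique_dist_le [Finite V] (hch : G.HasNoLongInducedCycle)
    (hG : G.Connected) {r : ℕ} (hr : ∀ x y, G.dist x y ≤ 2 * r + 1) :
    ∃ K : Set V, G.IsClique K ∧ ∀ x, ∃ y ∈ K, G.dist x y ≤ r := by
  by_contra! hno
  let P : Set (Set V × V) := {q | G.IsClique q.1 ∧ ∀ y, G.dist q.2 y ≤ r → y ∉ q.1}
  have hP (K : Set V) (hK : G.IsClique K) : ∃ x, (K, x) ∈ P := by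
    obtain ⟨x, hx⟩ := hno K hK
    exact ⟨x, hK, fun y hy hyK => (hx y hyK).not_ge hy⟩
  obtain ⟨x₀, hx₀⟩ := hP ∅ (by simp)
  obtain ⟨⟨K, x⟩, ⟨hK, hx⟩, hmin⟩ := Set.exists_min_image P
    (fun q => (G.avoidingComponent q.1 q.2).ncard) P.toFinite ⟨_, hx₀⟩
  dsimp only at hK hx hmin
  have hball {L : Set V} {z : V} (hz : ∀ y, G.dist z y ≤ r → y ∉ L) {y : V}
      (hy : G.dist z y ≤ r) : y ∈ G.avoidingComponent L z := by
    obtain ⟨p, hp⟩ := hG.exists_walk_of_dist_le hy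
    exact ⟨p, fun w hw => hz w (hp w hw)⟩
  set C := G.avoidingComponent K x with hC
  have hxC : x ∈ C := hball hx (by simp)
  let K' : Set V := {k ∈ K | ∃ c ∈ C, G.Adj k c}
  have hK' : G.IsClique K' := hK.subset (Set.sep_subset _ _)
  obtain ⟨c, hcC, hc⟩ := hch.exists_adj_clique hK'
    (Set.disjoint_left.mpr fun k hk hkC => notMem_of_mem_avoidingComponent hkC hk.1) ⟨x, hxC⟩
    (fun a ha b hb => exists_walk_avoidingComponent ha hb) (fun k hk => hk.2)
  have hL : G.IsClique (insert c K') := hK'.insert fun k hk _ => (hc k hk).symm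
  obtain ⟨z, hz⟩ := hP _ hL
  have hclosed (y) (hy : y ∈ C) (w) (hw : w ∉ insert c K') (hyw : G.Adj y w) : w ∈ C :=
    mem_avoidingComponent_of_adj hy hyw fun hwK =>
      hw (Set.mem_insert_of_mem _ ⟨hwK, y, hy, hyw.symm⟩)
  obtain ⟨a, b, ha, hb, hab⟩ := hG.exists_eq_or_adj_of_dist_le (hr x z)
  have haC : a ∈ C := hball hx ha
  have hbC : b ∈ C := by
    rcases hab with rfl | hab
    exacts [haC, hclosed a haC b (hz.2 b hb) hab]
  refine (hmin _ hz).not_gt (Set.ncard_lt_ncard ⟨fun v hv => ?_, fun h => ?_⟩)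
  · obtain ⟨p, hp⟩ := exists_walk_avoidingComponent (hball hz.2 hb) hv
    exact p.end_mem_of_forall_adj hbC fun y hy w hw =>
      hclosed y hy w (notMem_of_mem_avoidingComponent (hp w hw))
  · exact notMem_of_mem_avoidingComponent (h hcC) (Set.mem_insert _ _)

/-- Distances in a Hamiltonian graph are at most half its order. -/
theorem Walk.IsHamiltonianCycle.two_mul_dist_le [Fintype V] [DecidableEq V] {v : V}
    {p : G.Walk v v} (hp : p.IsHamiltonianCycle) (x y : V) :
    2 * G.dist x y ≤ Fintype.card V := by
  let q := p.rotate x (hp.mem_support x)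
  have hlen : q.length = Fintype.card V := (p.length_rotate _ _).trans hp.length_eq
  have hy : y ∈ q.support := (p.mem_support_rotate_iff _ _).mpr (hp.mem_support y)
  have h₁ := dist_le (q.takeUntil y hy)
  have h₂ := dist_le (q.dropUntil y hy)
  have h₃ := congrArg Walk.length (q.take_spec hy)
  rw [Walk.length_append] at h₃
  rw [dist_comm] at h₂
  omega

end SimpleGraph

/-- Let `G` be a finite connected chordal simple graph of order `n`
(chordal: no induced subgraph isomorphic to `C_k` for `k ≥ 4`) containing a Hamiltonian
cycle. Then `rad(G) ≤ ⌊n/4⌋ + 1`. -/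
theorem radius_le_of_chordal_hamiltonian
    {V : Type*} [Fintype V] [DecidableEq V] (G : SimpleGraph V) (hG : G.Connected)
    (n : ℕ) (hn : Fintype.card V = n)
    (hchordal : ¬ ∃ (k : ℕ) (f : Fin k ↪ V), 4 ≤ k ∧
      ∀ i j : Fin k, G.Adj (f i) (f j) ↔ (cycleGraph k).Adj i j)
    (hham : ∃ (v : V) (p : G.Walk v v), p.IsHamiltonianCycle) :
    sInf (Set.range fun v : V => Finset.univ.sup fun u : V => G.dist v u) ≤ n / 4 + 1 := by
  obtain ⟨v, p, hp⟩ := hham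
  obtain ⟨K, hK, hdist⟩ := HasNoLongInducedCycle.exists_clique_dist_le hchordal hG (r := n / 4)
    fun x y => by have := hp.two_mul_dist_le x y; omega
  obtain ⟨w, hw, -⟩ := hdist v
  refine (Nat.sInf_le (Set.mem_range_self w)).trans (Finset.sup_le fun u _ => ?_)
  obtain ⟨y, hy, hyu⟩ := hdist u
  have hwy : G.dist w y ≤ 1 := by
    rcases eq_or_ne w y with rfl | hne
    · simp
    · exact (dist_eq_one_iff_adj.mpr (hK hw hy hne)).le
  have := hG.dist_triangle (u := w) (v := y) (w := u)
  rw [G.dist_comm (u := y) (v := u)] at this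
  omega
end

section
/- Let n ≥ 4 be even and let G_n be the graph with vertex set {a_1, …, a_{n/2}} ∪ {b_1, …, b_{n/2}} whose edges are a_i a_{i+1} and b_i b_{i+1} for 1 ≤ i < n/2, together with the rungs a_i b_i for 1 ≤ i ≤ n/2. For odd n ≥ 5, let G_n be obtained from G_{n−1} by adding one new vertex adjacent to a_1 and b_1. Then for every n ≥ 4, rad(G_n) = ⌊n/4⌋ + 1. -/
open SimpleGraph Finset

/-- The graph `G_n` of Statement 14. For even `n` it is the ladder with rails
`a_1, …, a_{n/2}` (encoded `Sum.inl (Sum.inl i)`, `0`-based) and `b_1, …, b_{n/2}`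
(encoded `Sum.inl (Sum.inr i)`), with edges `a_i a_{i+1}`, `b_i b_{i+1}` and rungs
`a_i b_i`. For odd `n` there is one extra vertex (the unique element of `Fin (n % 2)`,
encoded `Sum.inr`), adjacent to `a_1` and `b_1`. -/
def statement14Graph (n : ℕ) :
    SimpleGraph ((Fin (n / 2) ⊕ Fin (n / 2)) ⊕ Fin (n % 2)) :=
  SimpleGraph.fromRel (fun x y =>
    match x, y with
    | Sum.inl (Sum.inl i), Sum.inl (Sum.inl j) => (i : ℕ) + 1 = (j : ℕ)
    | Sum.inl (Sum.inr i), Sum.inl (Sum.inr j) => (i : ℕ) + 1 = (j : ℕ)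
    | Sum.inl (Sum.inl i), Sum.inl (Sum.inr j) => (i : ℕ) = (j : ℕ)
    | Sum.inl (Sum.inl i), Sum.inr _ => (i : ℕ) = 0
    | Sum.inl (Sum.inr i), Sum.inr _ => (i : ℕ) = 0
    | _, _ => False)

namespace SimpleGraph

variable {V : Type*} {G : SimpleGraph V}

theorem Walk.le_add_length_of_lipschitz {h : V → ℕ} (hh : ∀ u w, G.Adj u w → h w ≤ h u + 1)
    {u v : V} (p : G.Walk u v) : h v ≤ h u + p.length := by
  induction p with
  | nil => simp
  | cons hadj p ih =>
    have := hh _ _ hadj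
    rw [Walk.length_cons]
    omega

theorem Connected.le_add_dist_of_lipschitz (hG : G.Connected) {h : V → ℕ}
    (hh : ∀ u w, G.Adj u w → h w ≤ h u + 1) (u v : V) : h v ≤ h u + G.dist u v := by
  obtain ⟨p, hp⟩ := hG.exists_walk_length_eq_dist u v
  exact hp ▸ p.le_add_length_of_lipschitz hh

theorem exists_walk_length_eq_of_descent {g : V → ℕ} {v : V} (h0 : ∀ u, g u = 0 → u = v)
    (hs : ∀ u, g u ≠ 0 → ∃ w, G.Adj w u ∧ g w + 1 = g u) (u : V) :
    ∃ p : G.Walk v u, p.length = g u := by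
  induction hk : g u generalizing u with
  | zero =>
    obtain rfl := h0 u hk
    exact ⟨Walk.nil, rfl⟩
  | succ k ih =>
    obtain ⟨w, hadj, hw⟩ := hs u (by omega)
    obtain ⟨p, hp⟩ := ih w (by omega)
    exact ⟨p.concat hadj, by rw [Walk.length_concat, hp]⟩

end SimpleGraph

section Ladder

variable {n : ℕ}

/-- The distance in `statement14Graph n` from the vertex of the first rail in column `c`. -/
def distFromFirstRail (c : ℕ) : (Fin (n / 2) ⊕ Fin (n / 2)) ⊕ Fin (n % 2) → ℕ
  | Sum.inl (Sum.inl j) => (j - c) + (c - j)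
  | Sum.inl (Sum.inr j) => (j - c) + (c - j) + 1
  | Sum.inr _ => c + 1

/-- The distance in `statement14Graph n` from the vertex of the second rail in column `c`. -/
def distFromSecondRail (c : ℕ) : (Fin (n / 2) ⊕ Fin (n / 2)) ⊕ Fin (n % 2) → ℕ
  | Sum.inl (Sum.inl j) => (j - c) + (c - j) + 1
  | Sum.inl (Sum.inr j) => (j - c) + (c - j)
  | Sum.inr _ => c + 1

/-- The distance in `statement14Graph n` from the extra vertex. -/
def distFromApex : (Fin (n / 2) ⊕ Fin (n / 2)) ⊕ Fin (n % 2) → ℕ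
  | Sum.inl (Sum.inl j) => j + 1
  | Sum.inl (Sum.inr j) => j + 1
  | Sum.inr _ => 0

theorem distFromFirstRail_lipschitz (c : ℕ) (u w : (Fin (n / 2) ⊕ Fin (n / 2)) ⊕ Fin (n % 2))
    (h : (statement14Graph n).Adj u w) : distFromFirstRail c w ≤ distFromFirstRail c u + 1 := by
  rcases u with (u | u) | u <;> rcases w with (w | w) | w <;>
    simp [statement14Graph, SimpleGraph.fromRel_adj, distFromFirstRail] at h ⊢ <;> omega

theorem distFromSecondRail_lipschitz (c : ℕ) (u w : (Fin (n / 2) ⊕ Fin (n / 2)) ⊕ Fin (n % 2))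
    (h : (statement14Graph n).Adj u w) : distFromSecondRail c w ≤ distFromSecondRail c u + 1 := by
  rcases u with (u | u) | u <;> rcases w with (w | w) | w <;>
    simp [statement14Graph, SimpleGraph.fromRel_adj, distFromSecondRail] at h ⊢ <;> omega

theorem distFromApex_lipschitz (u w : (Fin (n / 2) ⊕ Fin (n / 2)) ⊕ Fin (n % 2))
    (h : (statement14Graph n).Adj u w) : distFromApex w ≤ distFromApex u + 1 := by
  rcases u with (u | u) | u <;> rcases w with (w | w) | w <;>
    simp [statement14Graph, SimpleGraph.fromRel_adj, distFromApex] at h ⊢ <;> omega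

theorem exists_walk_length_eq_distFromFirstRail (c : Fin (n / 2))
    (u : (Fin (n / 2) ⊕ Fin (n / 2)) ⊕ Fin (n % 2)) :
    ∃ p : (statement14Graph n).Walk (Sum.inl (Sum.inl c)) u,
      p.length = distFromFirstRail c u := by
  have hc := c.isLt
  refine SimpleGraph.exists_walk_length_eq_of_descent ?_ ?_ u
  · rintro ((u | u) | u) h <;> simp [distFromFirstRail, Fin.ext_iff] at h ⊢
    omega
  · rintro ((u | u) | u) h
    · have hu := u.isLt
      simp only [distFromFirstRail] at h
      rcases lt_or_gt_of_ne (show (u : ℕ) ≠ c by omega) with hlt | hgt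
      · refine ⟨Sum.inl (Sum.inl ⟨u + 1, by omega⟩), ?_, ?_⟩
        · simp [statement14Graph, SimpleGraph.fromRel_adj, Fin.ext_iff]
        · simp only [distFromFirstRail]
          omega
      · refine ⟨Sum.inl (Sum.inl ⟨u - 1, by omega⟩), ?_, ?_⟩
        · simp [statement14Graph, SimpleGraph.fromRel_adj, Fin.ext_iff]
          omega
        · simp only [distFromFirstRail]
          omega
    · exact ⟨Sum.inl (Sum.inl u), by simp [statement14Graph, SimpleGraph.fromRel_adj], rfl⟩
    · refine ⟨Sum.inl (Sum.inl ⟨0, by omega⟩), ?_, ?_⟩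
      · simp [statement14Graph, SimpleGraph.fromRel_adj]
      · simp [distFromFirstRail]

theorem statement14Graph_connected (hn : 2 ≤ n) : (statement14Graph n).Connected :=
  SimpleGraph.connected_iff_exists_forall_reachable _ |>.2
    ⟨Sum.inl (Sum.inl ⟨0, by omega⟩), fun u =>
      (exists_walk_length_eq_distFromFirstRail _ u).elim fun p _ => p.reachable⟩

theorem exists_le_dist_statement14Graph (hn : 4 ≤ n)
    (v : (Fin (n / 2) ⊕ Fin (n / 2)) ⊕ Fin (n % 2)) :
    ∃ u, n / 4 + 1 ≤ (statement14Graph n).dist v u := by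
  have hG := statement14Graph_connected (n := n) (by omega)
  let first : Fin (n / 2) := ⟨0, by omega⟩
  let last : Fin (n / 2) := ⟨n / 2 - 1, by omega⟩
  rcases v with (c | c) | x
  · have hl := hG.le_add_dist_of_lipschitz (distFromFirstRail_lipschitz c) (Sum.inl (Sum.inl c))
    have h0 := hl (Sum.inl (Sum.inr first))
    have h1 := hl (Sum.inl (Sum.inr last))
    simp only [distFromFirstRail, first, last] at h0 h1
    by_cases hc : n / 4 ≤ c
    · exact ⟨Sum.inl (Sum.inr first), by simp only [first]; omega⟩
    · exact ⟨Sum.inl (Sum.inr last), by simp only [last]; omega⟩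
  · have hl := hG.le_add_dist_of_lipschitz (distFromSecondRail_lipschitz c) (Sum.inl (Sum.inr c))
    have h0 := hl (Sum.inl (Sum.inl first))
    have h1 := hl (Sum.inl (Sum.inl last))
    simp only [distFromSecondRail, first, last] at h0 h1
    by_cases hc : n / 4 ≤ c
    · exact ⟨Sum.inl (Sum.inl first), by simp only [first]; omega⟩
    · exact ⟨Sum.inl (Sum.inl last), by simp only [last]; omega⟩
  · have h1 := hG.le_add_dist_of_lipschitz distFromApex_lipschitz (Sum.inr x)
      (Sum.inl (Sum.inl last))
    simp only [distFromApex, last] at h1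
    exact ⟨Sum.inl (Sum.inl last), by simp only [last]; omega⟩

theorem dist_center_statement14Graph_le (hn : 4 ≤ n)
    (u : (Fin (n / 2) ⊕ Fin (n / 2)) ⊕ Fin (n % 2)) :
    (statement14Graph n).dist (Sum.inl (Sum.inl ⟨(n / 2 - 1) / 2, by omega⟩)) u ≤ n / 4 + 1 := by
  obtain ⟨p, hp⟩ := exists_walk_length_eq_distFromFirstRail
    (⟨(n / 2 - 1) / 2, by omega⟩ : Fin (n / 2)) u
  refine (SimpleGraph.dist_le p).trans (hp.trans_le ?_)
  rcases u with (u | u) | u <;> simp only [distFromFirstRail] <;> omega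

end Ladder

/-- For every `n ≥ 4`, the radius of `G_n` equals `⌊n/4⌋ + 1`. -/
theorem radius_statement14Graph (n : ℕ) (hn : 4 ≤ n) :
    sInf (Set.range fun v => Finset.univ.sup fun u => (statement14Graph n).dist v u) =
      n / 4 + 1 := by
  apply le_antisymm
  · exact (Nat.sInf_le (Set.mem_range_self (Sum.inl (Sum.inl _)))).trans
      (Finset.sup_le fun u _ => dist_center_statement14Graph_le hn u)
  · refine le_csInf ⟨_, Set.mem_range_self (Sum.inl (Sum.inl ⟨0, by omega⟩))⟩ ?_
    rintro _ ⟨v, rfl⟩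
    obtain ⟨u, hu⟩ := exists_le_dist_statement14Graph hn v
    exact hu.trans (Finset.le_sup (f := fun u => (statement14Graph n).dist v u)
      (Finset.mem_univ u))
end

section
/- Let q ≥ 4 be an even integer and let n ≥ q with n − q divisible by 4. Let H_{n,q} be the graph with vertex set {a_0, a_1, …, a_{n/2−1}} ∪ {b_0, b_1, …, b_{n/2−1}} whose edges are the path edges a_i a_{i+1} and b_i b_{i+1} for 0 ≤ i < n/2 − 1, together with the edges a_i b_i for all i ∈ {0, 1, …, (n−q)/4} ∪ {(n+q)/4 − 1, (n+q)/4, …, n/2 − 1}. Then π(H_{n,q}) = (n+5)/8 + (q² − 4q + 5)/(8(n−1)). -/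
open SimpleGraph Finset

/-- The graph `H_{n,q}` of Statement 15: two paths `a_0, …, a_{n/2-1}` (encoded
`Sum.inl i`) and `b_0, …, b_{n/2-1}` (encoded `Sum.inr i`), together with the rungs
`a_i b_i` for all `i ∈ {0, …, (n-q)/4} ∪ {(n+q)/4 - 1, …, n/2 - 1}`. -/
def statement15Graph (n q : ℕ) : SimpleGraph (Fin (n / 2) ⊕ Fin (n / 2)) :=
  SimpleGraph.fromRel (fun x y =>
    match x, y with
    | Sum.inl i, Sum.inl j => (i : ℕ) + 1 = (j : ℕ)
    | Sum.inr i, Sum.inr j => (i : ℕ) + 1 = (j : ℕ)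
    | Sum.inl i, Sum.inr j => (i : ℕ) = (j : ℕ) ∧
        ((i : ℕ) ≤ (n - q) / 4 ∨ (n + q) / 4 - 1 ≤ (i : ℕ))
    | Sum.inr _, Sum.inl _ => False)

/-- A function vanishing at `v` that grows by at most one along each edge is a lower bound
for the distance from `v`. -/
theorem SimpleGraph.le_dist_of_adj_le {V : Type*} {G : SimpleGraph V} {v u : V} (f : V → ℕ)
    (hv : f v = 0) (hf : ∀ x y, G.Adj x y → f y ≤ f x + 1) (hr : G.Reachable v u) :
    f u ≤ G.dist v u := by
  have key : ∀ {x y : V} (w : G.Walk x y), f y ≤ f x + w.length := by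
    intro x y w
    induction w with
    | nil => simp
    | cons h w ih =>
      have := hf _ _ h
      rw [Walk.length_cons]
      omega
  obtain ⟨w, hw⟩ := hr.exists_walk_length_eq_dist
  have := key w
  omega

/-- If every vertex other than `v` has a neighbour on which `f` is smaller by one, then `f u`
bounds the length of some walk from `v` to `u`. -/
theorem SimpleGraph.exists_walk_length_eq_of_descent_s15 {V : Type*} {G : SimpleGraph V} {v : V}
    (f : V → ℕ) (hv : ∀ u, f u = 0 → u = v)
    (hf : ∀ u, f u ≠ 0 → ∃ w, G.Adj w u ∧ f w + 1 = f u) (u : V) :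
    ∃ w : G.Walk v u, w.length = f u := by
  induction h : f u generalizing u with
  | zero =>
    obtain rfl := hv u h
    exact ⟨Walk.nil, rfl⟩
  | succ t ih =>
    obtain ⟨x, hx, hfx⟩ := hf u (by omega)
    obtain ⟨w, hw⟩ := ih x (by omega)
    exact ⟨w.concat hx, by rw [Walk.length_concat, hw]⟩

section statement15Graph

variable {n q : ℕ}

@[simp]
theorem statement15Graph_adj_inl_inl (i j : Fin (n / 2)) :
    (statement15Graph n q).Adj (Sum.inl i) (Sum.inl j) ↔
      (i : ℕ) + 1 = j ∨ (j : ℕ) + 1 = i := by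
  simp only [statement15Graph, fromRel_adj, ne_eq, Sum.inl.injEq, Fin.ext_iff]
  omega

@[simp]
theorem statement15Graph_adj_inr_inr (i j : Fin (n / 2)) :
    (statement15Graph n q).Adj (Sum.inr i) (Sum.inr j) ↔
      (i : ℕ) + 1 = j ∨ (j : ℕ) + 1 = i := by
  simp only [statement15Graph, fromRel_adj, ne_eq, Sum.inr.injEq, Fin.ext_iff]
  omega

@[simp]
theorem statement15Graph_adj_inl_inr (i j : Fin (n / 2)) :
    (statement15Graph n q).Adj (Sum.inl i) (Sum.inr j) ↔
      (i : ℕ) = j ∧ ((i : ℕ) ≤ (n - q) / 4 ∨ (n + q) / 4 - 1 ≤ (i : ℕ)) := by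
  simp [statement15Graph]

@[simp]
theorem statement15Graph_adj_inr_inl (i j : Fin (n / 2)) :
    (statement15Graph n q).Adj (Sum.inr i) (Sum.inl j) ↔
      (j : ℕ) = i ∧ ((j : ℕ) ≤ (n - q) / 4 ∨ (n + q) / 4 - 1 ≤ (j : ℕ)) := by
  rw [adj_comm, statement15Graph_adj_inl_inr]

theorem statement15Graph_adj_swap (x y : Fin (n / 2) ⊕ Fin (n / 2)) :
    (statement15Graph n q).Adj x.swap y.swap ↔ (statement15Graph n q).Adj x y := by
  rcases x with i | i <;> rcases y with j | j <;> simp <;> omega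

end statement15Graph

/-- The distance from `a_i` in `H_{n,q}`, where `n = 4 * p + 2 * k` and `q = 2 * k`. -/
def ladderDist (p k i : ℕ) {m : ℕ} : Fin m ⊕ Fin m → ℕ
  | Sum.inl j => (i - j) + (j - i)
  | Sum.inr j =>
    if i ≤ p ∨ p + k - 1 ≤ i then (i - j) + (j - i) + 1
    else min (i - p + ((j - p) + (p - j)))
      (p + k - 1 - i + ((j - (p + k - 1)) + (p + k - 1 - j))) + 1

/-- A lower bound, attained for `p ≤ i < p + k`, for the sum of the distances from `a_i` to `a_j`
and to the mirror image of `b_j`. -/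
def pairDist (p k j : ℕ) : ℕ :=
  max k (max (2 * p + k - 2 * j) (2 * j + 2 - (2 * p + k)))

theorem sum_pairDist (p k : ℕ) :
    ∑ j ∈ range (2 * p + k), pairDist p k j = 2 * p ^ 2 + 2 * p * k + k ^ 2 + 2 * p := by
  induction p with
  | zero =>
    rw [sum_congr rfl (g := fun _ => k)]
    · simp [sq]
    · intro j hj
      rw [mem_range] at hj
      simp only [pairDist]
      omega
  | succ p ih =>
    have h : 2 * (p + 1) + k = (2 * p + k + 1) + 1 := by ring
    rw [h, sum_range_succ, sum_range_succ', sum_congr rfl (g := pairDist p k), ih]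
    · have h0 : pairDist (p + 1) k 0 = 2 * p + k + 2 := by simp only [pairDist]; omega
      have h1 : pairDist (p + 1) k (2 * p + k + 1) = 2 * p + k + 2 := by
        simp only [pairDist]; omega
      rw [h0, h1]
      ring
    · intro j _
      simp only [pairDist]
      omega

section Distances

variable {n q p k : ℕ}

theorem ladderDist_le_of_adj (hk : 2 ≤ k) (hn : n = 4 * p + 2 * k) (hq : q = 2 * k) (i : ℕ)
    (x y : Fin (n / 2) ⊕ Fin (n / 2)) (h : (statement15Graph n q).Adj x y) :
    ladderDist p k i y ≤ ladderDist p k i x + 1 := by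
  have hL : (n - q) / 4 = p := by omega
  have hR : (n + q) / 4 - 1 = p + k - 1 := by omega
  rcases x with a | a <;> rcases y with b | b <;>
    simp only [statement15Graph_adj_inl_inl, statement15Graph_adj_inl_inr,
      statement15Graph_adj_inr_inl, statement15Graph_adj_inr_inr, hL, hR] at h <;>
    simp only [ladderDist] <;> clear hL hR hn hq <;>
    generalize (a : ℕ) = a at * <;> generalize (b : ℕ) = b at *
  · omega
  · obtain ⟨rfl, h⟩ := h
    split_ifs
    · omega
    · rcases h with h | h
      · exact Nat.succ_le_succ ((min_le_left _ _).trans (by omega))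
      · exact Nat.succ_le_succ ((min_le_right _ _).trans (by omega))
  · obtain ⟨rfl, h⟩ := h
    split_ifs
    · omega
    · rw [← min_add_add_right, ← min_add_add_right, le_min_iff]
      constructor <;> omega
  · split_ifs
    · omega
    · refine Nat.succ_le_succ ?_
      rw [← min_add_add_right]
      exact min_le_min (by omega) (by omega)

theorem exists_walk_length_eq_ladderDist (hn : n = 4 * p + 2 * k) (hq : q = 2 * k)
    (hp : p < n / 2) (u : Fin (n / 2) ⊕ Fin (n / 2)) :
    ∃ w : (statement15Graph n q).Walk (Sum.inl ⟨p, hp⟩) u, w.length = ladderDist p k p u := by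
  refine exists_walk_length_eq_of_descent_s15 _ ?_ ?_ u
  · rintro (j | j) h <;> simp [ladderDist] at h
    rw [Sum.inl.injEq, Fin.ext_iff]
    simp only
    omega
  · rintro (⟨j, hj⟩ | ⟨j, hj⟩) h
    · rcases lt_trichotomy j p with hlt | heq | hgt
      · exact ⟨Sum.inl ⟨j + 1, by omega⟩, by simp, by simp [ladderDist]; omega⟩
      · simp [ladderDist, heq] at h
      · exact ⟨Sum.inl ⟨j - 1, by omega⟩, by simp; omega, by simp [ladderDist]; omega⟩
    · rcases lt_trichotomy j p with hlt | heq | hgt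
      · exact ⟨Sum.inr ⟨j + 1, by omega⟩, by simp, by simp [ladderDist]; omega⟩
      · exact ⟨Sum.inl ⟨j, hj⟩, by simp; omega, by simp [ladderDist, heq]⟩
      · exact ⟨Sum.inr ⟨j - 1, by omega⟩, by simp; omega, by simp [ladderDist]; omega⟩

theorem statement15Graph_connected (hk : 2 ≤ k) (hn : n = 4 * p + 2 * k) (hq : q = 2 * k) :
    (statement15Graph n q).Connected := by
  have hp : p < n / 2 := by omega
  have h u := (exists_walk_length_eq_ladderDist hn hq hp u).choose.reachable
  exact (connected_iff_exists_forall_reachable _).2 ⟨_, h⟩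

theorem ladderDist_le_dist_inl (hk : 2 ≤ k) (hn : n = 4 * p + 2 * k) (hq : q = 2 * k)
    (i : Fin (n / 2)) (u : Fin (n / 2) ⊕ Fin (n / 2)) :
    ladderDist p k i u ≤ (statement15Graph n q).dist (Sum.inl i) u :=
  le_dist_of_adj_le _ (by simp [ladderDist]) (ladderDist_le_of_adj hk hn hq i)
    ((statement15Graph_connected hk hn hq).preconnected _ _)

theorem ladderDist_swap_le_dist_inr (hk : 2 ≤ k) (hn : n = 4 * p + 2 * k) (hq : q = 2 * k)
    (i : Fin (n / 2)) (u : Fin (n / 2) ⊕ Fin (n / 2)) :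
    ladderDist p k i u.swap ≤ (statement15Graph n q).dist (Sum.inr i) u :=
  le_dist_of_adj_le (fun u => ladderDist p k i u.swap) (by simp [ladderDist])
    (fun x y h => ladderDist_le_of_adj hk hn hq i _ _ ((statement15Graph_adj_swap x y).2 h))
    ((statement15Graph_connected hk hn hq).preconnected _ _)

theorem sum_pairDist_fin (hn : n = 4 * p + 2 * k) :
    ∑ j : Fin (n / 2), pairDist p k j = 2 * p ^ 2 + 2 * p * k + k ^ 2 + 2 * p := by
  rw [Fin.sum_univ_eq_sum_range, show n / 2 = 2 * p + k by omega, sum_pairDist]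

theorem sum_ladderDist (i : ℕ) (m : ℕ) :
    ∑ u : Fin m ⊕ Fin m, ladderDist p k i u =
      ∑ j : Fin m, (ladderDist p k i (Sum.inl j) + ladderDist p k i (Sum.inr j.rev)) := by
  rw [Fintype.sum_sum_type, sum_add_distrib]
  congr 1
  exact (Equiv.sum_comp Fin.revPerm fun j : Fin m => ladderDist p k i (Sum.inr j)).symm

theorem le_sum_ladderDist (hk : 2 ≤ k) (hn : n = 4 * p + 2 * k) (i : Fin (n / 2)) :
    2 * p ^ 2 + 2 * p * k + k ^ 2 + 2 * p ≤
      ∑ u : Fin (n / 2) ⊕ Fin (n / 2), ladderDist p k i u := by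
  rw [sum_ladderDist, ← sum_pairDist_fin hn]
  refine sum_le_sum fun j _ => ?_
  have hi : (i : ℕ) < 2 * p + k := by omega
  have hj : (j : ℕ) < 2 * p + k := by omega
  have hm : n / 2 = 2 * p + k := by omega
  simp only [ladderDist, pairDist, Fin.val_rev, hm]
  generalize (i : ℕ) = i at *
  generalize (j : ℕ) = j at *
  clear hm hn
  rw [max_le_iff, max_le_iff]
  split_ifs
  · refine ⟨?_, ?_, ?_⟩ <;> omega
  · rw [← add_assoc, ← min_add_add_left, ← min_add_add_right]
    simp only [le_min_iff]
    refine ⟨⟨?_, ?_⟩, ⟨?_, ?_⟩, ?_, ?_⟩ <;> rcases le_total j i with h | h <;> omega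

theorem sum_ladderDist_eq (hk : 2 ≤ k) (hn : n = 4 * p + 2 * k) :
    ∑ u : Fin (n / 2) ⊕ Fin (n / 2), ladderDist p k p u =
      2 * p ^ 2 + 2 * p * k + k ^ 2 + 2 * p := by
  rw [sum_ladderDist, ← sum_pairDist_fin hn]
  refine sum_congr rfl fun j _ => ?_
  have := j.2
  simp only [ladderDist, pairDist, Fin.val_rev, le_refl, true_or, if_true]
  omega

theorem le_sum_dist (hk : 2 ≤ k) (hn : n = 4 * p + 2 * k) (hq : q = 2 * k)
    (v : Fin (n / 2) ⊕ Fin (n / 2)) :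
    2 * p ^ 2 + 2 * p * k + k ^ 2 + 2 * p ≤ ∑ u, (statement15Graph n q).dist v u := by
  rcases v with i | i <;> refine (le_sum_ladderDist hk hn i).trans ?_
  · exact sum_le_sum fun u _ => ladderDist_le_dist_inl hk hn hq i u
  · rw [← Equiv.sum_comp (Equiv.sumComm (Fin (n / 2)) (Fin (n / 2)))]
    exact sum_le_sum fun u _ => ladderDist_swap_le_dist_inr hk hn hq i u

theorem exists_sum_dist_eq (hk : 2 ≤ k) (hn : n = 4 * p + 2 * k) (hq : q = 2 * k) :
    ∃ v, ∑ u, (statement15Graph n q).dist v u = 2 * p ^ 2 + 2 * p * k + k ^ 2 + 2 * p := by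
  have hp : p < n / 2 := by omega
  refine ⟨Sum.inl ⟨p, hp⟩, le_antisymm ?_ (le_sum_dist hk hn hq _)⟩
  rw [← sum_ladderDist_eq hk hn]
  refine sum_le_sum fun u _ => ?_
  obtain ⟨w, hw⟩ := exists_walk_length_eq_ladderDist hn hq hp u
  exact hw ▸ dist_le w

end Distances

/-- Let `q ≥ 4` be even and `n ≥ q` with `4 ∣ n - q`. Then the
proximity of `H_{n,q}` equals `(n+5)/8 + (q² - 4q + 5)/(8(n-1))`. -/
theorem proximity_statement15Graph (n q : ℕ) (hq4 : 4 ≤ q) (hqe : Even q)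
    (hnq : q ≤ n) (hdiv : 4 ∣ (n - q)) :
    (⨅ v : Fin (n / 2) ⊕ Fin (n / 2),
        (∑ u, ((statement15Graph n q).dist v u : ℝ)) / (n - 1)) =
      ((n : ℝ) + 5) / 8 + ((q : ℝ) ^ 2 - 4 * q + 5) / (8 * ((n : ℝ) - 1)) := by
  obtain ⟨k, hk⟩ := hqe
  obtain ⟨p, hp⟩ := hdiv
  have hk2 : 2 ≤ k := by omega
  have hq : q = 2 * k := by omega
  have hn : n = 4 * p + 2 * k := by omega
  have hn1 : (0 : ℝ) < n - 1 := by
    have : (1 : ℝ) < n := by exact_mod_cast (by omega : 1 < n)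
    linarith
  have hval : ((n : ℝ) + 5) / 8 + ((q : ℝ) ^ 2 - 4 * q + 5) / (8 * ((n : ℝ) - 1)) =
      ((2 * p ^ 2 + 2 * p * k + k ^ 2 + 2 * p : ℕ) : ℝ) / (n - 1) := by
    have hnR : (n : ℝ) = 4 * p + 2 * k := by exact_mod_cast hn
    have hqR : (q : ℝ) = 2 * k := by exact_mod_cast hq
    have := hn1.ne'
    field_simp
    push_cast
    rw [hnR, hqR]
    ring
  rw [hval]
  obtain ⟨v, hv⟩ := exists_sum_dist_eq hk2 hn hq
  have : Nonempty (Fin (n / 2) ⊕ Fin (n / 2)) := ⟨v⟩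
  refine le_antisymm ((ciInf_le (Set.finite_range _).bddBelow v).trans_eq ?_)
    (le_ciInf fun u => ?_)
  · rw [← hv]
    push_cast
    rfl
  · refine div_le_div_of_nonneg_right ?_ hn1.le
    exact_mod_cast le_sum_dist hk2 hn hq u
end
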